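/- There exists a Noetherian group whose Schur multiplier H₂(H, ℤ) is not a finitely generated abelian group. -/

import Mathlib

/-- A group is *Noetherian* if every subgroup is finitely generated. -/
def IsNoetherianGroup (G : Type*) [Group G] : Prop := ∀ K : Subgroup G, K.FG

/-- The *Schur multiplier* `H₂(G, ℤ)` of a group `G`, via Hopf's formula:
`H₂(G, ℤ) ≅ (R ⊓ [F, F]) / ⁅F, R⁆`, where `F` is the free group on the underlying set of `G`
and `R` is the kernel of the canonical projection `F → G`. -/
def SchurMultiplier (G : Type*) [Group G] :=
  ((FreeGroup.lift (id : G → G)).ker ⊓ commutator (FreeGroup G)).map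
    (QuotientGroup.mk' ⁅(⊤ : Subgroup (FreeGroup G)), (FreeGroup.lift (id : G → G)).ker⁆)

/-- `a` and `b` differ by at most `c`. -/
abbrev Near (a b c : ℤ) : Prop := a - b ≤ c ∧ b - a ≤ c

/-- The left-invariant distance attached to a length function. -/
def ds {G : Type*} [Group G] (ℓ : G → ℤ) (x y : G) : ℤ := ℓ (x⁻¹ * y)

/-- A proper geodesic integer-valued length function that is hyperbolic. -/
structure HypLen {G : Type*} [Group G] (ℓ : G → ℤ) (δ : ℤ) : Prop where
  nonneg : ∀ g, 0 ≤ ℓ g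
  one : ℓ 1 = 0
  eq_one : ∀ g, ℓ g ≤ 0 → g = 1
  inv : ∀ g, ℓ g⁻¹ = ℓ g
  mul : ∀ g h, ℓ (g * h) ≤ ℓ g + ℓ h
  geod : ∀ g k, 0 ≤ k → k ≤ ℓ g → ∃ p, ℓ p = k ∧ ℓ (p⁻¹ * g) = ℓ g - k
  fin : ∀ n, {g | ℓ g ≤ n}.Finite
  dpos : 1 ≤ δ
  hyp : ∀ x y z w, ds ℓ x y + ds ℓ z w ≤ ds ℓ x z + ds ℓ y w + δ ∨
    ds ℓ x y + ds ℓ z w ≤ ds ℓ x w + ds ℓ y z + δ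

namespace HypLen

variable {G : Type*} [Group G] {ℓ : G → ℤ} {δ : ℤ}

theorem ds_self (H : HypLen ℓ δ) (x : G) : ds ℓ x x = 0 := by simp [ds, H.one]

theorem ds_nonneg (H : HypLen ℓ δ) (x y : G) : 0 ≤ ds ℓ x y := H.nonneg _

theorem ds_comm (H : HypLen ℓ δ) (x y : G) : ds ℓ x y = ds ℓ y x := by
  unfold ds; rw [← H.inv]; simp

theorem ds_tri (H : HypLen ℓ δ) (x y z : G) : ds ℓ x z ≤ ds ℓ x y + ds ℓ y z := by
  have := H.mul (x⁻¹ * y) (y⁻¹ * z)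
  simpa [ds, mul_assoc] using this

theorem eq_of_ds (H : HypLen ℓ δ) {x y : G} (h : ds ℓ x y ≤ 0) : x = y :=
  (inv_mul_eq_one.mp (H.eq_one _ h))

theorem exists_between (H : HypLen ℓ δ) (x y : G) (k : ℤ) (h0 : 0 ≤ k) (h1 : k ≤ ds ℓ x y) :
    ∃ p, ds ℓ x p = k ∧ ds ℓ p y = ds ℓ x y - k := by
  obtain ⟨p, hp, hp'⟩ := H.geod _ k h0 h1
  refine ⟨x * p, ?_, ?_⟩
  · simpa [ds] using hp
  · simpa [ds, mul_assoc] using hp'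

end HypLen

theorem ds_mul_left {G : Type*} [Group G] (ℓ : G → ℤ) (g x y : G) :
    ds ℓ (g * x) (g * y) = ds ℓ x y := by
  unfold ds; congr 1; group

theorem ds_one_left {G : Type*} [Group G] (ℓ : G → ℤ) (x : G) : ds ℓ 1 x = ℓ x := by simp [ds]

/-- `p` lies on a geodesic from `x` to `y`. -/
def Btn {G : Type*} [Group G] (ℓ : G → ℤ) (x y p : G) : Prop :=
  ds ℓ x p + ds ℓ p y = ds ℓ x y

theorem btn_mul_left {G : Type*} [Group G] {ℓ : G → ℤ} (g : G) {x y p : G} :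
    Btn ℓ (g * x) (g * y) (g * p) ↔ Btn ℓ x y p := by
  simp [Btn, ds_mul_left]

namespace HypLen

variable {G : Type*} [Group G] {ℓ : G → ℤ} {δ : ℤ}

theorem btn_left (H : HypLen ℓ δ) (x y : G) : Btn ℓ x y x := by simp [Btn, H.ds_self]
theorem btn_right (H : HypLen ℓ δ) (x y : G) : Btn ℓ x y y := by simp [Btn, H.ds_self]
theorem btn_comm (H : HypLen ℓ δ) {x y p : G} (h : Btn ℓ x y p) : Btn ℓ y x p := by
  unfold Btn at *
  rw [H.ds_comm y p, H.ds_comm p x, H.ds_comm y x]; omega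

theorem btn_trans (H : HypLen ℓ δ) {x y p q : G} (h : Btn ℓ x y p) (h' : Btn ℓ x p q) :
    Btn ℓ x y q := by
  unfold Btn at *
  have h1 := H.ds_tri q p y
  have h2 := H.ds_tri x q y
  omega

theorem btn_trans' (H : HypLen ℓ δ) {x y p q : G} (h : Btn ℓ x y p) (h' : Btn ℓ p y q) :
    Btn ℓ x y q := H.btn_comm (H.btn_trans (H.btn_comm h) (H.btn_comm h'))

/-- If `q` is between `p` and `y`, and `p` is between `x` and `y`, then `p` is between `x`, `q`. -/
theorem btn_sub (H : HypLen ℓ δ) {x y p q : G} (h : Btn ℓ x y p) (h' : Btn ℓ p y q) :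
    Btn ℓ x q p := by
  unfold Btn at *
  have h1 := H.ds_tri x p q
  have h2 := H.ds_tri x q y
  omega

/-- Geodesic triangles are thin. -/
theorem thin (H : HypLen ℓ δ) {x y P : G} (z : G) (hP : Btn ℓ x y P) :
    ∃ Q, (Btn ℓ x z Q ∨ Btn ℓ z y Q) ∧ ds ℓ P Q ≤ 2 * δ := by
  have hd := H.dpos
  have n1 := H.ds_nonneg x P
  have n2 := H.ds_nonneg P y
  have n3 := H.ds_nonneg z P
  unfold Btn at *
  have c1 := H.ds_comm z y
  have c2 := H.ds_comm z x
  have c3 := H.ds_comm z P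
  have c4 := H.ds_comm P y
  have c5 := H.ds_comm x P
  rcases H.hyp x y z P with h | h
  · -- `P` is close to `[x,z]`
    by_cases hk : ds ℓ x P ≤ ds ℓ x z
    · obtain ⟨Q, hQ, hQ'⟩ := H.exists_between x z (ds ℓ x P) n1 hk
      refine ⟨Q, Or.inl (by omega), ?_⟩
      have e1 := H.ds_comm Q z
      have e2 := H.ds_comm Q x
      have e3 := H.ds_comm Q P
      rcases H.hyp x z P Q with h' | h' <;> omega
    · refine ⟨z, Or.inl (by rw [H.ds_self]; omega), ?_⟩
      omega
  · by_cases hk : ds ℓ y P ≤ ds ℓ y z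
    · obtain ⟨Q, hQ, hQ'⟩ := H.exists_between y z (ds ℓ y P) (H.ds_nonneg _ _) hk
      have e1 := H.ds_comm Q z
      have e2 := H.ds_comm Q y
      have e3 := H.ds_comm Q P
      refine ⟨Q, Or.inr (by omega), ?_⟩
      rcases H.hyp y z P Q with h' | h' <;> omega
    · refine ⟨z, Or.inr (by rw [H.ds_self]; omega), ?_⟩
      omega

end HypLen

/-- Coarse projection data for the axis of `r`: `b` measures (twice) the position along the axis,
`h` (twice) the distance to it. -/
structure AxisData {G : Type*} [Group G] (ℓ : G → ℤ) (δ : ℤ) (r : G) (σ L : ℤ) (b h : G → ℤ) :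
    Prop where
  sig : 10 * δ ≤ σ
  big : 1000000 * σ ≤ L
  hnn : ∀ x, 0 ≤ h x
  b_lip : ∀ x y, b x - b y ≤ 2 * ds ℓ x y
  h_lip : ∀ x y, h x - h y ≤ 2 * ds ℓ x y
  upper : ∀ x y, 2 * ds ℓ x y ≤ h x + h y + (b x - b y) + σ ∨
    2 * ds ℓ x y ≤ h x + h y + (b y - b x) + σ
  lower : ∀ x y, b x - b y > σ → h x + h y + (b x - b y) ≤ 2 * ds ℓ x y + σ
  br : b r = L
  shift : ∀ (k : ℤ) x, Near (b (r ^ k * x)) (b x + b (r ^ k)) σ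
  hshift : ∀ (k : ℤ) x, Near (h (r ^ k * x)) (h x) σ
  behr : ∀ g x, g ∉ Subgroup.zpowers r → ¬ Near (b x) (b g) σ →
    Near (b (g⁻¹ * x)) (b g⁻¹) σ
  near : ∀ g p, g ∉ Subgroup.zpowers r → Near (b p) (b g) (h (g⁻¹ * p) + σ)
  h1 : h 1 ≤ σ
  b1 : b 1 = 0

namespace AxisData

variable {G : Type*} [Group G] {ℓ : G → ℤ} {δ : ℤ} {r : G} {σ L : ℤ} {b h : G → ℤ}

/-- The data based at the translate `g`. -/
theorem lower' (A : AxisData ℓ δ r σ L b h) (H : HypLen ℓ δ) (x y : G) :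
    Near (b x) (b y) σ ∨ (h x + h y + (b x - b y) ≤ 2 * ds ℓ x y + σ ∧
      h x + h y + (b y - b x) ≤ 2 * ds ℓ x y + σ) := by
  have h1 := A.lower x y
  have h2 := A.lower y x
  have h3 := A.sig
  have h4 := H.dpos
  rw [H.ds_comm y x] at h2
  by_cases c1 : b x - b y > σ
  · right; have := h1 c1; omega
  · by_cases c2 : b y - b x > σ
    · right; have := h2 c2; omega
    · left; omega

/-- A geodesic whose projection is long comes close to the axis. -/
theorem hit (A : AxisData ℓ δ r σ L b h) (H : HypLen ℓ δ) (x y : G) (s : ℤ)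
    (hs : 0 ≤ s) (hs' : s + 3 * σ ≤ b y - b x) :
    ∃ q, Btn ℓ x y q ∧ h q ≤ 4 * σ ∧ Near (b q) (b x + s) (5 * σ) := by
  have e1 := A.sig
  have e2 := H.dpos
  have e3 := A.lower y x (by omega)
  rw [H.ds_comm y x] at e3
  have e4 := A.upper x y
  have n1 := A.hnn x
  have n2 := A.hnn y
  obtain ⟨q, hq, hq'⟩ := H.exists_between x y ((h x + s) / 2) (by omega) (by omega)
  have e5 := A.lower' H x q
  have e6 := A.lower' H q y
  have n3 := A.hnn q
  refine ⟨q, ?_, ?_, ?_⟩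
  · unfold Btn; omega
  · omega
  · omega

/-- Betweenness for projections. -/
theorem between (A : AxisData ℓ δ r σ L b h) (H : HypLen ℓ δ) {x y p : G} (s : ℤ) (hs : 0 ≤ s)
    (hp : ds ℓ x p + ds ℓ p y ≤ ds ℓ x y + s) :
    (b p ≤ b x + s + 2 * σ ∨ b p ≤ b y + s + 2 * σ) ∧
    (b x - s - 2 * σ ≤ b p ∨ b y - s - 2 * σ ≤ b p) := by
  have e1 := A.sig
  have e2 := H.dpos
  have e4 := A.upper x y
  have e5 := A.lower' H x p
  have e6 := A.lower' H p y
  have n3 := A.hnn p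
  omega

/-- Far from the axis, a point between is near an end. -/
theorem ends (A : AxisData ℓ δ r σ L b h) (H : HypLen ℓ δ) {x y p : G}
    (hp : Btn ℓ x y p) (hh : 2 * σ < h p) : Near (b p) (b x) σ ∨ Near (b p) (b y) σ := by
  have e1 := A.sig
  have e2 := H.dpos
  have e4 := A.upper x y
  have e5 := A.lower' H x p
  have e6 := A.lower' H p y
  unfold Btn at hp
  omega

theorem pow_succ_pos (A : AxisData ℓ δ r σ L b h) (k : ℤ) :
    Near (b (r ^ (k + 1))) (b (r ^ k) + L) σ := by
  have h1 := A.shift 1 (r ^ k)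
  rw [← zpow_add, add_comm, zpow_one, A.br] at h1
  omega

theorem pow_nat (A : AxisData ℓ δ r σ L b h) (k : ℕ) :
    L - σ ≤ b (r ^ ((k : ℤ) + 1)) := by
  induction k with
  | zero =>
    have h1 := A.pow_succ_pos 0
    simp only [zpow_zero, A.b1] at h1
    simp only [Nat.cast_zero]
    omega
  | succ n ih =>
    have h1 := A.pow_succ_pos (n + 1)
    have := A.big
    have h3 := A.shift 0 1
    simp only [zpow_zero, mul_one, A.b1] at h3
    push_cast
    omega

/-- Nontrivial powers of `r` move far along the axis. -/
theorem pow_far (A : AxisData ℓ δ r σ L b h) (k : ℤ) (hk : k ≠ 0) :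
    L - 2 * σ ≤ b (r ^ k) ∨ b (r ^ k) ≤ - (L - 2 * σ) := by
  have h3 := A.shift 0 1
  simp only [zpow_zero, mul_one, A.b1] at h3
  rcases lt_or_gt_of_ne hk with h | h
  · right
    obtain ⟨n, rfl⟩ : ∃ n : ℕ, k = - ((n : ℤ) + 1) := ⟨(-k - 1).toNat, by omega⟩
    have h1 := A.pow_nat n
    have h2 := A.shift (-((n : ℤ) + 1)) (r ^ ((n : ℤ) + 1))
    rw [← zpow_add, neg_add_cancel, zpow_zero, A.b1] at h2
    omega
  · left
    obtain ⟨n, rfl⟩ : ∃ n : ℕ, k = (n : ℤ) + 1 := ⟨(k - 1).toNat, by omega⟩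
    have h1 := A.pow_nat n
    omega

theorem sig_pos (A : AxisData ℓ δ r σ L b h) (H : HypLen ℓ δ) : 10 ≤ σ := by
  have := A.sig; have := H.dpos; omega

/-- Powers of `r` act almost by translations on pairs. -/
theorem shift_diff (A : AxisData ℓ δ r σ L b h) (k : ℤ) (x y : G) :
    Near (b (r ^ k * x) - b (r ^ k * y)) (b x - b y) (2 * σ) := by
  have h1 := A.shift k x
  have h2 := A.shift k y
  omega

theorem h_pow (A : AxisData ℓ δ r σ L b h) (k : ℤ) : h (r ^ k) ≤ 2 * σ := by
  have h1 := A.hshift k 1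
  have h2 := A.h1
  rw [mul_one] at h1
  omega

theorem overlap (A : AxisData ℓ δ r σ L b h) {g : G} (hg : g ∉ Subgroup.zpowers r) (k : ℤ) :
    Near (b (g * r ^ k)) (b g) (3 * σ) := by
  have h1 := A.near g (g * r ^ k) hg
  have h2 := A.h_pow k
  rw [inv_mul_cancel_left] at h1
  omega

/-- Some power of `r` moves a value of `b` into a fundamental interval. -/
theorem exists_pow (A : AxisData ℓ δ r σ L b h) (H : HypLen ℓ δ) (t : ℤ) (y : G) :
    ∃ k : ℤ, Near t (b (r ^ k * y)) ((L + σ) / 2 + 1) := by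
  have hs := A.sig_pos H
  have hb := A.big
  have step : ∀ k : ℤ, Near (b (r ^ (k + 1) * y)) (b (r ^ k * y) + L) σ := by
    intro k
    have h1 := A.shift 1 (r ^ k * y)
    rw [← mul_assoc, ← zpow_add, add_comm, zpow_one, A.br] at h1
    omega
  suffices ∀ n : ℕ, ∀ k : ℤ, Near t (b (r ^ k * y)) n →
      ∃ k : ℤ, Near t (b (r ^ k * y)) ((L + σ) / 2 + 1) by
    exact this (t - b (r ^ (0 : ℤ) * y)).natAbs 0 (by omega)
  intro n
  induction n using Nat.strong_induction_on with
  | _ n ih =>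
    intro k hk
    by_cases hc : Near t (b (r ^ k * y)) ((L + σ) / 2 + 1)
    · exact ⟨k, hc⟩
    · have s1 := step k
      have s2 := step (k - 1)
      rw [sub_add_cancel] at s2
      by_cases c : t ≤ b (r ^ k * y)
      · exact ih (n - 1) (by omega) (k - 1) (by omega)
      · exact ih (n - 1) (by omega) (k + 1) (by omega)

/-- Minimal pairs modulo a normal subgroup containing `r` have short projections. -/
theorem reduced_near (A : AxisData ℓ δ r σ L b h) (H : HypLen ℓ δ) {N : Subgroup G} [N.Normal]
    (hr : r ∈ N) {x y : G} (hxy : ∀ n ∈ N, ds ℓ x y ≤ ds ℓ x (n * y)) (g : G) :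
    2 * (b (g⁻¹ * x) - b (g⁻¹ * y)) ≤ L + 10 * σ ∧ 2 * (b (g⁻¹ * y) - b (g⁻¹ * x)) ≤ L + 10 * σ := by
  have hs := A.sig_pos H
  have hb := A.big
  have key : ∀ k : ℤ, ds ℓ (g⁻¹ * x) (g⁻¹ * y) ≤ ds ℓ (g⁻¹ * x) (r ^ k * (g⁻¹ * y)) := by
    intro k
    have h1 := hxy (g * r ^ k * g⁻¹) (Subgroup.Normal.conj_mem ‹_› _ (N.zpow_mem hr k) g)
    rw [ds_mul_left, ← ds_mul_left ℓ g (g⁻¹ * x)]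
    simpa [mul_assoc] using h1
  generalize g⁻¹ * x = X at *
  generalize g⁻¹ * y = Y at *
  have k1 := key 1
  have k2 := key (-1)
  have s1 := A.shift 1 Y
  have s2 := A.shift (-1) (r ^ (1 : ℤ) * Y)
  have s3 := A.shift (-1) Y
  have t1 := A.hshift 1 Y
  have t3 := A.hshift (-1) Y
  have u1 := A.upper X (r ^ (1 : ℤ) * Y)
  have u2 := A.upper X (r ^ (-1 : ℤ) * Y)
  have l := A.lower' H X Y
  simp only [zpow_neg, zpow_one, inv_mul_cancel_left, A.br] at *
  omega

end AxisData

namespace AxisData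

variable {G : Type*} [Group G] {ℓ : G → ℤ} {δ : ℤ} {r : G} {σ L : ℤ} {b h : G → ℤ}

theorem behr' (A : AxisData ℓ δ r σ L b h) {y z : G} (x : G)
    (hyz : z⁻¹ * y ∉ Subgroup.zpowers r) (hx : ¬ Near (b (z⁻¹ * x)) (b (z⁻¹ * y)) σ) :
    Near (b (y⁻¹ * x)) (b (y⁻¹ * z)) σ := by
  have := A.behr _ _ hyz hx
  simpa [mul_assoc] using this

theorem near' (A : AxisData ℓ δ r σ L b h) {y z : G} (p : G)
    (hyz : z⁻¹ * y ∉ Subgroup.zpowers r) :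
    Near (b (z⁻¹ * p)) (b (z⁻¹ * y)) (h (y⁻¹ * p) + σ) := by
  have := A.near _ (z⁻¹ * p) hyz
  simpa [mul_assoc] using this

end AxisData

theorem not_mem_zpowers_symm {G : Type*} [Group G] {r y z : G}
    (h : z⁻¹ * y ∉ Subgroup.zpowers r) : y⁻¹ * z ∉ Subgroup.zpowers r := by
  intro h'
  apply h
  have := (Subgroup.zpowers r).inv_mem h'
  simpa using this

/-- The union of the geodesics with endpoints in `A`. -/
def Hull {G : Type*} [Group G] (ℓ : G → ℤ) (A : Set G) : Set G :=
  {p | ∃ x ∈ A, ∃ y ∈ A, Btn ℓ x y p}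

/-- Reduced products of rotations about lines in `V`; the first argument is the first line. -/
inductive RW {E G : Type*} [Group E] [Group G] (π : E →* G) (rh : E) (V : Set E) : E → E → Prop
  | single (g : E) (k : ℤ) : g ∈ V → k ≠ 0 → RW π rh V g (g * rh ^ k * g⁻¹)
  | cons (g : E) (k : ℤ) (g₁ w : E) : g ∈ V → k ≠ 0 → RW π rh V g₁ w →
      (π g)⁻¹ * π g₁ ∉ Subgroup.zpowers (π rh) → RW π rh V g (g * rh ^ k * g⁻¹ * w)

section Windmill

variable {E G : Type*} [Group E] [Group G] {π : E →* G} {rh : E}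

theorem rot_eq (hker : ∀ z, π z = 1 → ∀ e, z * e = e * z) {g y : E}
    (hgy : (π g)⁻¹ * π y ∈ Subgroup.zpowers (π rh)) (j : ℤ) :
    y * rh ^ j * y⁻¹ = g * rh ^ j * g⁻¹ := by
  obtain ⟨k, hk⟩ := hgy
  have hz : π ((g * rh ^ k)⁻¹ * y) = 1 := by
    simp only at hk
    rw [map_mul, map_inv, map_mul, map_zpow, hk]; group
  have hc := hker _ hz (rh ^ j)
  obtain ⟨z, hzz⟩ : ∃ z, z = (g * rh ^ k)⁻¹ * y := ⟨_, rfl⟩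
  rw [← hzz] at hc
  have hy : y = g * rh ^ k * z := by rw [hzz]; group
  rw [hy]
  calc g * rh ^ k * z * rh ^ j * (g * rh ^ k * z)⁻¹
      = g * rh ^ k * (z * rh ^ j) * z⁻¹ * (rh ^ k)⁻¹ * g⁻¹ := by group
    _ = g * rh ^ j * g⁻¹ := by rw [hc]; group

theorem RW.mem {V : Set E} {g w : E} (hw : RW π rh V g w) : g ∈ V := by
  cases hw <;> assumption

theorem RW.conj {V : Set E} {m g w : E} (hV : ∀ g ∈ V, m * g ∈ V) (hw : RW π rh V g w) :
    RW π rh V (m * g) (m * w * m⁻¹) := by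
  induction hw with
  | single g k hg hk =>
    have := RW.single (π := π) (rh := rh) (m * g) k (hV g hg) hk
    convert this using 1; group
  | cons g k g₁ w hg hk _ hn ih =>
    have := RW.cons (π := π) (rh := rh) (m * g) k _ _ (hV g hg) hk ih (by
      convert hn using 2; simp only [map_mul]; group)
    convert this using 1; group

/-- Elements of the enlarged group are reduced products. -/
theorem RW.decomp (hker : ∀ z, π z = 1 → ∀ e, z * e = e * z) {V : Set E} {M : Subgroup E}
    (hV : ∀ m ∈ M, ∀ g ∈ V, m * g ∈ V) {y : E}
    (hy : y ∈ Subgroup.closure ((M : Set E) ∪ {x | ∃ g ∈ V, ∃ k : ℤ, x = g * rh ^ k * g⁻¹})) :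
    ∃ w, ∃ m ∈ M, y = w * m ∧ (w = 1 ∨ ∃ g, RW π rh V g w) := by
  have step : ∀ x ∈ ((M : Set E) ∪ {x | ∃ g ∈ V, ∃ k : ℤ, x = g * rh ^ k * g⁻¹}), ∀ y,
      (∃ w, ∃ m ∈ M, y = w * m ∧ (w = 1 ∨ ∃ g, RW π rh V g w)) →
      (∃ w, ∃ m ∈ M, x * y = w * m ∧ (w = 1 ∨ ∃ g, RW π rh V g w)) := by
    rintro x hx y ⟨w, m, hm, rfl, hw⟩
    rcases hx with hx | ⟨g, hg, k, rfl⟩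
    · refine ⟨x * w * x⁻¹, x * m, M.mul_mem hx hm, by group, ?_⟩
      rcases hw with rfl | ⟨g, hw⟩
      · left; simp
      · right; exact ⟨_, hw.conj (hV x hx)⟩
    · by_cases hk : k = 0
      · refine ⟨w, m, hm, by simp [hk], hw⟩
      refine ⟨g * rh ^ k * g⁻¹ * w, m, hm, by group, ?_⟩
      rcases hw with rfl | ⟨g₁, hw⟩
      · right; exact ⟨g, by simpa using RW.single (π := π) (rh := rh) g k hg hk⟩
      by_cases hn : (π g)⁻¹ * π g₁ ∈ Subgroup.zpowers (π rh)
      · rw [← rot_eq hker hn k]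
        cases hw with
        | single _ k₁ hg₁ hk₁ =>
          have e : g₁ * rh ^ k * g₁⁻¹ * (g₁ * rh ^ k₁ * g₁⁻¹) = g₁ * rh ^ (k + k₁) * g₁⁻¹ := by
            rw [zpow_add]; group
          rw [e]
          by_cases hs : k + k₁ = 0
          · left; simp [hs]
          · right; exact ⟨_, RW.single _ _ hg₁ hs⟩
        | cons _ k₁ g₂ w₂ hg₁ hk₁ hw₂ hn₂ =>
          have e : g₁ * rh ^ k * g₁⁻¹ * (g₁ * rh ^ k₁ * g₁⁻¹ * w₂)
              = g₁ * rh ^ (k + k₁) * g₁⁻¹ * w₂ := by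
            rw [zpow_add]; group
          rw [e]
          by_cases hs : k + k₁ = 0
          · right; exact ⟨g₂, by simpa [hs] using hw₂⟩
          · right; exact ⟨_, RW.cons _ _ _ _ hg₁ hs hw₂ hn₂⟩
      · right; exact ⟨_, RW.cons _ _ _ _ hg hk hw hn⟩
  refine Subgroup.closure_induction_left
    (p := fun y _ => ∃ w, ∃ m ∈ M, y = w * m ∧ (w = 1 ∨ ∃ g, RW π rh V g w)) ?_ ?_ ?_ hy
  · exact ⟨1, 1, M.one_mem, by simp, Or.inl rfl⟩
  · intro x hx y _ h
    exact step x hx y h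
  · intro x hx y _ h
    refine step x⁻¹ ?_ y h
    rcases hx with hx | ⟨g, hg, k, rfl⟩
    · exact Or.inl (M.inv_mem hx)
    · exact Or.inr ⟨g, hg, -k, by simp [mul_assoc]⟩

variable {ℓ : G → ℤ} {δ : ℤ} {σ L : ℤ} {b h : G → ℤ}

/-- One stage of the windmill. -/
structure Wind (ℓ : G → ℤ) (π : E →* G) (rh : E) (σ L : ℤ) (b : G → ℤ) (M : Subgroup E)
    (A : Set G) : Prop where
  one_mem : 1 ∈ A
  inv : ∀ m ∈ M, ∀ x ∈ A, π m * x ∈ A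
  small : ∀ g, g * rh * g⁻¹ ∉ M → ∀ x ∈ A, ∀ y ∈ A,
    Near (b ((π g)⁻¹ * x)) (b ((π g)⁻¹ * y)) (30 * σ)
  dehn : ∀ m ∈ M, m ≠ 1 → ∃ g, ¬ Near (b ((π g)⁻¹)) (b ((π g)⁻¹ * π m)) (L - 100 * σ)

/-- The lines not yet rotated about that come close to the hull. -/
def newLines (ℓ : G → ℤ) (π : E →* G) (rh : E) (σ : ℤ) (h : G → ℤ) (M : Subgroup E)
    (A : Set G) : Set E :=
  {g | g * rh * g⁻¹ ∉ M ∧ ∃ p ∈ Hull ℓ A, h ((π g)⁻¹ * p) ≤ 4 * σ}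

section Step

variable {M : Subgroup E} {A : Set G}

theorem newLines_mul (W : Wind ℓ π rh σ L b M A) {m g : E} (hm : m ∈ M)
    (hg : g ∈ newLines ℓ π rh σ h M A) : m * g ∈ newLines ℓ π rh σ h M A := by
  obtain ⟨h1, p, ⟨x, hx, y, hy, hp⟩, h2⟩ := hg
  refine ⟨fun hc => h1 ?_, π m * p, ⟨π m * x, W.inv m hm x hx, π m * y, W.inv m hm y hy,
    (btn_mul_left _).2 hp⟩, ?_⟩
  · have := M.mul_mem (M.mul_mem (M.inv_mem hm) hc) hm
    convert this using 1; group
  · convert h2 using 2; simp only [map_mul]; group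

theorem hull_near (D : AxisData ℓ δ (π rh) σ L b h) (H : HypLen ℓ δ) (W : Wind ℓ π rh σ L b M A)
    {g : E} (hg : g * rh * g⁻¹ ∉ M) {p : G} (hp : p ∈ Hull ℓ A) :
    Near (b ((π g)⁻¹ * p)) (b (π g)⁻¹) (32 * σ) := by
  obtain ⟨x, hx, y, hy, hp⟩ := hp
  have h1 := W.small g hg x hx 1 W.one_mem
  have h2 := W.small g hg y hy 1 W.one_mem
  have h3 := D.between H (x := (π g)⁻¹ * x) (y := (π g)⁻¹ * y) (p := (π g)⁻¹ * p) 0 le_rfl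
    (by simp only [ds_mul_left]; unfold Btn at hp; omega)
  have h4 := D.sig_pos H
  rw [mul_one] at h1 h2
  omega

/-- Lines far from the hull see it as a point. -/
theorem hull_small (D : AxisData ℓ δ (π rh) σ L b h) (H : HypLen ℓ δ) {g : E}
    (hg : ∀ p ∈ Hull ℓ A, ¬ h ((π g)⁻¹ * p) ≤ 4 * σ) {p q : G} (hp : p ∈ Hull ℓ A)
    (hq : q ∈ Hull ℓ A) : Near (b ((π g)⁻¹ * p)) (b ((π g)⁻¹ * q)) (9 * σ) := by
  have key : ∀ x y : G, (∀ p, Btn ℓ x y p → p ∈ Hull ℓ A) →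
      b ((π g)⁻¹ * y) - b ((π g)⁻¹ * x) ≤ 3 * σ := by
    intro x y hxy
    by_contra hc
    obtain ⟨u, hu, hu', -⟩ := D.hit H ((π g)⁻¹ * x) ((π g)⁻¹ * y) 0 le_rfl (by omega)
    refine hg (π g * u) (hxy _ ?_) (by simpa using hu')
    rw [← btn_mul_left (π g)⁻¹]
    simpa using hu
  obtain ⟨x, hx, y, hy, hp⟩ := hp
  obtain ⟨x', hx', y', hy', hq⟩ := hq
  have e1 := key x p fun u hu => ⟨x, hx, y, hy, H.btn_trans hp hu⟩
  have e2 := key p x fun u hu => ⟨x, hx, y, hy, H.btn_trans hp (H.btn_comm hu)⟩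
  have e3 := key x' q fun u hu => ⟨x', hx', y', hy', H.btn_trans hq hu⟩
  have e4 := key q x' fun u hu => ⟨x', hx', y', hy', H.btn_trans hq (H.btn_comm hu)⟩
  have e5 := key x x' fun u hu => ⟨x, hx, x', hx', hu⟩
  have e6 := key x' x fun u hu => ⟨x', hx', x, hx, hu⟩
  omega

theorem line_near (D : AxisData ℓ δ (π rh) σ L b h) (H : HypLen ℓ δ) (W : Wind ℓ π rh σ L b M A)
    {g g₁ : E} (hg : g * rh * g⁻¹ ∉ M) (hg₁ : g₁ ∈ newLines ℓ π rh σ h M A)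
    (hn : (π g)⁻¹ * π g₁ ∉ Subgroup.zpowers (π rh)) :
    Near (b ((π g)⁻¹ * π g₁)) (b (π g)⁻¹) (37 * σ) := by
  obtain ⟨h1, p, hp, h2⟩ := hg₁
  have h3 := D.near' p hn
  have h4 := hull_near D H W hg hp
  omega

theorem rot_far (D : AxisData ℓ δ (π rh) σ L b h) (H : HypLen ℓ δ) (g : E) (k : ℤ) (hk : k ≠ 0)
    (x : G) (hx : Near (b ((π g)⁻¹ * x)) (b (π g)⁻¹) (40 * σ)) :
    ¬ Near (b ((π g)⁻¹ * (π (g * rh ^ k * g⁻¹) * x))) (b (π g)⁻¹) (L - 50 * σ) := by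
  have h1 := D.pow_far k hk
  have h2 := D.shift k ((π g)⁻¹ * x)
  have h3 := D.sig_pos H
  have e : (π g)⁻¹ * (π (g * rh ^ k * g⁻¹) * x) = (π rh) ^ k * ((π g)⁻¹ * x) := by
    simp only [map_mul, map_inv, map_zpow]; group
  rw [e]
  omega

theorem near_of_far (D : AxisData ℓ δ (π rh) σ L b h) (H : HypLen ℓ δ) (W : Wind ℓ π rh σ L b M A)
    {g g₁ : E} (hg : g ∈ newLines ℓ π rh σ h M A) (hg₁ : g₁ ∈ newLines ℓ π rh σ h M A)
    (hn : (π g)⁻¹ * π g₁ ∉ Subgroup.zpowers (π rh)) {y : G}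
    (hy : ¬ Near (b ((π g₁)⁻¹ * y)) (b (π g₁)⁻¹) (38 * σ)) :
    Near (b ((π g)⁻¹ * y)) (b (π g)⁻¹) (40 * σ) := by
  have h0 := D.sig_pos H
  have h1 := line_near D H W hg₁.1 hg (not_mem_zpowers_symm hn)
  have h2 := line_near D H W hg.1 hg₁ hn
  have h3 := D.behr' y (not_mem_zpowers_symm hn) (by omega)
  omega

theorem RW.far (D : AxisData ℓ δ (π rh) σ L b h) (H : HypLen ℓ δ) (W : Wind ℓ π rh σ L b M A)
    {g w : E} (hw : RW π rh (newLines ℓ π rh σ h M A) g w) {x : G} (hx : x ∈ A) :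
    ¬ Near (b ((π g)⁻¹ * (π w * x))) (b (π g)⁻¹) (L - 50 * σ) := by
  have h0 := D.sig_pos H
  induction hw with
  | single g k hg hk =>
    refine rot_far D H g k hk x ?_
    have h1 := W.small g hg.1 x hx 1 W.one_mem
    rw [mul_one] at h1; omega
  | cons g k g₁ w hg hk hw hn ih =>
    rw [map_mul, mul_assoc]
    refine rot_far D H g k hk _ ?_
    refine near_of_far D H W hg hw.mem hn ?_
    have := D.big
    omega

theorem RW.small (D : AxisData ℓ δ (π rh) σ L b h) (H : HypLen ℓ δ)
    (hker : ∀ z, π z = 1 → ∀ e, z * e = e * z) (W : Wind ℓ π rh σ L b M A)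
    {M' : Subgroup E} (hM : M ≤ M')
    (hM' : ∀ g ∈ newLines ℓ π rh σ h M A, ∀ k : ℤ, g * rh ^ k * g⁻¹ ∈ M')
    {g w : E} (hw : RW π rh (newLines ℓ π rh σ h M A) g w) (Y : E) (hY : Y * rh * Y⁻¹ ∉ M')
    (x q : G) (hx : Near (b ((π g)⁻¹ * x)) (b (π g)⁻¹) (40 * σ)) (hq : q ∈ Hull ℓ A)
    (hxq : Near (b ((π Y)⁻¹ * x)) (b ((π Y)⁻¹ * q)) (10 * σ)) (x' : G) (hx' : x' ∈ A) :
    Near (b ((π Y)⁻¹ * x)) (b ((π Y)⁻¹ * (π w * x'))) (25 * σ) := by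
  have h0 := D.sig_pos H
  have hbig := D.big
  have hfarV : ∀ Y : E, Y * rh * Y⁻¹ ∉ M' → ∀ p ∈ Hull ℓ A, ¬ h ((π Y)⁻¹ * p) ≤ 4 * σ := by
    intro Y hY p hp hc
    have := hM' Y ⟨fun hm => hY (hM hm), p, hp, hc⟩ 1
    exact hY (by simpa using this)
  have hne : ∀ Y : E, Y * rh * Y⁻¹ ∉ M' → ∀ g ∈ newLines ℓ π rh σ h M A,
      (π g)⁻¹ * π Y ∉ Subgroup.zpowers (π rh) := by
    intro Y hY g hg hc
    apply hY
    have := rot_eq hker hc 1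
    rw [zpow_one] at this
    rw [this]
    simpa using hM' g hg 1
  -- the common first part of the inductive step
  have main : ∀ (g : E) (k : ℤ), g ∈ newLines ℓ π rh σ h M A → ∀ (Y : E) (_ : Y * rh * Y⁻¹ ∉ M')
      (x q y : G), Near (b ((π g)⁻¹ * x)) (b (π g)⁻¹) (40 * σ) → q ∈ Hull ℓ A →
      Near (b ((π Y)⁻¹ * x)) (b ((π Y)⁻¹ * q)) (10 * σ) →
      ¬ Near (b ((π g)⁻¹ * y)) (b (π g)⁻¹) (L - 50 * σ) →
      Near (b ((π Y)⁻¹ * x)) (b ((π Y)⁻¹ * y)) (25 * σ) ∨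
      ∃ p ∈ Hull ℓ A, Near (b ((π ((g * rh ^ k * g⁻¹)⁻¹ * Y))⁻¹ * (π (g * rh ^ k * g⁻¹)⁻¹ * x)))
        (b ((π ((g * rh ^ k * g⁻¹)⁻¹ * Y))⁻¹ * p)) (10 * σ) := by
    intro g k hg Y hY x q y hx hq hxq hy
    have n1 := hne Y hY g hg
    have n1' := not_mem_zpowers_symm n1
    obtain ⟨hg1, p, hp, hgp⟩ := id hg
    by_cases c1 : Near (b ((π g)⁻¹ * x)) (b ((π g)⁻¹ * π Y)) σ
    · -- `Y` is seen near `x`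
      left
      have e1 := D.behr' y n1 (by omega)
      have e2 := D.near' p n1'
      have e3 := hull_small D H (hfarV Y hY) hp hq
      omega
    · have e1 := D.behr' x n1 c1
      right
      refine ⟨p, hp, ?_⟩
      have hY' : (g * rh ^ k * g⁻¹)⁻¹ * Y * rh * ((g * rh ^ k * g⁻¹)⁻¹ * Y)⁻¹ ∉ M' := by
        intro hc
        apply hY
        have := M'.mul_mem (M'.mul_mem (hM' g hg k) hc) (M'.inv_mem (hM' g hg k))
        convert this using 1; group
      have n2 := not_mem_zpowers_symm (hne _ hY' g hg)
      have e2 := D.near' p n2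
      have e3 := D.overlap n2 (-k)
      have i1 : (π ((g * rh ^ k * g⁻¹)⁻¹ * Y))⁻¹ * (π (g * rh ^ k * g⁻¹)⁻¹ * x)
          = (π Y)⁻¹ * x := by
        simp only [map_mul, map_inv]; group
      have i2 : (π ((g * rh ^ k * g⁻¹)⁻¹ * Y))⁻¹ * π g * π rh ^ (-k) = (π Y)⁻¹ * π g := by
        simp only [map_mul, map_inv, map_zpow]; group
      rw [i1]
      rw [i2] at e3
      omega
  induction hw generalizing Y x q with
  | single g k hg hk =>
    have hy := RW.far D H W (RW.single g k hg hk) hx'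
    rcases main g k hg Y hY x q _ hx hq hxq hy with hm | ⟨p, hp, hm⟩
    · exact hm
    · have hY' : (g * rh ^ k * g⁻¹)⁻¹ * Y * rh * ((g * rh ^ k * g⁻¹)⁻¹ * Y)⁻¹ ∉ M' := by
        intro hc
        apply hY
        have := M'.mul_mem (M'.mul_mem (hM' g hg k) hc) (M'.inv_mem (hM' g hg k))
        convert this using 1; group
      have e3 := hull_small D H (hfarV _ hY') hp (q := x') ⟨x', hx', x', hx', H.btn_left _ _⟩
      have i1 : (π ((g * rh ^ k * g⁻¹)⁻¹ * Y))⁻¹ * (π (g * rh ^ k * g⁻¹)⁻¹ * x)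
          = (π Y)⁻¹ * x := by
        simp only [map_mul, map_inv]; group
      have i2 : (π ((g * rh ^ k * g⁻¹)⁻¹ * Y))⁻¹ * x'
          = (π Y)⁻¹ * (π (g * rh ^ k * g⁻¹) * x') := by
        simp only [map_mul, map_inv]; group
      rw [i1] at hm
      rw [i2] at e3
      omega
  | cons g k g₁ w hg hk hw hn ih =>
    have hy := RW.far D H W (RW.cons g k g₁ w hg hk hw hn) hx'
    rcases main g k hg Y hY x q _ hx hq hxq hy with hm | ⟨p, hp, hm⟩
    · exact hm
    · have hY' : (g * rh ^ k * g⁻¹)⁻¹ * Y * rh * ((g * rh ^ k * g⁻¹)⁻¹ * Y)⁻¹ ∉ M' := by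
        intro hc
        apply hY
        have := M'.mul_mem (M'.mul_mem (hM' g hg k) hc) (M'.inv_mem (hM' g hg k))
        convert this using 1; group
      have hfar : ¬ Near (b ((π g)⁻¹ * (π (g * rh ^ k * g⁻¹)⁻¹ * x))) (b (π g)⁻¹) (L - 50 * σ) := by
        have := rot_far D H g (-k) (by omega) x hx
        have e : g * rh ^ (-k) * g⁻¹ = (g * rh ^ k * g⁻¹)⁻¹ := by group
        rw [e] at this
        exact this
      have hx1 := near_of_far D H W hw.mem hg (not_mem_zpowers_symm hn)
        (y := π (g * rh ^ k * g⁻¹)⁻¹ * x) (by omega)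
      have := ih _ hY' _ p hx1 hp hm
      have i1 : (π ((g * rh ^ k * g⁻¹)⁻¹ * Y))⁻¹ * (π (g * rh ^ k * g⁻¹)⁻¹ * x)
          = (π Y)⁻¹ * x := by
        simp only [map_mul, map_inv]; group
      have i2 : (π ((g * rh ^ k * g⁻¹)⁻¹ * Y))⁻¹ * (π w * x')
          = (π Y)⁻¹ * (π (g * rh ^ k * g⁻¹ * w) * x') := by
        simp only [map_mul, map_inv]; group
      rw [i1, i2] at this
      exact this

end Step

end Windmill

section Windmill

variable {E G : Type*} [Group E] [Group G] {π : E →* G} {rh : E}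
  {ℓ : G → ℤ} {δ : ℤ} {σ L : ℤ} {b h : G → ℤ} {M : Subgroup E} {A : Set G}

/-- The windmill step. -/
theorem Wind.step (D : AxisData ℓ δ (π rh) σ L b h) (H : HypLen ℓ δ)
    (hker : ∀ z, π z = 1 → ∀ e, z * e = e * z) (W : Wind ℓ π rh σ L b M A) :
    ∃ (M' : Subgroup E) (A' : Set G), Wind ℓ π rh σ L b M' A' ∧
      (∀ a ∈ A, ∀ s, ℓ s ≤ 1 → a * s ∈ A') ∧
      (∀ g : E, π g ∈ A → g * rh * g⁻¹ ∈ M') ∧ M ≤ M' := by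
  have h0 := D.sig_pos H
  have hbig := D.big
  set V := newLines ℓ π rh σ h M A with hV
  set M' := Subgroup.closure ((M : Set E) ∪ {x | ∃ g ∈ V, ∃ k : ℤ, x = g * rh ^ k * g⁻¹}) with hM'
  have hMM : M ≤ M' := fun m hm => Subgroup.subset_closure (Or.inl hm)
  have hVM : ∀ g ∈ V, ∀ k : ℤ, g * rh ^ k * g⁻¹ ∈ M' := fun g hg k =>
    Subgroup.subset_closure (Or.inr ⟨g, hg, k, rfl⟩)
  have hdec : ∀ y ∈ M', ∃ w, ∃ m ∈ M, y = w * m ∧ (w = 1 ∨ ∃ g, RW π rh V g w) := fun y hy =>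
    RW.decomp hker (fun m hm g hg => newLines_mul W hm hg) hy
  have hline : ∀ g : E, g * rh * g⁻¹ ∉ M' → ∀ p ∈ Hull ℓ A, ¬ h ((π g)⁻¹ * p) ≤ 4 * σ := by
    intro g hg p hp hc
    exact hg (by simpa using hVM g ⟨fun hm => hg (hMM hm), p, hp, hc⟩ 1)
  refine ⟨M', {y | ∃ m ∈ M', ∃ a ∈ A, ∃ s, ℓ s ≤ 1 ∧ y = π m * a * s}, ⟨?_, ?_, ?_, ?_⟩,
    ?_, ?_, hMM⟩
  · exact ⟨1, M'.one_mem, 1, W.one_mem, 1, by rw [H.one]; omega, by simp⟩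
  · rintro m hm _ ⟨m₁, hm₁, a, ha, s, hs, rfl⟩
    exact ⟨m * m₁, M'.mul_mem hm hm₁, a, ha, s, hs, by simp only [map_mul]; group⟩
  · rintro Y hY _ ⟨m₁, hm₁, a₁, ha₁, s₁, hs₁, rfl⟩ _ ⟨m₂, hm₂, a₂, ha₂, s₂, hs₂, rfl⟩
    have lip : ∀ x s : G, ℓ s ≤ 1 → Near (b (x * s)) (b x) 2 := by
      intro x s hs
      have e1 := D.b_lip x (x * s)
      have e2 := D.b_lip (x * s) x
      rw [H.ds_comm] at e2
      have e3 : ds ℓ x (x * s) = ℓ s := by simp [ds]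
      omega
    have l1 := lip ((π Y)⁻¹ * (π m₁ * a₁)) s₁ hs₁
    have l2 := lip ((π Y)⁻¹ * (π m₂ * a₂)) s₂ hs₂
    simp only [mul_assoc] at l1 l2 ⊢
    have hY₁ : m₁⁻¹ * Y * rh * (m₁⁻¹ * Y)⁻¹ ∉ M' := by
      intro hc
      apply hY
      have := M'.mul_mem (M'.mul_mem hm₁ hc) (M'.inv_mem hm₁)
      convert this using 1; group
    have i1 : (π (m₁⁻¹ * Y))⁻¹ * a₁ = (π Y)⁻¹ * (π m₁ * a₁) := by
      simp only [map_mul, map_inv]; group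
    obtain ⟨w, m, hm, hwm, hw⟩ := hdec _ (M'.mul_mem (M'.inv_mem hm₁) hm₂)
    have i2 : (π (m₁⁻¹ * Y))⁻¹ * (π w * (π m * a₂)) = (π Y)⁻¹ * (π m₂ * a₂) := by
      have : π w * (π m * a₂) = (π m₁)⁻¹ * π m₂ * a₂ := by
        rw [← mul_assoc, ← map_mul, ← hwm, map_mul, map_inv]
      rw [this]
      simp only [map_mul, map_inv]; group
    have hA : ∀ a ∈ A, a ∈ Hull ℓ A := fun a ha => ⟨a, ha, a, ha, H.btn_left _ _⟩
    have key : Near (b ((π (m₁⁻¹ * Y))⁻¹ * a₁)) (b ((π (m₁⁻¹ * Y))⁻¹ * (π w * (π m * a₂))))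
        (25 * σ) := by
      rcases hw with rfl | ⟨g, hw⟩
      · have := hull_small D H (hline _ hY₁) (hA _ ha₁) (hA _ (W.inv m hm a₂ ha₂))
        simp only [map_one, one_mul] at *
        omega
      · have e1 := W.small g hw.mem.1 a₁ ha₁ 1 W.one_mem
        rw [mul_one] at e1
        exact RW.small D H hker W hMM hVM hw _ hY₁ a₁ a₁ (by omega) (hA _ ha₁) (by omega) _
          (W.inv m hm a₂ ha₂)
    rw [i1, i2] at key
    omega
  · intro y hy hy1
    obtain ⟨w, m, hm, rfl, hw⟩ := hdec y hy
    rcases hw with rfl | ⟨g, hw⟩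
    · simpa using W.dehn m hm (by simpa using hy1)
    · refine ⟨g, ?_⟩
      have := RW.far D H W hw (W.inv m hm 1 W.one_mem)
      rw [mul_one, ← map_mul] at this
      omega
  · intro a ha s hs
    exact ⟨1, M'.one_mem, a, ha, s, hs, by simp⟩
  · intro g hg
    by_contra hc
    refine hline g hc (π g) ⟨_, hg, _, hg, H.btn_left _ _⟩ ?_
    have := D.h1
    rw [inv_mul_cancel]; omega

theorem Wind.exists_stage (D : AxisData ℓ δ (π rh) σ L b h) (H : HypLen ℓ δ)
    (hker : ∀ z, π z = 1 → ∀ e, z * e = e * z) (n : ℕ) :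
    ∃ (M : Subgroup E) (A : Set G), Wind ℓ π rh σ L b M A ∧ (∀ x, ℓ x ≤ n → x ∈ A) ∧
      (∀ g : E, ℓ (π g) < n → g * rh * g⁻¹ ∈ M) := by
  have h0 := D.sig_pos H
  induction n with
  | zero =>
    refine ⟨⊥, {1}, ⟨rfl, ?_, ?_, ?_⟩, ?_, ?_⟩
    · rintro m hm x rfl
      rw [Subgroup.mem_bot] at hm
      simp [hm]
    · rintro g - x rfl y rfl
      omega
    · intro m hm hm'
      exact absurd (Subgroup.mem_bot.1 hm) hm'
    · intro x hx
      exact H.eq_one x (by simpa using hx)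
    · intro g hg
      have := H.nonneg (π g)
      exact absurd hg (by simpa using this)
  | succ n ih =>
    obtain ⟨M, A, W, h1, h2⟩ := ih
    obtain ⟨M', A', W', h3, h4, h5⟩ := W.step D H hker
    refine ⟨M', A', W', ?_, ?_⟩
    · intro x hx
      by_cases hc : ℓ x ≤ n
      · simpa using h3 x (h1 x hc) 1 (by rw [H.one]; omega)
      · obtain ⟨p, hp, hp'⟩ := H.geod x n (by omega) (by omega)
        simpa using h3 p (h1 p (by omega)) (p⁻¹ * x) (by push_cast at hx; omega)
    · intro g hg
      exact h4 g (h1 _ (by push_cast at hg; omega))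

/-- Every nontrivial element of the normal closure of `rh` moves the base point a long way along
some line. -/
theorem AxisData.greendlinger (D : AxisData ℓ δ (π rh) σ L b h) (H : HypLen ℓ δ)
    (hker : ∀ z, π z = 1 → ∀ e, z * e = e * z) {y : E} (hy : y ∈ Subgroup.normalClosure {rh})
    (hy1 : y ≠ 1) : ∃ g : E, ¬ Near (b ((π g)⁻¹)) (b ((π g)⁻¹ * π y)) (L - 100 * σ) := by
  have key : ∃ n : ℕ, ∀ M : Subgroup E, (∀ g : E, ℓ (π g) < n → g * rh * g⁻¹ ∈ M) → y ∈ M := by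
    refine Subgroup.closure_induction (p := fun y _ => ∃ n : ℕ, ∀ M : Subgroup E,
      (∀ g : E, ℓ (π g) < n → g * rh * g⁻¹ ∈ M) → y ∈ M) ?_ ?_ ?_ ?_ hy
    · intro x hx
      obtain ⟨a, ha, hax⟩ := Group.mem_conjugatesOfSet_iff.1 hx
      rw [Set.mem_singleton_iff] at ha
      subst ha
      obtain ⟨g, rfl⟩ := isConj_iff.1 hax
      refine ⟨(ℓ (π g)).toNat + 1, fun M hM => hM g ?_⟩
      push_cast; omega
    · exact ⟨0, fun M _ => M.one_mem⟩
    · rintro x y - - ⟨n, hn⟩ ⟨m, hm⟩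
      refine ⟨n + m, fun M hM => M.mul_mem (hn M fun g hg => hM g ?_) (hm M fun g hg => hM g ?_)⟩
      all_goals push_cast; omega
    · rintro x - ⟨n, hn⟩
      exact ⟨n, fun M hM => M.inv_mem (hn M hM)⟩
  obtain ⟨n, hn⟩ := key
  obtain ⟨M, A, W, -, h2⟩ := Wind.exists_stage D H hker n
  exact W.dehn y (hn M h2) hy1

end Windmill

section Quot

variable {G : Type*} [Group G] {ℓ : G → ℤ} {δ : ℤ} {r : G} {σ L : ℤ} {b h : G → ℤ}

/-- Every nontrivial element of the normal closure moves every point a long way along some line. -/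
theorem AxisData.greendlinger' (D : AxisData ℓ δ r σ L b h) (H : HypLen ℓ δ) {n : G}
    (hn : n ∈ Subgroup.normalClosure {r}) (hn1 : n ≠ 1) (x : G) :
    ∃ g : G, ¬ Near (b (g⁻¹ * x)) (b (g⁻¹ * (n * x))) (L - 100 * σ) := by
  have D' : AxisData ℓ δ ((MonoidHom.id G) r) σ L b h := D
  obtain ⟨g, hg⟩ := D'.greendlinger H (by rintro z rfl e; simp) (y := x⁻¹ * n * x)
    (by have := Subgroup.normalClosure_normal.conj_mem n hn x⁻¹; simpa using this)
    (by intro hc; apply hn1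
        have : n = x * (x⁻¹ * n * x) * x⁻¹ := by group
        rw [this, hc]; simp)
  refine ⟨x * g, ?_⟩
  simp only [MonoidHom.id_apply] at hg
  convert hg using 3
  · group
  · group

/-- The normal closure of a lift of `r` in a central extension meets the kernel trivially. -/
theorem AxisData.central {E : Type*} [Group E] {π : E →* G} {rh : E}
    (D : AxisData ℓ δ (π rh) σ L b h) (H : HypLen ℓ δ)
    (hker : ∀ z, π z = 1 → ∀ e, z * e = e * z) {y : E} (hy : y ∈ Subgroup.normalClosure {rh})
    (hy1 : π y = 1) : y = 1 := by
  by_contra hc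
  obtain ⟨g, hg⟩ := D.greendlinger H hker hy hc
  have h0 := D.sig_pos H
  have hbig := D.big
  rw [hy1, mul_one] at hg
  omega

/-- Nontrivial elements of the normal closure are long. -/
theorem AxisData.long (D : AxisData ℓ δ r σ L b h) (H : HypLen ℓ δ) {n : G}
    (hn : n ∈ Subgroup.normalClosure {r}) (hn1 : n ≠ 1) : L - 100 * σ ≤ 2 * ℓ n := by
  obtain ⟨g, hg⟩ := D.greendlinger' H hn hn1 1
  have h1 := D.b_lip (g⁻¹ * 1) (g⁻¹ * (n * 1))
  have h2 := D.b_lip (g⁻¹ * (n * 1)) (g⁻¹ * 1)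
  rw [H.ds_comm (g⁻¹ * (n * 1))] at h2
  simp only [mul_one] at h1 h2 hg
  have e : ds ℓ g⁻¹ (g⁻¹ * n) = ℓ n := by simp [ds]
  omega

end Quot

/-- `x` is close to the translate by `g` of the axis of `r`. -/
def NearLine {G : Type*} [Group G] (r : G) (σ : ℤ) (h : G → ℤ) (g x : G) : Prop :=
  ∃ k : ℤ, h (r ^ k * (g⁻¹ * x)) ≤ 20 * σ

/-- The pair `x`, `y` realises the distance between `x` and the orbit of `y`. -/
def Shortest {G : Type*} [Group G] (ℓ : G → ℤ) (N : Subgroup G) (x y : G) : Prop :=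
  ∀ n ∈ N, ds ℓ x y ≤ ds ℓ x (n * y)

/-- Either `x = y`, or both are close to a common axis and not too far apart along it. -/
def Jump {G : Type*} [Group G] (r : G) (σ L : ℤ) (b h : G → ℤ) (x y : G) : Prop :=
  x = y ∨ ∃ g, NearLine r σ h g x ∧ NearLine r σ h g y ∧ Near (b (g⁻¹ * x)) (b (g⁻¹ * y)) (2 * L)

section

variable {G : Type*} [Group G] {ℓ : G → ℤ} {δ : ℤ} {r : G} {σ L : ℤ} {b h : G → ℤ}
  {N : Subgroup G}

theorem nearLine_mul_left (n g x : G) :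
    NearLine r σ h (n * g) (n * x) ↔ NearLine r σ h g x := by
  unfold NearLine
  have : (n * g)⁻¹ * (n * x) = g⁻¹ * x := by group
  rw [this]

theorem nearLine_congr {g z : G} (x : G) (hz : z⁻¹ * g ∈ Subgroup.zpowers r)
    (hx : NearLine r σ h g x) : NearLine r σ h z x := by
  obtain ⟨j, hj⟩ := hz
  obtain ⟨k, hk⟩ := hx
  refine ⟨k - j, ?_⟩
  simp only at hj
  have : r ^ (k - j) * (z⁻¹ * x) = r ^ k * (g⁻¹ * x) := by
    have e : z⁻¹ * x = r ^ j * (g⁻¹ * x) := by rw [hj]; group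
    rw [e, ← mul_assoc, ← zpow_add]; simp
  rwa [this]

theorem nearLine_rot {g : G} (x : G) (k : ℤ) (hx : NearLine r σ h g x) :
    NearLine r σ h g (g * r ^ k * g⁻¹ * x) := by
  obtain ⟨j, hj⟩ := hx
  refine ⟨j - k, ?_⟩
  have : r ^ (j - k) * (g⁻¹ * (g * r ^ k * g⁻¹ * x)) = r ^ j * (g⁻¹ * x) := by
    rw [zpow_sub]; group
  rwa [this]

theorem AxisData.h_le_of_nearLine (D : AxisData ℓ δ r σ L b h) {g x : G}
    (hx : NearLine r σ h g x) : h (g⁻¹ * x) ≤ 21 * σ := by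
  obtain ⟨k, hk⟩ := hx
  have := D.hshift k (g⁻¹ * x)
  omega

theorem nearLine_of_h_le {g x : G} (hx : h (g⁻¹ * x) ≤ 20 * σ) : NearLine r σ h g x :=
  ⟨0, by simpa using hx⟩

theorem Jump.mul_left (n : G) {x y : G} (hxy : Jump r σ L b h x y) :
    Jump r σ L b h (n * x) (n * y) := by
  rcases hxy with rfl | ⟨g, h1, h2, h3⟩
  · exact Or.inl rfl
  · refine Or.inr ⟨n * g, (nearLine_mul_left _ _ _).2 h1, (nearLine_mul_left _ _ _).2 h2, ?_⟩
    have e : ∀ x, (n * g)⁻¹ * (n * x) = g⁻¹ * x := fun x => by group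
    rwa [e, e]

theorem Jump.short (D : AxisData ℓ δ r σ L b h) (H : HypLen ℓ δ) {x y : G}
    (hxy : Jump r σ L b h x y) : ds ℓ x y ≤ L + 22 * σ := by
  have h0 := D.sig_pos H
  have hbig := D.big
  rcases hxy with rfl | ⟨g, h1, h2, h3⟩
  · rw [H.ds_self]; omega
  · have e1 := D.h_le_of_nearLine h1
    have e2 := D.h_le_of_nearLine h2
    have e3 := D.upper (g⁻¹ * x) (g⁻¹ * y)
    rw [ds_mul_left] at e3
    omega

theorem Jump.near (D : AxisData ℓ δ r σ L b h) (H : HypLen ℓ δ) {x y : G}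
    (hxy : Jump r σ L b h x y) (z : G) : Near (b (z⁻¹ * x)) (b (z⁻¹ * y)) (44 * σ) ∨
    (NearLine r σ h z x ∧ NearLine r σ h z y ∧
      Near (b (z⁻¹ * x)) (b (z⁻¹ * y)) (2 * L + 2 * σ)) := by
  have h0 := D.sig_pos H
  rcases hxy with rfl | ⟨g, h1, h2, h3⟩
  · left; omega
  · by_cases hz : z⁻¹ * g ∈ Subgroup.zpowers r
    · right
      refine ⟨nearLine_congr _ hz h1, nearLine_congr _ hz h2, ?_⟩
      obtain ⟨j, hj⟩ := hz
      simp only at hj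
      have e : ∀ x, z⁻¹ * x = r ^ j * (g⁻¹ * x) := fun x => by rw [hj]; group
      rw [e, e]
      have := D.shift_diff j (g⁻¹ * x) (g⁻¹ * y)
      omega
    · left
      have e1 := D.h_le_of_nearLine h1
      have e2 := D.h_le_of_nearLine h2
      have e3 := D.near' x hz
      have e4 := D.near' y hz
      omega

theorem Shortest.mul_left [N.Normal] (g : G) {x y : G} (hxy : Shortest ℓ N x y) :
    Shortest ℓ N (g * x) (g * y) := by
  intro n hn
  have := hxy _ (Subgroup.Normal.conj_mem ‹_› n hn g⁻¹)
  rw [ds_mul_left]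
  rw [← ds_mul_left ℓ g x (_ * y)] at this
  convert this using 2
  group

theorem Shortest.left (H : HypLen ℓ δ) {x y p : G} (hxy : Shortest ℓ N x y) (hp : Btn ℓ x y p) :
    Shortest ℓ N p y := by
  intro n hn
  have h1 := hxy n hn
  have h2 := H.ds_tri x p (n * y)
  unfold Btn at hp
  omega

theorem Shortest.right (H : HypLen ℓ δ) {x y p : G} (hxy : Shortest ℓ N x y) (hp : Btn ℓ x y p) :
    Shortest ℓ N x p := by
  intro n hn
  have h1 := hxy n hn
  have h2 := H.ds_tri x (n * p) (n * y)
  rw [ds_mul_left] at h2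
  unfold Btn at hp
  omega

theorem shortest_self (H : HypLen ℓ δ) (x : G) : Shortest ℓ N x x := by
  intro n _
  rw [H.ds_self]
  exact H.ds_nonneg _ _

theorem AxisData.touch (D : AxisData ℓ δ r σ L b h) (H : HypLen ℓ δ) (z x y : G)
    (hxy : ¬ ∃ a, Btn ℓ x y a ∧ NearLine r σ h z a) :
    Near (b (z⁻¹ * x)) (b (z⁻¹ * y)) (10 * σ) ∧ ¬ NearLine r σ h z x ∧ ¬ NearLine r σ h z y := by
  have h0 := D.sig_pos H
  refine ⟨?_, fun hc => hxy ⟨x, H.btn_left _ _, hc⟩, fun hc => hxy ⟨y, H.btn_right _ _, hc⟩⟩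
  by_contra hc
  apply hxy
  have key : ∃ a, Btn ℓ (z⁻¹ * x) (z⁻¹ * y) a ∧ h a ≤ 4 * σ := by
    by_cases c : b (z⁻¹ * x) ≤ b (z⁻¹ * y)
    · obtain ⟨a, h1, h2, -⟩ := D.hit H (z⁻¹ * x) (z⁻¹ * y) 0 le_rfl (by omega)
      exact ⟨a, h1, h2⟩
    · obtain ⟨a, h1, h2, -⟩ := D.hit H (z⁻¹ * y) (z⁻¹ * x) 0 le_rfl (by omega)
      exact ⟨a, H.btn_comm h1, h2⟩
  obtain ⟨a, h1, h2⟩ := key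
  refine ⟨z * a, ?_, nearLine_of_h_le (by rw [inv_mul_cancel_left]; omega)⟩
  rw [← btn_mul_left z⁻¹, inv_mul_cancel_left]
  exact h1

set_option maxHeartbeats 1000000 in
/-- Thinness of hexagons modulo the normal closure of `r`. -/
theorem AxisData.hexagon (D : AxisData ℓ δ r σ L b h) (H : HypLen ℓ δ)
    (hN : N = Subgroup.normalClosure {r}) (m : ℕ) : ∀ (p₀ p₁ p₂ p₃ p₄ p₅ n P : G), n ∈ N →
      p₅ = n * p₀ → ds ℓ p₀ p₅ < m →
      Shortest ℓ N p₀ p₁ → Jump r σ L b h p₁ p₂ → Shortest ℓ N p₂ p₃ → Jump r σ L b h p₃ p₄ →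
      Shortest ℓ N p₄ p₅ → Btn ℓ p₀ p₁ P →
      ∃ n' ∈ N, ∃ Q, (Btn ℓ p₂ p₃ Q ∨ Btn ℓ p₄ p₅ Q) ∧ ds ℓ P (n' * Q) ≤ 10 * L := by
  have h0 := D.sig_pos H
  have hbig := D.big
  have hsig := D.sig
  have : N.Normal := by rw [hN]; infer_instance
  have hrN : r ∈ N := by rw [hN]; exact Subgroup.subset_normalClosure rfl
  induction m with
  | zero =>
    intro p₀ p₁ p₂ p₃ p₄ p₅ n P hn h5 hd
    have := H.ds_nonneg p₀ p₅
    exact absurd hd (by push_cast; omega)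
  | succ m ih =>
  intro p₀ p₁ p₂ p₃ p₄ p₅ n P hn h5 hd s1 j1 s2 j2 s3 hP
  have near_done : ∀ Q, (Btn ℓ p₂ p₃ Q ∨ Btn ℓ p₄ p₅ Q) → ds ℓ P Q ≤ 10 * L →
      ∃ n' ∈ N, ∃ Q, (Btn ℓ p₂ p₃ Q ∨ Btn ℓ p₄ p₅ Q) ∧ ds ℓ P (n' * Q) ≤ 10 * L :=
    fun Q hQ hd => ⟨1, N.one_mem, Q, hQ, by simpa using hd⟩
  have sj1 := j1.short D H
  have sj2 := j2.short D H
  -- thin polygons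
  obtain ⟨Q, hQ, hPQ⟩ := H.thin p₅ hP
  rcases hQ with hQ | hQ
  swap
  · obtain ⟨Q₂, hQ₂, hd₂⟩ := H.thin p₄ hQ
    have t1 := H.ds_tri P Q Q₂
    rcases hQ₂ with hQ₂ | hQ₂
    · exact near_done Q₂ (Or.inr (H.btn_comm hQ₂)) (by omega)
    obtain ⟨Q₃, hQ₃, hd₃⟩ := H.thin p₃ hQ₂
    have t2 := H.ds_tri P Q₂ Q₃
    rcases hQ₃ with hQ₃ | hQ₃
    · have t3 := H.ds_tri P Q₃ p₄
      have t4 := H.ds_comm p₄ Q₃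
      have t5 := H.ds_comm p₄ p₃
      have t6 := H.ds_nonneg Q₃ p₃
      unfold Btn at hQ₃
      exact near_done p₄ (Or.inr (H.btn_left _ _)) (by omega)
    obtain ⟨Q₄, hQ₄, hd₄⟩ := H.thin p₂ hQ₃
    have t3 := H.ds_tri P Q₃ Q₄
    rcases hQ₄ with hQ₄ | hQ₄
    · exact near_done Q₄ (Or.inl (H.btn_comm hQ₄)) (by omega)
    have t4 := H.ds_tri P Q₄ p₂
    have t5 := H.ds_comm p₂ Q₄
    have t6 := H.ds_comm p₂ p₁
    have t7 := H.ds_nonneg Q₄ p₁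
    unfold Btn at hQ₄
    exact near_done p₂ (Or.inl (H.btn_left _ _)) (by omega)
  by_cases hn1 : n = 1
  · have : Q = p₅ := by
      have e1 := H.ds_self p₀
      have e2 := H.ds_nonneg p₀ Q
      subst hn1
      rw [one_mul] at h5
      subst h5
      unfold Btn at hQ
      exact H.eq_of_ds (by omega)
    subst this
    exact near_done _ (Or.inr (H.btn_right _ _)) (by omega)
  obtain ⟨Z, hZ⟩ := D.greendlinger' H (by rw [← hN]; exact hn) hn1 p₀
  rw [← h5] at hZ
  have b1 := D.reduced_near H hrN s1 Z
  have b2 := D.reduced_near H hrN s2 Z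
  have b3 := D.reduced_near H hrN s3 Z
  have bP := D.reduced_near H hrN (s1.right H hP) Z
  have bP1 := D.reduced_near H hrN (s1.left H hP) Z
  have bj1 := j1.near D H Z
  have bj2 := j2.near D H Z
  by_cases hPZ : h (Z⁻¹ * P) ≤ 100 * σ
  · -- `P` is close to the line, and so is another side
    have fin : ∀ W, (Btn ℓ p₂ p₃ W ∨ Btn ℓ p₄ p₅ W) → NearLine r σ h Z W →
        Near (b (Z⁻¹ * P)) (b (Z⁻¹ * W)) (10 * L) →
        ∃ n' ∈ N, ∃ Q, (Btn ℓ p₂ p₃ Q ∨ Btn ℓ p₄ p₅ Q) ∧ ds ℓ P (n' * Q) ≤ 10 * L := by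
      intro W hW hWZ hPW
      have e1 := D.h_le_of_nearLine hWZ
      have e2 := D.upper (Z⁻¹ * P) (Z⁻¹ * W)
      rw [ds_mul_left] at e2
      exact near_done W hW (by omega)
    by_cases T2 : ∃ a, Btn ℓ p₂ p₃ a ∧ NearLine r σ h Z a
    · obtain ⟨a, ha, haZ⟩ := T2
      have e1 := D.reduced_near H hrN (s2.right H ha) Z
      exact fin a (Or.inl ha) haZ (by omega)
    · by_cases T3 : ∃ a, Btn ℓ p₄ p₅ a ∧ NearLine r σ h Z a
      · obtain ⟨a, ha, haZ⟩ := T3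
        have e1 := D.reduced_near H hrN (s3.right H ha) Z
        exact fin a (Or.inr ha) haZ (by omega)
      · exfalso
        have e2 := D.touch H _ _ _ T2
        have e3 := D.touch H _ _ _ T3
        have bj1' := bj1.resolve_right (fun hc => e2.2.1 hc.2.1)
        have bj2' := bj2.resolve_right (fun hc => e2.2.2 hc.1)
        omega
  -- `P` is far from the line and projects near `p₀`
  have hQ' := D.ends H ((btn_mul_left Z⁻¹).2 hQ) (by
    have := D.h_lip (Z⁻¹ * P) (Z⁻¹ * Q)
    rw [ds_mul_left] at this
    omega)
  have l1 := D.b_lip (Z⁻¹ * P) (Z⁻¹ * Q)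
  have l2 := D.b_lip (Z⁻¹ * Q) (Z⁻¹ * P)
  rw [H.ds_comm] at l2
  rw [ds_mul_left] at l1 l2
  have hP0 : Near (b (Z⁻¹ * P)) (b (Z⁻¹ * p₀)) (2 * σ) := by omega
  obtain ⟨k, hk⟩ := D.exists_pow H (b (Z⁻¹ * p₀)) (Z⁻¹ * p₅)
  obtain ⟨ρ, hρ⟩ : ∃ ρ, ρ = Z * r ^ k * Z⁻¹ := ⟨_, rfl⟩
  have hρN : ρ ∈ N := hρ ▸ Subgroup.Normal.conj_mem ‹_› _ (N.zpow_mem hrN k) Z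
  have eρ : ∀ x, Z⁻¹ * (ρ * x) = r ^ k * (Z⁻¹ * x) := fun x => by
    rw [hρ, ← mul_assoc, ← mul_assoc, ← mul_assoc, inv_mul_cancel, one_mul, mul_assoc]
  have hdec : ds ℓ p₀ (ρ * p₅) < m := by
    have e1 := D.lower' H (Z⁻¹ * p₀) (Z⁻¹ * p₅)
    have e2 := D.upper (Z⁻¹ * p₀) (Z⁻¹ * (ρ * p₅))
    have e3 := D.hshift k (Z⁻¹ * p₅)
    rw [ds_mul_left] at e1 e2
    rw [eρ] at e2
    push_cast at hd
    omega
  have h5' : ρ * p₅ = (ρ * n) * p₀ := by rw [h5, mul_assoc]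
  have back : (∃ n' ∈ N, ∃ Q, (Btn ℓ p₂ p₃ Q ∨ Btn ℓ p₄ p₅ Q ∨
      Btn ℓ p₂ p₃ (ρ⁻¹ * Q) ∨ Btn ℓ p₄ p₅ (ρ⁻¹ * Q)) ∧ ds ℓ P (n' * Q) ≤ 10 * L) →
      ∃ n' ∈ N, ∃ Q, (Btn ℓ p₂ p₃ Q ∨ Btn ℓ p₄ p₅ Q) ∧ ds ℓ P (n' * Q) ≤ 10 * L := by
    rintro ⟨n', hn', Q, hQ, hd⟩
    rcases hQ with hQ | hQ | hQ
    · exact ⟨n', hn', Q, Or.inl hQ, hd⟩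
    · exact ⟨n', hn', Q, Or.inr hQ, hd⟩
    · exact ⟨n' * ρ, N.mul_mem hn' hρN, _, hQ, by simpa [mul_assoc] using hd⟩
  have jump : ∀ a c, NearLine r σ h Z a → NearLine r σ h Z c →
      Near (b (Z⁻¹ * a)) (b (Z⁻¹ * p₀)) (L / 2 + 100 * σ) →
      Near (b (Z⁻¹ * c)) (b (Z⁻¹ * p₅)) (L / 2 + 100 * σ) → Jump r σ L b h a (ρ * c) := by
    intro a c ha hc h1 h2
    refine Or.inr ⟨Z, ha, hρ ▸ nearLine_rot _ k hc, ?_⟩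
    rw [eρ]
    have := D.shift_diff k (Z⁻¹ * c) (Z⁻¹ * p₅)
    omega
  have tr : ∀ x y q, Btn ℓ (ρ * x) (ρ * y) q → Btn ℓ x y (ρ⁻¹ * q) := by
    intro x y q hq
    rw [← btn_mul_left ρ]
    simpa using hq
  by_cases T1 : ∃ a, Btn ℓ P p₁ a ∧ NearLine r σ h Z a
  · obtain ⟨a, ha, haZ⟩ := T1
    have ha' := H.btn_trans' hP ha
    have hPa := H.btn_sub hP ha
    have e1 := D.reduced_near H hrN (s1.right H ha') Z
    by_cases T3 : ∃ a, Btn ℓ p₄ p₅ a ∧ NearLine r σ h Z a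
    · obtain ⟨c, hc, hcZ⟩ := T3
      have e2 := D.reduced_near H hrN (s3.left H hc) Z
      obtain ⟨n', hn', Q, hQ, hd⟩ := ih p₀ a (ρ * c) (ρ * c) (ρ * c) (ρ * p₅) (ρ * n) P
        (N.mul_mem hρN hn) h5' hdec (s1.right H ha') (jump a c haZ hcZ (by omega) (by omega))
        (shortest_self H _) (Or.inl rfl) ((s3.left H hc).mul_left ρ) hPa
      refine back ⟨n', hn', Q, ?_, hd⟩
      have hQ' : Btn ℓ (ρ * c) (ρ * p₅) Q := by
        rcases hQ with hQ | hQ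
        · have : Q = ρ * c := by
            have e1 := H.ds_self (ρ * c)
            have e2 := H.ds_nonneg (ρ * c) Q
            unfold Btn at hQ
            exact H.eq_of_ds (by omega)
          rw [this]; exact H.btn_left _ _
        · exact hQ
      exact Or.inr (Or.inr (Or.inr (H.btn_trans' hc (tr _ _ _ hQ'))))
    · have e3 := D.touch H _ _ _ T3
      have bj2' := bj2.resolve_right (fun hc => e3.2.1 hc.2.1)
      by_cases T2 : ∃ a, Btn ℓ p₂ p₃ a ∧ NearLine r σ h Z a
      · obtain ⟨c, hc, hcZ⟩ := T2
        have e2 := D.reduced_near H hrN (s2.left H hc) Z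
        obtain ⟨n', hn', Q, hQ, hd⟩ := ih p₀ a (ρ * c) (ρ * p₃) (ρ * p₄) (ρ * p₅) (ρ * n) P
          (N.mul_mem hρN hn) h5' hdec (s1.right H ha') (jump a c haZ hcZ (by omega) (by omega))
          ((s2.left H hc).mul_left ρ) (j2.mul_left ρ) (s3.mul_left ρ) hPa
        refine back ⟨n', hn', Q, ?_, hd⟩
        rcases hQ with hQ | hQ
        · exact Or.inr (Or.inr (Or.inl (H.btn_trans' hc (tr _ _ _ hQ))))
        · exact Or.inr (Or.inr (Or.inr (tr _ _ _ hQ)))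
      · exfalso
        have e2 := D.touch H _ _ _ T2
        have bj1' := bj1.resolve_right (fun hc => e2.2.1 hc.2.1)
        omega
  · have e1 := D.touch H _ _ _ T1
    have bj1' := bj1.resolve_right (fun hc => e1.2.2 hc.1)
    by_cases T3 : ∃ a, Btn ℓ p₄ p₅ a ∧ NearLine r σ h Z a
    · by_cases T2 : ∃ a, Btn ℓ p₂ p₃ a ∧ NearLine r σ h Z a
      · obtain ⟨c, hc, hcZ⟩ := T3
        obtain ⟨a, ha, haZ⟩ := T2
        have e2 := D.reduced_near H hrN (s3.left H hc) Z
        have e3 := D.reduced_near H hrN (s2.right H ha) Z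
        obtain ⟨n', hn', Q, hQ, hd⟩ := ih p₀ p₁ p₂ a (ρ * c) (ρ * p₅) (ρ * n) P
          (N.mul_mem hρN hn) h5' hdec s1 j1 (s2.right H ha) (jump a c haZ hcZ (by omega) (by omega))
          ((s3.left H hc).mul_left ρ) hP
        refine back ⟨n', hn', Q, ?_, hd⟩
        rcases hQ with hQ | hQ
        · exact Or.inl (H.btn_trans ha hQ)
        · exact Or.inr (Or.inr (Or.inr (H.btn_trans' hc (tr _ _ _ hQ))))
      · exfalso
        have e2 := D.touch H _ _ _ T2
        have bj2' := bj2.resolve_right (fun hc => e2.2.2 hc.1)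
        omega
    · exfalso
      have e3 := D.touch H _ _ _ T3
      have bj2' := bj2.resolve_right (fun hc => e3.2.1 hc.2.1)
      omega

end

section

variable {G : Type*} [Group G] {ℓ : G → ℤ}

/-- Thin triangles imply the four point condition. -/
theorem hypLen_of_thin {D : ℤ} (hD : 0 ≤ D) (nonneg : ∀ g, 0 ≤ ℓ g) (one : ℓ 1 = 0)
    (eq_one : ∀ g, ℓ g ≤ 0 → g = 1) (inv : ∀ g, ℓ g⁻¹ = ℓ g)
    (mul : ∀ g h, ℓ (g * h) ≤ ℓ g + ℓ h)
    (geod : ∀ g k, 0 ≤ k → k ≤ ℓ g → ∃ p, ℓ p = k ∧ ℓ (p⁻¹ * g) = ℓ g - k)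
    (fin : ∀ n, {g | ℓ g ≤ n}.Finite)
    (thin : ∀ x y z P, Btn ℓ x y P → ∃ Q, (Btn ℓ x z Q ∨ Btn ℓ z y Q) ∧ ds ℓ P Q ≤ D) :
    HypLen ℓ (4 * D + 2) := by
  have ds_self : ∀ x, ds ℓ x x = 0 := fun x => by simp [ds, one]
  have ds_nonneg : ∀ x y, 0 ≤ ds ℓ x y := fun x y => nonneg _
  have ds_comm : ∀ x y, ds ℓ x y = ds ℓ y x := fun x y => by
    unfold ds; rw [← inv]; simp
  have ds_tri : ∀ x y z, ds ℓ x z ≤ ds ℓ x y + ds ℓ y z := fun x y z => by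
    have := mul (x⁻¹ * y) (y⁻¹ * z)
    simpa [ds, mul_assoc] using this
  have thin' : ∀ x y z P, Btn ℓ x y P → ds ℓ x P + ds ℓ P z ≤ ds ℓ x z + 2 * D ∨
      ds ℓ y P + ds ℓ P z ≤ ds ℓ y z + 2 * D := by
    intro x y z P hP
    obtain ⟨Q, hQ, hd⟩ := thin x y z P hP
    have e1 := ds_tri x Q P
    have e2 := ds_tri P Q z
    have e3 := ds_tri y Q P
    have e4 := ds_comm P Q
    have e5 := ds_comm z y
    have e6 := ds_comm Q y
    have e7 := ds_comm z Q
    unfold Btn at hQ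
    omega
  have centre : ∀ x y z, ∃ P, Btn ℓ x y P ∧ ds ℓ x P + ds ℓ P z ≤ ds ℓ x z + 2 * D ∧
      ds ℓ y P + ds ℓ P z ≤ ds ℓ y z + 2 * D + 2 := by
    intro x y z
    have key : ∀ (n : ℕ) P, ds ℓ P y ≤ n → Btn ℓ x y P →
        ds ℓ x P + ds ℓ P z ≤ ds ℓ x z + 2 * D → ∃ P, Btn ℓ x y P ∧
        ds ℓ x P + ds ℓ P z ≤ ds ℓ x z + 2 * D ∧
        ds ℓ y P + ds ℓ P z ≤ ds ℓ y z + 2 * D + 2 := by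
      intro n
      induction n with
      | zero =>
        intro P h1 h2 h3
        refine ⟨P, h2, h3, ?_⟩
        have e1 := ds_comm P y
        have e2 := ds_tri P y z
        have e3 := ds_nonneg P y
        push_cast at h1
        omega
      | succ n ih =>
        intro P h1 h2 h3
        by_cases hy : ds ℓ P y = 0
        · exact ih P (by omega) h2 h3
        have n0 := ds_nonneg P y
        obtain ⟨p, hp, hp'⟩ := geod (P⁻¹ * y) 1 (by omega) (by unfold ds at *; omega)
        have e1 : ds ℓ P (P * p) = 1 := by simpa [ds] using hp
        have e2 : ds ℓ (P * p) y = ds ℓ P y - 1 := by simpa [ds, mul_assoc] using hp'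
        have e3 := ds_tri x P (P * p)
        have e4 := ds_tri x (P * p) y
        have e5 : Btn ℓ x y (P * p) := by unfold Btn at *; omega
        rcases thin' x y z _ e5 with h | h
        · exact ih (P * p) (by push_cast at h1; omega) e5 h
        · refine ⟨P, h2, h3, ?_⟩
          have e6 := ds_tri P (P * p) z
          have e7 := ds_comm P y
          have e8 := ds_comm (P * p) y
          omega
    have e := ds_self x
    refine key (ds ℓ x y).toNat x (by have := ds_nonneg x y; omega) (by unfold Btn; omega) (by omega)
  refine ⟨nonneg, one, eq_one, inv, mul, geod, fin, by omega, ?_⟩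
  intro x y z w
  obtain ⟨P, h1, h2, h3⟩ := centre x y z
  have e1 := ds_tri z P w
  have e2 := ds_comm z P
  have e3 := ds_comm y P
  rcases thin' x y w P h1 with h | h <;> unfold Btn at h1 <;> omega

end

/-- The quotient length. -/
noncomputable def qlen {G Q : Type*} [Group G] [Group Q] (π : G →* Q) (ℓ : G → ℤ) (q : Q) : ℤ :=
  sInf (ℓ '' {g | π g = q})

section

variable {G Q : Type*} [Group G] [Group Q] {π : G →* Q} {ℓ : G → ℤ} {δ : ℤ}

theorem qlen_le (H : HypLen ℓ δ) (g : G) : qlen π ℓ (π g) ≤ ℓ g :=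
  csInf_le ⟨0, by rintro _ ⟨g, -, rfl⟩; exact H.nonneg g⟩ ⟨g, rfl, rfl⟩

theorem exists_qlen (H : HypLen ℓ δ) (hπ : Function.Surjective π) (q : Q) :
    ∃ g, π g = q ∧ ℓ g = qlen π ℓ q := by
  obtain ⟨g, hg⟩ := hπ q
  have := Int.csInf_mem (s := ℓ '' {g | π g = q}) ⟨_, g, hg, rfl⟩
    ⟨0, by rintro _ ⟨g, -, rfl⟩; exact H.nonneg g⟩
  obtain ⟨g, h1, h2⟩ := this
  exact ⟨g, h1, h2⟩

theorem ds_qlen_le (H : HypLen ℓ δ) (x y : G) : ds (qlen π ℓ) (π x) (π y) ≤ ds ℓ x y := by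
  unfold ds
  rw [← map_inv, ← map_mul]
  exact qlen_le H _

theorem exists_ds_qlen (H : HypLen ℓ δ) (hπ : Function.Surjective π) (x : G) (q : Q) :
    ∃ y, π y = q ∧ ds ℓ x y = ds (qlen π ℓ) (π x) q := by
  obtain ⟨g, h1, h2⟩ := exists_qlen H hπ ((π x)⁻¹ * q)
  exact ⟨x * g, by simp [h1], by simpa [ds] using h2⟩

theorem shortest_of_ds_qlen (H : HypLen ℓ δ) {x y : G}
    (h : ds ℓ x y = ds (qlen π ℓ) (π x) (π y)) : Shortest ℓ π.ker x y := by
  intro n hn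
  rw [h]
  have := ds_qlen_le (π := π) H x (n * y)
  rwa [map_mul, (MonoidHom.mem_ker).1 hn, one_mul] at this

theorem AxisData.hypLen_qlen {r : G} {σ L : ℤ} {b h : G → ℤ} (D : AxisData ℓ δ r σ L b h)
    (H : HypLen ℓ δ) (hπ : Function.Surjective π) (hker : π.ker = Subgroup.normalClosure {r}) :
    HypLen (qlen π ℓ) (4 * (10 * L) + 2) := by
  have h0 := D.sig_pos H
  have hb := D.big
  have nn : ∀ q, 0 ≤ qlen π ℓ q := fun q => by
    obtain ⟨g, -, h⟩ := exists_qlen H hπ q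
    rw [← h]; exact H.nonneg _
  have mul : ∀ g h, qlen π ℓ (g * h) ≤ qlen π ℓ g + qlen π ℓ h := fun q q' => by
    obtain ⟨g, rfl, h⟩ := exists_qlen H hπ q
    obtain ⟨g', rfl, h'⟩ := exists_qlen H hπ q'
    have e1 := H.mul g g'
    have e2 := qlen_le (π := π) H (g * g')
    rw [map_mul] at e2
    omega
  have one : qlen π ℓ 1 = 0 := by
    have e2 := qlen_le (π := π) H 1
    rw [map_one, H.one] at e2
    exact le_antisymm e2 (nn 1)
  apply hypLen_of_thin (by omega) nn one
  · intro q hq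
    obtain ⟨g, rfl, h⟩ := exists_qlen H hπ q
    rw [H.eq_one g (by omega), map_one]
  · have : ∀ q, qlen π ℓ q⁻¹ ≤ qlen π ℓ q := fun q => by
      obtain ⟨g, rfl, h⟩ := exists_qlen H hπ q
      rw [← h, ← map_inv, ← H.inv]
      exact qlen_le H _
    intro q
    refine le_antisymm (this q) ?_
    simpa using this q⁻¹
  · exact mul
  · intro q k h0 h1
    obtain ⟨g, rfl, h⟩ := exists_qlen H hπ q
    obtain ⟨p, hp, hp'⟩ := H.geod g k h0 (by omega)
    have e1 := qlen_le (π := π) H p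
    have e2 := qlen_le (π := π) H (p⁻¹ * g)
    have e3 := mul (π p) ((π p)⁻¹ * π g)
    rw [mul_inv_cancel_left] at e3
    rw [map_mul, map_inv] at e2
    exact ⟨π p, by omega, by omega⟩
  · intro n
    refine ((H.fin n).image π).subset ?_
    intro q hq
    obtain ⟨g, rfl, h⟩ := exists_qlen H hπ q
    exact ⟨g, by simpa [h] using hq, rfl⟩
  · intro x' y' z' P' hP'
    obtain ⟨x, rfl⟩ := hπ x'
    obtain ⟨P, rfl, eP⟩ := exists_ds_qlen H hπ x P'
    obtain ⟨y, rfl, ey⟩ := exists_ds_qlen H hπ P y'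
    obtain ⟨z, rfl, ez⟩ := exists_ds_qlen H hπ y z'
    obtain ⟨x2, e2, ex⟩ := exists_ds_qlen H hπ z (π x)
    have exy : ds ℓ x y = ds (qlen π ℓ) (π x) (π y) := by
      have t1 := H.ds_tri x P y
      have t2 := ds_qlen_le (π := π) H x y
      unfold Btn at hP'
      omega
    have hP : Btn ℓ x y P := by unfold Btn at *; omega
    obtain ⟨n', hn', R, hR, hd⟩ := D.hexagon H hker ((ds ℓ x x2).toNat + 1) x y y z z x2
      (x2 * x⁻¹) P (by simp [MonoidHom.mem_ker, e2]) (by simp)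
      (by have := H.ds_nonneg x x2; push_cast; omega)
      (shortest_of_ds_qlen H exy) (Or.inl rfl) (shortest_of_ds_qlen H ez) (Or.inl rfl)
      (shortest_of_ds_qlen H (by rw [e2]; exact ex)) hP
    have mul_tri : ∀ a b c, ds (qlen π ℓ) a c ≤ ds (qlen π ℓ) a b + ds (qlen π ℓ) b c := by
      intro a b c
      have := mul (a⁻¹ * b) (b⁻¹ * c)
      simpa [ds, mul_assoc] using this
    have proj : ∀ a b c, Btn ℓ a b c → ds ℓ a b = ds (qlen π ℓ) (π a) (π b) →
        Btn (qlen π ℓ) (π a) (π b) (π c) := by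
      intro a b c h1 h2
      have t1 := mul_tri (π a) (π c) (π b)
      have t2 := ds_qlen_le (π := π) H a c
      have t3 := ds_qlen_le (π := π) H c b
      unfold Btn at *
      omega
    have comm : ∀ a b, ds (qlen π ℓ) (π a) (π b) = ds (qlen π ℓ) (π b) (π a) := by
      have : ∀ a b, ds (qlen π ℓ) (π a) (π b) ≤ ds (qlen π ℓ) (π b) (π a) := by
        intro a b
        obtain ⟨c, hc, e⟩ := exists_ds_qlen H hπ b (π a)
        rw [← e, ← hc, H.ds_comm]
        exact ds_qlen_le H _ _
      exact fun a b => le_antisymm (this a b) (this b a)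
    refine ⟨π R, ?_, ?_⟩
    · rcases hR with hR | hR
      · right
        have := proj _ _ _ hR ez
        unfold Btn at *
        rw [comm z R, comm R y, comm z y]
        omega
      · left
        have := proj _ _ _ hR (by rw [e2]; exact ex)
        rw [e2] at this
        unfold Btn at *
        rw [comm x R, comm R z, comm x z]
        omega
    · have := ds_qlen_le (π := π) H P (n' * R)
      rw [map_mul, (MonoidHom.mem_ker).1 hn', one_mul] at this
      omega

end

/-- No nontrivial element has finite order. -/
def TorFree (G : Type*) [Group G] : Prop := ∀ (g : G) (m : ℕ), m ≠ 0 → g ^ m = 1 → g = 1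

section

variable {G : Type*} [Group G] {ℓ : G → ℤ} {δ : ℤ}

theorem HypLen.chain_right (H : HypLen ℓ δ) {f : ℤ → G} {A κ : ℤ} (hκ : 0 ≤ κ)
    (hA : κ + 2 * δ < A) (h1 : ∀ i, A ≤ ds ℓ (f i) (f (i + 1)))
    (h2 : ∀ i, ds ℓ (f i) (f (i + 1)) + ds ℓ (f (i + 1)) (f (i + 2)) ≤ ds ℓ (f i) (f (i + 2)) + κ)
    (i : ℤ) (n : ℕ) : ds ℓ (f i) (f (i + n)) + ds ℓ (f (i + n)) (f (i + n + 1)) ≤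
      ds ℓ (f i) (f (i + n + 1)) + κ + δ := by
  have hd := H.dpos
  induction n with
  | zero => simp [H.ds_self]; omega
  | succ n ih =>
    have e1 := h2 (i + n)
    have e2 := h1 (i + n)
    have e3 := H.hyp (f i) (f (i + n + 1)) (f (i + n)) (f (i + n + 2))
    have e4 := H.ds_comm (f (i + n + 1)) (f (i + n))
    push_cast
    rw [show i + n + 2 = i + (n + 1) + 1 by ring, show i + n + 1 = i + (n + 1) by ring] at *
    omega

theorem HypLen.chain (H : HypLen ℓ δ) {f : ℤ → G} {A κ : ℤ} (hκ : 0 ≤ κ)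
    (hA : κ + 2 * δ < A) (h1 : ∀ i, A ≤ ds ℓ (f i) (f (i + 1)))
    (h2 : ∀ i, ds ℓ (f i) (f (i + 1)) + ds ℓ (f (i + 1)) (f (i + 2)) ≤ ds ℓ (f i) (f (i + 2)) + κ)
    {i j k : ℤ} (hij : i ≤ j) (hjk : j ≤ k) :
    ds ℓ (f i) (f j) + ds ℓ (f j) (f k) ≤ ds ℓ (f i) (f k) + (κ + 2 * δ) := by
  have hd := H.dpos
  rcases hjk.eq_or_lt with rfl | hjk
  · rw [H.ds_self]; omega
  have r := H.chain_right hκ hA h1 h2 i (j - i).toNat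
  have l := H.chain_right (f := fun i => f (-i)) hκ hA
    (fun i => by
      rw [H.ds_comm]; simpa [neg_add] using h1 (-(i + 1)))
    (fun i => by
      have := h2 (-(i + 2))
      beta_reduce at this ⊢
      have c1 := H.ds_comm (f (-i)) (f (-(i + 1)))
      have c2 := H.ds_comm (f (-(i + 1))) (f (-(i + 2)))
      have c3 := H.ds_comm (f (-i)) (f (-(i + 2)))
      rw [show -(i + 2) + 1 = -(i + 1) by ring, show -(i + 2) + 2 = -i by ring] at this
      omega) (-k) (k - j - 1).toNat
  have e1 : ((j - i).toNat : ℤ) = j - i := by omega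
  have e2 : ((k - j - 1).toNat : ℤ) = k - j - 1 := by omega
  simp only [e1, e2] at r l
  rw [show i + (j - i) = j by ring] at r
  rw [show - -k = k by ring, show -(-k + (k - j - 1)) = j + 1 by ring,
    show -(-k + (k - j - 1) + 1) = j by ring, H.ds_comm (f k), H.ds_comm (f (j + 1)) (f j),
    H.ds_comm (f k)] at l
  have e3 := H.hyp (f i) (f (j + 1)) (f j) (f k)
  have e4 := H.ds_comm (f (j + 1)) (f j)
  have e5 := h1 j
  omega

theorem HypLen.chain_growth (H : HypLen ℓ δ) {f : ℤ → G} {A κ : ℤ} (hκ : 0 ≤ κ)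
    (hA : κ + 2 * δ < A) (h1 : ∀ i, A ≤ ds ℓ (f i) (f (i + 1)))
    (h2 : ∀ i, ds ℓ (f i) (f (i + 1)) + ds ℓ (f (i + 1)) (f (i + 2)) ≤ ds ℓ (f i) (f (i + 2)) + κ)
    (i : ℤ) (n : ℕ) : (n : ℤ) ≤ ds ℓ (f i) (f (i + n)) := by
  have hd := H.dpos
  induction n with
  | zero => simp [H.ds_self]
  | succ n ih =>
    have := H.chain_right hκ hA h1 h2 i n
    have e5 := h1 (i + n)
    push_cast
    rw [← add_assoc]
    omega

/-- An element which is short in its conjugacy class has a square about twice as long. -/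
theorem HypLen.conj_min (H : HypLen ℓ δ) {g : G} (hg : 10 * δ ≤ ℓ g)
    (hmin : ∀ x, ℓ g ≤ ds ℓ x (g * x)) : 2 * ℓ g ≤ ℓ (g ^ 2) + 2 * δ := by
  have hd := H.dpos
  obtain ⟨M, h1, h2⟩ := H.exists_between 1 g (ℓ g / 2) (by omega) (by rw [ds_one_left]; omega)
  rw [ds_one_left] at h2
  have e1 := hmin M
  have e2 := H.ds_tri M g (g * M)
  have e3 := ds_mul_left ℓ g 1 M
  have e4 := ds_mul_left ℓ g M g
  have e5 := ds_mul_left ℓ g 1 g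
  have e6 := H.hyp 1 g M (g * M)
  have e7 := H.hyp 1 (g * M) g (g * g)
  have e8 := H.ds_comm g M
  have e9 := H.ds_comm (g * M) g
  rw [mul_one] at e3 e5
  simp only [ds_one_left] at *
  rw [pow_two]
  omega

theorem zpow_chain (g : G) (i j : ℤ) : ds ℓ (g ^ i) (g ^ (i + j)) = ℓ (g ^ j) := by
  rw [zpow_add]; simp [ds]

end

section

variable {G : Type*} [Group G] {ℓ : G → ℤ} {δ : ℤ} {r : G} {σ L : ℤ} {b h : G → ℤ}
  {N : Subgroup G}

theorem AxisData.stab (D : AxisData ℓ δ r σ L b h) {g y X X' : G} {c : ℤ}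
    (h1 : h (y⁻¹ * X) ≤ c) (h2 : h (y⁻¹ * X') ≤ c) (h3 : h (y⁻¹ * (g * X)) ≤ c)
    (h4 : h (y⁻¹ * (g * X')) ≤ c)
    (hb : 4 * c + 4 * σ < b (y⁻¹ * X') - b (y⁻¹ * X)) : y⁻¹ * g * y ∈ Subgroup.zpowers r := by
  by_contra hc
  have e1 := D.near _ (y⁻¹ * (g * X)) hc
  have e2 := D.near _ (y⁻¹ * (g * X')) hc
  have s : ∀ X, (y⁻¹ * g * y)⁻¹ * (y⁻¹ * (g * X)) = y⁻¹ * X := fun X => by group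
  rw [s] at e1 e2
  have e3 := D.upper (y⁻¹ * (g * X')) (y⁻¹ * (g * X))
  have e4 := D.lower (y⁻¹ * X') (y⁻¹ * X)
  have e5 := D.hnn (y⁻¹ * X)
  have e6 := D.hnn (y⁻¹ * X')
  simp only [ds_mul_left] at e3 e4
  omega

theorem mem_of_conj_zpowers [N.Normal] (hr : r ∈ N) {y g : G}
    (h : y⁻¹ * g * y ∈ Subgroup.zpowers r) : g ∈ N := by
  have h1 : y⁻¹ * g * y ∈ N := (Subgroup.zpowers_le.2 hr) h
  have := Subgroup.Normal.conj_mem ‹_› _ h1 y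
  simpa [mul_assoc] using this

/-- An element with small displacement at two points projecting far apart stabilises the line. -/
theorem AxisData.small_disp (D : AxisData ℓ δ r σ L b h) (H : HypLen ℓ δ) {g y x x' : G}
    (hx : ds ℓ x (g * x) ≤ 1000 * σ) (hx' : ds ℓ x' (g * x') ≤ 1000 * σ)
    (hb : L - 100 * σ < b (y⁻¹ * x') - b (y⁻¹ * x)) : y⁻¹ * g * y ∈ Subgroup.zpowers r := by
  have h0 := D.sig_pos H
  have hbig := D.big
  have key : ∀ t, 100000 * σ ≤ t → t ≤ 200000 * σ → ∃ X, h (y⁻¹ * X) ≤ 2010 * σ ∧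
      h (y⁻¹ * (g * X)) ≤ 2010 * σ ∧ Near (b (y⁻¹ * X)) (b (y⁻¹ * x) + t) (5 * σ) := by
    intro t h1 h2
    obtain ⟨X, e1, e2, e3⟩ := D.hit H (y⁻¹ * x) (y⁻¹ * x') t (by omega) (by omega)
    obtain ⟨X, rfl⟩ : ∃ X', X = y⁻¹ * X' := ⟨y * X, by simp⟩
    refine ⟨X, by omega, ?_, e3⟩
    have f1 := H.ds_tri x (g * x) (g * X)
    have f2 := H.ds_tri (g * X) (g * x') x'
    have f3 := H.ds_comm x' (g * x')
    rw [btn_mul_left] at e1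
    unfold Btn at e1
    have u := D.upper (y⁻¹ * x) (y⁻¹ * x')
    have l1 := D.lower' H (y⁻¹ * x) (y⁻¹ * X)
    have l2 := D.lower' H (y⁻¹ * x) (y⁻¹ * (g * X))
    have l3 := D.lower' H (y⁻¹ * (g * X)) (y⁻¹ * x')
    have l4 := D.lower' H (y⁻¹ * X) (y⁻¹ * x')
    have n := D.hnn (y⁻¹ * X)
    have n' := D.hnn (y⁻¹ * (g * X))
    simp only [ds_mul_left] at *
    omega
  obtain ⟨X, a1, a2, a3⟩ := key (100000 * σ) le_rfl (by omega)
  obtain ⟨X', a1', a2', a3'⟩ := key (200000 * σ) (by omega) le_rfl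
  exact D.stab a1 a1' a2 a2' (by omega)

theorem AxisData.large_disp (D : AxisData ℓ δ r σ L b h) (H : HypLen ℓ δ) [N.Normal] (hr : r ∈ N)
    {g y : G} {m : ℕ} (hg : 1000 * σ ≤ ℓ g) (hmin : ∀ x, ∀ n ∈ N, ℓ g ≤ ds ℓ x (n * (g * x)))
    (hb : L - 100 * σ < b (y⁻¹ * g ^ m) - b (y⁻¹ * 1)) : y⁻¹ * g * y ∈ Subgroup.zpowers r := by
  have h0 := D.sig_pos H
  have hbig := D.big
  have hsig := D.sig
  have hd := H.dpos
  have sq := H.conj_min (g := g) (by omega) (fun x => by simpa using hmin x 1 N.one_mem)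
  have ch : ∀ {i j k : ℤ}, i ≤ j → j ≤ k → ds ℓ (g ^ i) (g ^ j) + ds ℓ (g ^ j) (g ^ k) ≤
      ds ℓ (g ^ i) (g ^ k) + (2 * δ + 2 * δ) := by
    intro i j k hij hjk
    refine H.chain (f := fun i => g ^ i) (A := ℓ g) (by omega) (by omega) ?_ ?_ hij hjk
    · intro i
      simp only [zpow_chain, zpow_one]; omega
    · intro i
      rw [show i + 2 = (i + 1) + 1 by ring, zpow_chain, zpow_chain,
        show i + 1 + 1 = i + 2 by ring, zpow_chain, zpow_one, zpow_ofNat]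
      omega
  have step : ∀ i : ℤ, ds ℓ (g ^ i) (g ^ (i + 1)) = ℓ g := fun i => by rw [zpow_chain, zpow_one]
  have key : ∀ t, 100 * σ ≤ t → t ≤ 1000 * σ → ∃ X, h (y⁻¹ * X) ≤ 10 * σ ∧
      h (y⁻¹ * (g * X)) ≤ 10 * σ ∧ Near (b (y⁻¹ * X)) (b (y⁻¹ * 1) + t) (5 * σ) := by
    intro t h1 h2
    have hm : m ≠ 0 := by rintro rfl; simp at hb; omega
    have ex : ∃ j : ℕ, b (y⁻¹ * 1) + t + 3 * σ < b (y⁻¹ * g ^ (j + 1)) :=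
      ⟨m - 1, by rw [Nat.sub_add_cancel (by omega)]; omega⟩
    classical
    obtain ⟨j, hj, hj', hjm⟩ : ∃ j : ℕ, b (y⁻¹ * 1) + t + 3 * σ < b (y⁻¹ * g ^ (j + 1)) ∧
        b (y⁻¹ * g ^ j) ≤ b (y⁻¹ * 1) + t + 3 * σ ∧ j + 1 ≤ m := by
      refine ⟨Nat.find ex, Nat.find_spec ex, ?_, ?_⟩
      · rcases h : Nat.find ex with _ | i
        · simp only [pow_zero]; omega
        · have := Nat.find_min ex (m := i) (by omega)
          omega
      · have := Nat.find_min' ex (m := m - 1) (by rw [Nat.sub_add_cancel (by omega)]; omega)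
        omega
    obtain ⟨X, bX, nX⟩ : ∃ X, Btn ℓ (g ^ j) (g ^ (j + 1)) X ∧
        Near (b (y⁻¹ * X)) (b (y⁻¹ * 1) + t) (5 * σ) := by
      by_cases hc : b (y⁻¹ * g ^ j) ≤ b (y⁻¹ * 1) + t
      · obtain ⟨X, e1, e2, e3⟩ := D.hit H (y⁻¹ * g ^ j) (y⁻¹ * g ^ (j + 1))
          (b (y⁻¹ * 1) + t - b (y⁻¹ * g ^ j)) (by omega) (by omega)
        obtain ⟨X, rfl⟩ : ∃ X', X = y⁻¹ * X' := ⟨y * X, by simp⟩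
        exact ⟨X, (btn_mul_left _).1 e1, by omega⟩
      · exact ⟨_, H.btn_left _ _, by omega⟩
    have sh : Shortest ℓ N (g ^ j) (g ^ (j + 1)) := by
      intro n hn
      have := hmin (g ^ j) n hn
      rw [← pow_succ'] at this
      have s := step j
      norm_cast at s
      omega
    have hjm' : j + 2 ≤ m := by
      by_contra hc
      have : m = j + 1 := by omega
      subst this
      have := D.reduced_near H hr (sh.left H bX) y
      omega
    have bX' : Btn ℓ (g ^ (j + 1)) (g ^ (j + 2)) (g * X) := by
      have := (btn_mul_left (ℓ := ℓ) g).2 bX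
      simpa only [← pow_succ'] using this
    have red := D.reduced_near H hr (x := X) (y := g * X) (by
      intro n hn
      have e1 := hmin X n hn
      have e2 := H.ds_tri X (g ^ (j + 1)) (g * X)
      have s := step j
      have s' := step (j + 1)
      have e3 := ds_mul_left ℓ g (g ^ j) X
      rw [← pow_succ'] at e3
      norm_cast at s s'
      unfold Btn at bX
      omega) y
    have c1 := ch (i := 0) (j := j) (k := j + 1) (by omega) (by omega)
    have c2 := ch (i := 0) (j := j + 1) (k := m) (by omega) (by omega)
    have c3 := ch (i := j + 1) (j := j + 2) (k := m) (by omega) (by omega)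
    have c4 := ch (i := 0) (j := j + 1) (k := j + 2) (by omega) (by omega)
    have c5 := ch (i := 0) (j := j + 2) (k := m) (by omega) (by omega)
    have s1 := step j
    have s2 := step (j + 1)
    rw [show (j : ℤ) + 1 + 1 = j + 2 by ring] at s2
    norm_cast at c1 c2 c3 c4 c5 s1 s2
    rw [pow_zero] at *
    have t1 := H.ds_tri 1 (g ^ j) X
    have t2 := H.ds_tri X (g ^ (j + 1)) (g ^ m)
    have t3 := H.ds_tri (g * X) (g ^ (j + 2)) (g ^ m)
    have t4 := H.ds_tri 1 (g ^ (j + 1)) (g * X)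
    unfold Btn at bX bX'
    have u := D.upper (y⁻¹ * 1) (y⁻¹ * g ^ m)
    have l1 := D.lower' H (y⁻¹ * 1) (y⁻¹ * X)
    have l2 := D.lower' H (y⁻¹ * 1) (y⁻¹ * (g * X))
    have l3 := D.lower' H (y⁻¹ * (g * X)) (y⁻¹ * g ^ m)
    have l4 := D.lower' H (y⁻¹ * X) (y⁻¹ * g ^ m)
    have n1 := H.ds_nonneg (g ^ (j + 2)) (g * X)
    have n2 := H.ds_nonneg (g ^ j) X
    have n3 := H.ds_nonneg X (g ^ (j + 1))
    have n4 := H.ds_nonneg (g ^ (j + 1)) (g * X)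
    have n5 := H.ds_nonneg (g * X) (g ^ (j + 2))
    have n := D.hnn (y⁻¹ * X)
    have n' := D.hnn (y⁻¹ * (g * X))
    simp only [ds_mul_left] at u l1 l2 l3 l4
    have k1 : ds ℓ 1 X + ds ℓ (g * X) (g ^ m) ≤ ds ℓ 1 (g ^ m) + 2 * σ := by omega
    have k2 : ds ℓ 1 X + ds ℓ X (g ^ m) ≤ ds ℓ 1 (g ^ m) + 2 * σ := by omega
    have k3 : ds ℓ 1 (g * X) + ds ℓ (g * X) (g ^ m) ≤ ds ℓ 1 (g ^ m) + 2 * σ := by omega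
    clear t1 t2 t3 t4 c1 c2 c3 c4 c5 s1 s2 bX bX' n1 n2 n3 n4 n5
    refine ⟨X, ?_, ?_, nX⟩ <;> omega
  obtain ⟨X, a1, a2, a3⟩ := key (100 * σ) le_rfl (by omega)
  obtain ⟨X', a1', a2', a3'⟩ := key (1000 * σ) (by omega) le_rfl
  exact D.stab a1 a1' a2 a2' (by omega)

end

section

variable {G Q : Type*} [Group G] [Group Q] {π : G →* Q} {ℓ : G → ℤ} {δ : ℤ} {r : G} {σ L : ℤ}
  {b h : G → ℤ} {N : Subgroup G}

theorem AxisData.torFree (D : AxisData ℓ δ r σ L b h) (H : HypLen ℓ δ) (tf : TorFree G)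
    (hπ : Function.Surjective π) (hker : π.ker = Subgroup.normalClosure {r}) : TorFree Q := by
  have h0 := D.sig_pos H
  have hbig := D.big
  intro q m hm hq
  by_contra hq1
  obtain ⟨g, ⟨c, hc⟩, hmin⟩ := WellFounded.has_min
    (InvImage.wf (fun g => (ℓ g).toNat) Nat.lt_wfRel.wf) {g | ∃ c, π g = c * q * c⁻¹} (by
      obtain ⟨g, hg⟩ := hπ q
      exact ⟨g, 1, by simpa using hg⟩)
  replace hmin : ∀ w c, π w = c * q * c⁻¹ → ℓ g ≤ ℓ w := by
    intro w c hw
    have h1 := hmin w ⟨c, hw⟩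
    have h2 := H.nonneg g
    have h3 := H.nonneg w
    simp only [InvImage] at h1
    change ¬ ((ℓ w).toNat < (ℓ g).toNat) at h1
    omega
  have hgN : g ∉ π.ker := by
    intro hg
    rw [MonoidHom.mem_ker, hc] at hg
    exact hq1 (conj_eq_one_iff.1 hg)
  have hgm : g ^ m ∈ π.ker := by
    rw [MonoidHom.mem_ker, map_pow, hc, conj_pow, hq]; simp
  have hrN : r ∈ π.ker := by rw [hker]; exact Subgroup.subset_normalClosure rfl
  obtain ⟨y, hy⟩ := D.greendlinger' H (by rw [← hker]; exact hgm)
    (fun hc => hgN ((tf g m hm hc) ▸ Subgroup.one_mem _)) 1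
  rw [mul_one (g ^ m)] at hy
  by_cases hs : ℓ g ≤ 1000 * σ
  · have d1 : ds ℓ 1 (g * 1) ≤ 1000 * σ := by simpa [ds] using hs
    have d2 : ds ℓ (g ^ m) (g * g ^ m) ≤ 1000 * σ := by
      rw [← pow_succ', pow_succ]; simpa [ds] using hs
    by_cases ho : b (y⁻¹ * 1) ≤ b (y⁻¹ * g ^ m)
    · exact hgN (mem_of_conj_zpowers hrN (D.small_disp H (y := y) d1 d2 (by omega)))
    · exact hgN (mem_of_conj_zpowers hrN (D.small_disp H (y := y) d2 d1 (by omega)))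
  · have e : ∀ x, ∀ n ∈ π.ker, π (x⁻¹ * (n * (g * x))) = (π x⁻¹ * c) * q * (π x⁻¹ * c)⁻¹ := by
      intro x n hn
      rw [MonoidHom.mem_ker] at hn
      simp only [map_mul, hn, hc, map_inv]
      group
    by_cases ho : b (y⁻¹ * 1) ≤ b (y⁻¹ * g ^ m)
    · refine hgN (mem_of_conj_zpowers hrN (D.large_disp H hrN (y := y) (m := m) (by omega) ?_ (by omega)))
      exact fun x n hn => hmin _ _ (e x n hn)
    · refine hgN (inv_mem_iff.1 (mem_of_conj_zpowers hrN (D.large_disp H hrN (m := m) (g := g⁻¹)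
        (y := (g ^ m)⁻¹ * y) (by rw [H.inv]; omega) ?_ ?_)))
      · intro x n hn
        rw [H.inv]
        have := hmin _ _ (e x (g * n⁻¹ * g⁻¹) ((MonoidHom.normal_ker π).conj_mem _ (inv_mem hn) g))
        rw [← H.inv (x⁻¹ * _)] at this
        unfold ds
        convert this using 2
        group
      · have e1 : ((g ^ m)⁻¹ * y)⁻¹ * g⁻¹ ^ m = y⁻¹ * 1 := by simp
        have e2 : ((g ^ m)⁻¹ * y)⁻¹ * 1 = y⁻¹ * g ^ m := by simp
        rw [e1, e2]
        omega

/-- Short elements acquire no new centralisers in the quotient. -/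
theorem AxisData.commute_of_short (D : AxisData ℓ δ r σ L b h) (H : HypLen ℓ δ)
    (hN : N = Subgroup.normalClosure {r}) {g u : G} (hg : ℓ g ≤ 1000 * σ) (hgN : g ∉ N)
    (hu : Shortest ℓ N 1 u) (hc : u * g * u⁻¹ * g⁻¹ ∈ N) : u * g = g * u := by
  have h0 := D.sig_pos H
  have hbig := D.big
  have : N.Normal := by rw [hN]; infer_instance
  have hrN : r ∈ N := by rw [hN]; exact Subgroup.subset_normalClosure rfl
  by_contra hne
  obtain ⟨n, hn⟩ : ∃ n, n = u * g * u⁻¹ * g⁻¹ := ⟨_, rfl⟩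
  rw [← hn] at hc
  have eg : n * g = u * g * u⁻¹ := by rw [hn]; group
  have egu : n * g * u = u * g := by rw [hn]; group
  obtain ⟨y, hy⟩ := D.greendlinger' H (n := n) (by rw [← hN]; exact hc) (by
    rintro rfl
    rw [one_mul] at egu
    exact hne egu.symm) 1
  rw [mul_one n] at hy
  have r1 := D.reduced_near H hrN hu y
  have r2 := D.reduced_near H hrN (hu.mul_left (n * g)) y
  rw [egu, mul_one] at r2
  have l1 := D.b_lip (y⁻¹ * n) (y⁻¹ * (n * g))
  have l2 := D.b_lip (y⁻¹ * (n * g)) (y⁻¹ * n)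
  have l3 := D.b_lip (y⁻¹ * u) (y⁻¹ * (u * g))
  have l4 := D.b_lip (y⁻¹ * (u * g)) (y⁻¹ * u)
  have l5 := D.h_lip (y⁻¹ * u) (y⁻¹ * (u * g))
  have l6 := D.h_lip (y⁻¹ * (u * g)) (y⁻¹ * u)
  have d1 : ds ℓ n (n * g) = ℓ g := by simp [ds]
  have d2 : ds ℓ u (u * g) = ℓ g := by simp [ds]
  have d1' := H.ds_comm n (n * g)
  have d2' := H.ds_comm u (u * g)
  simp only [ds_mul_left] at l1 l2 l3 l4 l5 l6
  have key : ∀ t, 5000 * σ ≤ t → t ≤ 20000 * σ → ∃ X, h (y⁻¹ * X) ≤ 10 * σ ∧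
      h (y⁻¹ * (n * g * X)) ≤ 10 * σ ∧
      (b (y⁻¹ * 1) < b (y⁻¹ * n) → Near (b (y⁻¹ * X)) (b (y⁻¹ * u) - t) (5 * σ)) ∧
      (b (y⁻¹ * n) < b (y⁻¹ * 1) → Near (b (y⁻¹ * X)) (b (y⁻¹ * u) + t) (5 * σ)) := by
    intro t t1 t2
    obtain ⟨X, bX, hX, o1, o2⟩ : ∃ X, Btn ℓ (y⁻¹ * 1) (y⁻¹ * u) (y⁻¹ * X) ∧ h (y⁻¹ * X) ≤ 4 * σ ∧
        (b (y⁻¹ * 1) < b (y⁻¹ * n) → Near (b (y⁻¹ * X)) (b (y⁻¹ * u) - t) (5 * σ)) ∧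
        (b (y⁻¹ * n) < b (y⁻¹ * 1) → Near (b (y⁻¹ * X)) (b (y⁻¹ * u) + t) (5 * σ)) := by
      by_cases ho : b (y⁻¹ * 1) < b (y⁻¹ * n)
      · obtain ⟨X, e1, e2, e3⟩ := D.hit H (y⁻¹ * 1) (y⁻¹ * u)
          (b (y⁻¹ * u) - b (y⁻¹ * 1) - t) (by omega) (by omega)
        obtain ⟨X, rfl⟩ : ∃ X', X = y⁻¹ * X' := ⟨y * X, by simp⟩
        exact ⟨X, e1, e2, by omega, by omega⟩
      · obtain ⟨X, e1, e2, e3⟩ := D.hit H (y⁻¹ * u) (y⁻¹ * 1) t (by omega) (by omega)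
        obtain ⟨X, rfl⟩ : ∃ X', X = y⁻¹ * X' := ⟨y * X, by simp⟩
        exact ⟨X, H.btn_comm e1, e2, by omega, by omega⟩
    refine ⟨X, by omega, ?_, o1, o2⟩
    have bq : Btn ℓ (y⁻¹ * (n * g)) (y⁻¹ * (u * g)) (y⁻¹ * (n * g * X)) := by
      rw [btn_mul_left] at bX ⊢
      rw [← egu]
      have := (btn_mul_left (ℓ := ℓ) (n * g)).2 bX
      rwa [mul_one] at this
    by_contra hh
    have en := D.ends H bq (by omega)
    have a1 := D.lower' H (y⁻¹ * (n * g)) (y⁻¹ * (n * g * X))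
    have a2 := D.lower' H (y⁻¹ * (n * g * X)) (y⁻¹ * (u * g))
    have a3 := D.upper (y⁻¹ * (n * g)) (y⁻¹ * (u * g))
    have a4 := D.upper (y⁻¹ * X) (y⁻¹ * u)
    have a5 := D.lower' H (y⁻¹ * X) (y⁻¹ * u)
    have a6 := D.hnn (y⁻¹ * X)
    have e1 : ds ℓ (n * g * X) (u * g) = ds ℓ X u := by rw [← egu, ds_mul_left]
    unfold Btn at bq
    simp only [ds_mul_left] at a1 a2 a3 a4 a5 bq
    omega
  have fin : y⁻¹ * (n * g) * y ∈ Subgroup.zpowers r := by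
    obtain ⟨X, a1, a2, a3, a4⟩ := key (5000 * σ) le_rfl (by omega)
    obtain ⟨X', a1', a2', a3', a4'⟩ := key (10000 * σ) (by omega) (by omega)
    by_cases ho : b (y⁻¹ * 1) < b (y⁻¹ * n)
    · exact D.stab a1' a1 a2' a2 (by omega)
    · exact D.stab a1 a1' a2 a2' (by omega)
  have : n * g ∈ N := mem_of_conj_zpowers hrN fin
  exact hgN ((N.mul_mem_cancel_left hc).1 this)

theorem AxisData.commute_lift (D : AxisData ℓ δ r σ L b h) (H : HypLen ℓ δ)
    {g : G} (hg : ℓ g ≤ 1000 * σ) (hgN : g ∉ Subgroup.normalClosure {r}) (u : G)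
    (hc : u * g * u⁻¹ * g⁻¹ ∈ Subgroup.normalClosure {r}) :
    ∃ v, v * g = g * v ∧ u * v⁻¹ ∈ Subgroup.normalClosure {r} := by
  set N := Subgroup.normalClosure {r} with hN
  obtain ⟨n, hn, hmin⟩ := WellFounded.has_min
    (InvImage.wf (fun g => (ℓ (g * u)).toNat) Nat.lt_wfRel.wf) {n | n ∈ N} ⟨1, N.one_mem⟩
  refine ⟨n * u, ?_, ?_⟩
  · refine D.commute_of_short H hN hg hgN ?_ ?_
    · intro n' hn'
      have h1 := hmin (n' * n) (N.mul_mem hn' hn)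
      have h2 := H.nonneg (n * u)
      have h3 := H.nonneg (n' * n * u)
      change ¬ ((ℓ (n' * n * u)).toNat < (ℓ (n * u)).toNat) at h1
      rw [ds_one_left, ds_one_left, ← mul_assoc]
      omega
    · have e : n * u * g * (n * u)⁻¹ * g⁻¹ =
          n * (u * g * u⁻¹ * g⁻¹) * (g * n⁻¹ * g⁻¹) := by group
      rw [e]
      exact N.mul_mem (N.mul_mem hn hc)
        (Subgroup.normalClosure_normal.conj_mem _ (N.inv_mem hn) g)
  · have : u * (n * u)⁻¹ = n⁻¹ := by group
    rw [this]; exact N.inv_mem hn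

end

section

variable {G : Type*} [Group G] {ℓ : G → ℤ} {δ : ℤ}

theorem HypLen.pow_unbounded (H : HypLen ℓ δ) {g : G} (hg : Function.Injective fun n : ℕ => g ^ n)
    (M : ℤ) : ∃ n : ℕ, M < ℓ (g ^ n) := by
  by_contra! hc
  exact Set.infinite_of_injective_forall_mem hg (fun n => hc n) (H.fin M)

theorem HypLen.pow_le (H : HypLen ℓ δ) (g : G) (n : ℕ) : ℓ (g ^ n) ≤ n * ℓ g := by
  induction n with
  | zero => simp [H.one]
  | succ n ih =>
    have := H.mul (g ^ n) g
    rw [pow_succ]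
    push_cast
    linarith

theorem TorFree.pow_injective (tf : TorFree G) {g : G} (hg : g ≠ 1) :
    Function.Injective fun n : ℕ => g ^ n := by
  have key : ∀ a k : ℕ, g ^ a = g ^ (a + k) → k = 0 := by
    intro a k h
    by_contra hk
    rw [pow_add] at h
    exact hg (tf g k hk (by simpa using h.symm))
  intro a c h
  simp only at h
  rcases le_total a c with h' | h'
  · obtain ⟨k, rfl⟩ := Nat.exists_eq_add_of_le h'
    rw [key a k h]; rfl
  · obtain ⟨k, rfl⟩ := Nat.exists_eq_add_of_le h'
    rw [key c k h.symm]; rfl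

/-- Some power of an element of infinite order is conjugate to a loxodromic element with large
translation length. -/
theorem HypLen.lox (H : HypLen ℓ δ) {g : G} (hg : Function.Injective fun n : ℕ => g ^ n)
    (C : ℤ) : ∃ j : ℕ, j ≠ 0 ∧ ∃ m, C ≤ ℓ (m⁻¹ * g ^ j * m) ∧
      2 * ℓ (m⁻¹ * g ^ j * m) ≤ ℓ ((m⁻¹ * g ^ j * m) ^ 2) + 5 * δ := by
  classical
  have hd := H.dpos
  obtain ⟨R, hR⟩ : ∃ R : ℤ, R = max C 0 + 10 * δ := ⟨_, rfl⟩
  set J := (H.fin R).toFinset.card with hJ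
  have hgn := H.nonneg g
  obtain ⟨T, hT⟩ : ∃ T : ℤ, T = 2 * J * ℓ g := ⟨_, rfl⟩
  have hT0 : 0 ≤ T := by rw [hT]; positivity
  have hpow : ∀ i : ℕ, i ≤ 2 * J → ℓ (g ^ i) ≤ T := by
    intro i hi
    have h1 := H.pow_le g i
    have h2 : (i : ℤ) ≤ 2 * J := by exact_mod_cast hi
    nlinarith
  obtain ⟨n, hn⟩ := H.pow_unbounded hg (100 * (T + R + δ))
  obtain ⟨c, hc⟩ : ∃ c, c = g ^ n := ⟨_, rfl⟩
  rw [← hc] at hn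
  have hcg : ∀ i : ℕ, g ^ i * c = c * g ^ i := fun i => by rw [hc, ← pow_add, ← pow_add, add_comm]
  obtain ⟨m, hm1, hm2⟩ := H.exists_between 1 c (ℓ c / 2) (by omega) (by rw [ds_one_left]; omega)
  obtain ⟨j, hj0, hjJ, hjR⟩ : ∃ j : ℕ, j ≠ 0 ∧ j ≤ J ∧ R < ℓ (m⁻¹ * g ^ j * m) := by
    by_contra! hcon
    have : (Finset.range (J + 1)).card ≤ (H.fin R).toFinset.card := by
      apply Finset.card_le_card_of_injOn (fun j => m⁻¹ * g ^ j * m)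
      · intro j hj
        simp only [Finset.coe_range, Set.mem_Iio] at hj
        simp only [Set.Finite.coe_toFinset, Set.mem_ofPred_eq]
        by_cases h0 : j = 0
        · subst h0; simp [H.one]; omega
        · exact hcon j h0 (by omega)
      · intro a _ b _ hab
        exact hg (by simpa using hab)
    rw [Finset.card_range] at this
    omega
  refine ⟨j, hj0, m, by omega, ?_⟩
  have far : ∀ i : ℕ, i ≤ 2 * J → ds ℓ 1 (g ^ i * m) + ds ℓ (g ^ i * m) c ≤ ℓ c + 2 * δ ∧
      Near (ds ℓ 1 (g ^ i * m)) (ℓ c / 2) T ∧ Near (ds ℓ (g ^ i * m) c) (ℓ c / 2) (T + 1) := by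
    intro i hi
    have e0 := hpow i hi
    have e1 := ds_mul_left ℓ (g ^ i) 1 m
    have e2 := ds_mul_left ℓ (g ^ i) m c
    have e3 := ds_mul_left ℓ (g ^ i) 1 c
    have e4 : ds ℓ c (g ^ i * c) = ℓ (g ^ i) := by rw [hcg]; simp [ds]
    have e5 := ds_one_left ℓ (g ^ i)
    rw [mul_one] at e1 e3
    have e6 := ds_one_left ℓ c
    have f1 := H.ds_tri 1 (g ^ i) (g ^ i * m)
    have f2 := H.ds_tri (g ^ i) 1 (g ^ i * m)
    have f3 := H.ds_tri (g ^ i * m) (g ^ i * c) c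
    have f4 := H.ds_tri (g ^ i * m) c (g ^ i * c)
    have f5 := H.ds_comm c (g ^ i * c)
    have f6 := H.ds_comm 1 (g ^ i)
    have f7 := H.ds_comm c (g ^ i * m)
    have f8 := H.ds_comm (g ^ i) (g ^ i * m)
    have f9 := H.ds_comm (g ^ i * m) (g ^ i * c)
    have f10 := H.ds_tri 1 c (g ^ i * c)
    have f11 := H.ds_tri 1 (g ^ i * c) c
    have k1 := H.hyp 1 (g ^ i * m) (g ^ i) (g ^ i * c)
    have k2 := H.hyp c (g ^ i * m) 1 (g ^ i * c)
    have f12 := H.ds_comm 1 c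
    have f13 := H.ds_comm 1 (g ^ i * m)
    have f14 := H.ds_comm 1 (g ^ i * c)
    refine ⟨?_, by omega, by omega⟩
    omega
  have a0 := far 0 (by omega)
  have a1 := far j (by omega)
  have a2 := far (j + j) (by omega)
  have e0 := hpow j (by omega)
  rw [pow_zero, one_mul] at a0
  obtain ⟨y, hy⟩ : ∃ y, y = g ^ j * m := ⟨_, rfl⟩
  obtain ⟨z, hz⟩ : ∃ z, z = g ^ j * y := ⟨_, rfl⟩
  rw [← hy] at a1
  rw [pow_add, mul_assoc, ← hy, ← hz] at a2
  have d1 : ℓ (m⁻¹ * g ^ j * m) = ds ℓ m y := by rw [hy]; simp [ds, mul_assoc]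
  have d2 : ℓ ((m⁻¹ * g ^ j * m) ^ 2) = ds ℓ m z := by
    rw [hz, hy, pow_two]; simp [ds, mul_assoc]
  obtain ⟨p, hp⟩ : ∃ p, p = (g ^ j)⁻¹ := ⟨_, rfl⟩
  obtain ⟨q, hq⟩ : ∃ q, q = (g ^ j)⁻¹ * c := ⟨_, rfl⟩
  have x1 := ds_mul_left ℓ (g ^ j) m p
  have x2 := ds_mul_left ℓ (g ^ j) m q
  have x3 := ds_mul_left ℓ (g ^ j) y p
  have x4 := ds_mul_left ℓ (g ^ j) y q
  have gp : g ^ j * p = 1 := by rw [hp]; simp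
  have gq : g ^ j * q = c := by rw [hq]; simp
  have x5 : ds ℓ 1 p = ℓ (g ^ j) := by rw [ds_one_left, hp, H.inv]
  have x6 : ds ℓ c q = ℓ (g ^ j) := by
    rw [← ds_mul_left ℓ (g ^ j), gq, hcg, H.ds_comm]; simp [ds]
  rw [gp, ← hy] at x1
  rw [gq, ← hy] at x2
  rw [gp, ← hz] at x3
  rw [gq, ← hz] at x4
  have k1 := H.hyp m p y 1
  have k2 := H.hyp m 1 y p
  have k3 := H.hyp m q y c
  have k4 := H.hyp m c y q
  have k5 := H.hyp m y 1 c
  have l1 := H.ds_tri m y 1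
  have l2 := H.ds_tri m y c
  have l3 := H.ds_tri y m 1
  have l4 := H.ds_tri y m c
  have l5 := H.ds_tri m z 1
  have l6 := H.ds_tri m z c
  have l7 := H.ds_tri z m 1
  have l8 := H.ds_tri z m c
  have l9 := H.ds_tri m 1 p
  have l10 := H.ds_tri y 1 p
  have l11 := H.ds_tri m c q
  have l12 := H.ds_tri y c q
  have l13 := H.ds_tri m p 1
  have l14 := H.ds_tri y p 1
  have l15 := H.ds_tri m q c
  have l16 := H.ds_tri y q c
  have s1 := H.ds_comm 1 m
  have s2 := H.ds_comm 1 y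
  have s3 := H.ds_comm 1 z
  have s4 := H.ds_comm m y
  have s5 := H.ds_comm m z
  have s6 := H.ds_comm p 1
  have s7 := H.ds_comm q c
  have s9 := ds_one_left ℓ c
  have s10 := H.ds_comm p y
  have s11 := H.ds_comm q y
  have s12 := H.ds_comm c y
  rw [d1] at hjR ⊢
  rw [d2]
  have my : ds ℓ m y ≤ 2 * T + 2 + 2 * δ := by
    clear k1 k2 k3 k4 x1 x2 x3 x4 x5 x6 l1 l2 l3 l4 l5 l6 l7 l8 l9 l10 l11 l12 l13 l14 l15 l16 d1 d2 e0 a2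
    clear far hpow
    omega
  have pos1 : Near ((ds ℓ y p - ds ℓ y 1) - (ds ℓ m p - ds ℓ m 1)) 0 δ := by
    clear k3 k4 k5 x1 x2 x3 x4 x6 l1 l2 l3 l4 l5 l6 l7 l8 l11 l12 l15 l16 d1 d2 a2 hpow far
    omega
  have pos2 : Near ((ds ℓ y q - ds ℓ y c) - (ds ℓ m q - ds ℓ m c)) 0 δ := by
    clear k1 k2 k5 x1 x2 x3 x4 x5 l1 l2 l3 l4 l5 l6 l7 l8 l9 l10 l13 l14 d1 d2 a2 hpow far pos1
    omega
  have b0 := H.ds_nonneg m y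
  have t1 : ds ℓ y 1 - ds ℓ m 1 - (ds ℓ z 1 - ds ℓ y 1) ≤ δ ∧ ds ℓ z 1 - ds ℓ y 1 - (ds ℓ y 1 - ds ℓ m 1) ≤ δ := by
    clear k1 k2 k3 k4 k5 x2 x4 x5 x6 l1 l2 l3 l4 l5 l6 l7 l8 l9 l10 l11 l12 l13 l14 l15 l16 d1 d2 a0 a1 a2 hpow far pos2
    omega
  have t2 : ds ℓ y c - ds ℓ m c - (ds ℓ z c - ds ℓ y c) ≤ δ ∧ ds ℓ z c - ds ℓ y c - (ds ℓ y c - ds ℓ m c) ≤ δ := by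
    clear k1 k2 k3 k4 k5 x1 x3 x5 x6 l1 l2 l3 l4 l5 l6 l7 l8 l9 l10 l11 l12 l13 l14 l15 l16 d1 d2 a0 a1 a2 hpow far pos1
    omega
  clear k1 k2 k3 k4 x1 x2 x3 x4 x5 x6 l9 l10 l11 l12 l13 l14 l15 l16 d1 d2 hpow far pos1 pos2
  omega

end

section

variable {G : Type*} [Group G] {ℓ : G → ℤ} {δ κ : ℤ} {s : G} {f : ℤ → G} {b h : G → ℤ}

/-- Doubled Busemann-type position `b` and height `h` relative to a quasi-geodesic line `f` which
is invariant under `s`. -/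
structure LineData (ℓ : G → ℤ) (δ κ : ℤ) (s : G) (f : ℤ → G) (b h : G → ℤ) : Prop where
  hnn : ∀ x, 0 ≤ h x
  b1 : b 1 = 0
  b_lip : ∀ x y, b x - b y ≤ 2 * ds ℓ x y
  h_lip : ∀ x y, h x - h y ≤ 2 * ds ℓ x y
  upper : ∀ x y, 2 * ds ℓ x y ≤ h x + h y + (b x - b y) + 2 * δ ∨
    2 * ds ℓ x y ≤ h x + h y + (b y - b x) + 2 * δ
  lower : ∀ x y, b x - b y > 2 * δ → h x + h y + (b x - b y) ≤ 2 * ds ℓ x y + 2 * δ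
  shift : ∀ ε x, ε * s = s * ε → Near (b (ε * x)) (b x + b ε) (4 * δ)
  hshift : ∀ ε x, ε * s = s * ε → Near (h (ε * x)) (h x) (4 * δ)
  hf : ∀ k, h (f k) ≤ κ
  bf : ∀ i j, i ≤ j → 2 * ds ℓ (f i) (f j) ≤ b (f j) - b (f i) + 2 * κ

theorem exists_eventually_eq_hyperfilter {u : ℕ → ℤ} {c C : ℤ} (hu : ∀ n, c ≤ u n ∧ u n ≤ C) :
    ∃ v, ∀ᶠ n in (Filter.hyperfilter ℕ : Filter ℕ), u n = v := by
  have := (Ultrafilter.eventually_exists_mem_iff (f := Filter.hyperfilter ℕ)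
    (P := fun v n => u n = v) (Set.finite_Icc c C)).1
    (Filter.Eventually.of_forall fun n => ⟨u n, hu n, rfl⟩)
  obtain ⟨v, -, hv⟩ := this
  exact ⟨v, hv⟩

/-- A quasi-geodesic chain invariant under `s` carries line data. -/
theorem HypLen.exists_lineData (H : HypLen ℓ δ) {n : ℤ} (hn : 1 ≤ n) (f0 : f 0 = 1)
    (hs : ∀ i, f (i + n) = s * f i)
    (hc : ∀ i j k, i ≤ j → j ≤ k → ds ℓ (f i) (f j) + ds ℓ (f j) (f k) ≤ ds ℓ (f i) (f k) + κ)
    (hg : ∀ (i : ℤ) (m : ℕ), (m : ℤ) ≤ ds ℓ (f i) (f (i + m))) :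
    ∃ b h, LineData ℓ δ κ s f b h := by
  have hd := H.dpos
  have fpos : ∀ (K : ℕ) i, f (i + K * n) = s ^ K * f i := by
    intro K i
    induction K with
    | zero => simp
    | succ K ih => rw [pow_succ', mul_assoc, ← ih, ← hs]; congr 1; push_cast; ring
  obtain ⟨q, hq⟩ : ∃ q : ℕ → G, ∀ K, q K = s ^ K := ⟨fun K => s ^ K, fun _ => rfl⟩
  obtain ⟨p, hp⟩ : ∃ p : ℕ → G, ∀ K, p K = (s ^ K)⁻¹ := ⟨fun K => (s ^ K)⁻¹, fun _ => rfl⟩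
  have fq : ∀ K : ℕ, f (K * n) = q K := by
    intro K; have := fpos K 0; rw [zero_add, f0, mul_one] at this; rw [this, hq]
  have fp : ∀ K : ℕ, f (-(K * n)) = p K := by
    intro K; have := fpos K (-(K * n))
    rw [neg_add_cancel, f0] at this; rw [hp]; exact eq_inv_of_mul_eq_one_right this.symm
  have grow : ∀ K : ℕ, (K : ℤ) ≤ ds ℓ 1 (p K) ∧ (K : ℤ) ≤ ds ℓ 1 (q K) := by
    intro K
    have e1 := hg (-(K * n)) (K * n.toNat)
    have e2 := hg 0 (K * n.toNat)
    have e3 : ((K * n.toNat : ℕ) : ℤ) = K * n := by push_cast; rw [Int.toNat_of_nonneg (by omega)]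
    rw [e3] at e1 e2
    rw [neg_add_cancel, f0, fp, H.ds_comm] at e1
    rw [zero_add, f0, fq] at e2
    have : (K : ℤ) ≤ K * n := le_mul_of_one_le_right (by positivity) hn
    omega
  have ord : ∀ K : ℕ, 0 ≤ (K : ℤ) * n := fun K => by positivity
  have mid : ∀ K : ℕ, ds ℓ 1 (p K) + ds ℓ 1 (q K) ≤ ds ℓ (p K) (q K) + κ := by
    intro K
    have := hc (-(K * n)) 0 (K * n) (by have := ord K; omega) (ord K)
    rwa [fp, fq, f0, H.ds_comm (p K) 1] at this
  have eb : ∀ x, ∃ v, ∀ᶠ K in (Filter.hyperfilter ℕ : Filter ℕ),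
      (ds ℓ x (p K) - ds ℓ x (q K)) - (ds ℓ 1 (p K) - ds ℓ 1 (q K)) = v := by
    intro x
    refine exists_eventually_eq_hyperfilter (c := - (2 * ds ℓ x 1)) (C := 2 * ds ℓ x 1) fun K => ?_
    have h1 := H.ds_tri x 1 (p K)
    have h2 := H.ds_tri x 1 (q K)
    have h3 := H.ds_tri 1 x (p K)
    have h4 := H.ds_tri 1 x (q K)
    rw [H.ds_comm 1 x] at h3 h4
    omega
  have eh : ∀ x, ∃ v, ∀ᶠ K in (Filter.hyperfilter ℕ : Filter ℕ),
      ds ℓ x (p K) + ds ℓ x (q K) - ds ℓ (p K) (q K) = v := by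
    intro x
    refine exists_eventually_eq_hyperfilter (c := 0) (C := 2 * ds ℓ x 1 + κ) fun K => ?_
    have h1 := H.ds_tri x 1 (p K)
    have h2 := H.ds_tri x 1 (q K)
    have h3 := mid K
    have h4 := H.ds_tri (p K) x (q K)
    rw [H.ds_comm (p K) x] at h4
    omega
  choose b hb using eb
  choose h hh using eh
  have large : ∀ M : ℤ, ∀ᶠ K : ℕ in (Filter.hyperfilter ℕ : Filter ℕ), M ≤ (K : ℤ) := by
    intro M
    refine Nat.hyperfilter_le_atTop ?_
    filter_upwards [Filter.eventually_ge_atTop M.toNat] with K (hK : M.toNat ≤ K)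
    omega
  have ex2 : ∀ x y M, ∃ K : ℕ, M ≤ (K : ℤ) ∧
      (ds ℓ x (p K) - ds ℓ x (q K)) - (ds ℓ 1 (p K) - ds ℓ 1 (q K)) = b x ∧
      (ds ℓ y (p K) - ds ℓ y (q K)) - (ds ℓ 1 (p K) - ds ℓ 1 (q K)) = b y ∧
      ds ℓ x (p K) + ds ℓ x (q K) - ds ℓ (p K) (q K) = h x ∧
      ds ℓ y (p K) + ds ℓ y (q K) - ds ℓ (p K) (q K) = h y := by
    intro x y M
    exact ((large M).and ((hb x).and ((hb y).and ((hh x).and (hh y))))).exists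
  have comm_inv : ∀ ε, ε * s = s * ε → ∀ K, ds ℓ (p K) (ε⁻¹ * p K) = ℓ ε ∧
      ds ℓ (q K) (ε⁻¹ * q K) = ℓ ε ∧ ds ℓ (ε⁻¹ * p K) (ε⁻¹ * q K) = ds ℓ (p K) (q K) := by
    intro ε he K
    have c0 : Commute ε⁻¹ (s ^ K) := (Commute.inv_left (show Commute ε s from he)).pow_right K
    refine ⟨?_, ?_, ds_mul_left ℓ _ _ _⟩
    · rw [hp, (c0.inv_right).eq]; simp [ds, H.inv]
    · rw [hq, c0.eq]; simp [ds, H.inv]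
  refine ⟨b, h, ?_, ?_, ?_, ?_, ?_, ?_, ?_, ?_, ?_, ?_⟩
  · intro x
    obtain ⟨K, -, -, -, e, -⟩ := ex2 x x 0
    have h4 := H.ds_tri (p K) x (q K)
    rw [H.ds_comm (p K) x] at h4
    omega
  · obtain ⟨K, -, e, -⟩ := ex2 1 1 0
    omega
  · intro x y
    obtain ⟨K, -, e1, e2, e3, e4⟩ := ex2 x y 0
    have h1 := H.ds_tri x y (p K)
    have h2 := H.ds_tri y x (q K)
    rw [H.ds_comm y x] at h2
    omega
  · intro x y
    obtain ⟨K, -, e1, e2, e3, e4⟩ := ex2 x y 0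
    have h1 := H.ds_tri x y (p K)
    have h2 := H.ds_tri x y (q K)
    omega
  · intro x y
    obtain ⟨K, -, e1, e2, e3, e4⟩ := ex2 x y 0
    have h1 := H.hyp x y (p K) (q K)
    omega
  · intro x y
    obtain ⟨K, -, e1, e2, e3, e4⟩ := ex2 x y 0
    have h1 := H.hyp x (p K) y (q K)
    have h2 := H.ds_comm (p K) y
    omega
  · intro ε x he
    obtain ⟨K, eK, e1, e2, e3, e4, e5⟩ := ((large (10 * (ds ℓ x 1 + ℓ ε + δ))).and
      ((hb x).and ((hb ε).and ((hb (ε * x)).and ((hh x).and (hh (ε * x))))))).exists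
    obtain ⟨c1, c2, c3⟩ := comm_inv ε he K
    have a1 : ∀ z w, ds ℓ (ε * z) w = ds ℓ z (ε⁻¹ * w) := fun z w => by
      rw [← ds_mul_left ℓ ε z]; simp
    have a2 := a1 1
    rw [mul_one] at a2
    rw [a1, a1] at e3
    rw [a2, a2] at e2
    obtain ⟨g1, g2⟩ := grow K
    have hl := H.nonneg ε
    have hx := H.ds_nonneg x 1
    have key : ∀ w w', ds ℓ w w' = ℓ ε → 10 * (ds ℓ x 1 + ℓ ε + δ) ≤ ds ℓ 1 w →
        Near (ds ℓ x w' - ds ℓ x w) (ds ℓ 1 w' - ds ℓ 1 w) δ := by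
      intro w w' h1 h2
      have k1 := H.hyp x w 1 w'
      have k2 := H.hyp x w' 1 w
      have t1 := H.ds_tri 1 x w
      have t2 := H.ds_tri x w' w
      have t3 := H.ds_tri 1 w' w
      have t4 := H.ds_comm 1 x
      have t5 := H.ds_comm w' w
      have t6 := H.ds_comm 1 w
      have t7 := H.ds_comm 1 w'
      clear e1 e2 e3 e4 e5 c1 c2 c3
      omega
    have k1 := key _ _ c1 (by omega)
    have k2 := key _ _ c2 (by omega)
    omega
  · intro ε x he
    obtain ⟨K, eK, e5, e6⟩ := ((large (10 * (ds ℓ x 1 + ℓ ε + δ) + κ)).and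
      ((hh x).and (hh (ε * x)))).exists
    obtain ⟨c1, c2, c3⟩ := comm_inv ε he K
    have a1 : ∀ z w, ds ℓ (ε * z) w = ds ℓ z (ε⁻¹ * w) := fun z w => by
      rw [← ds_mul_left ℓ ε z]; simp
    rw [a1, a1] at e6
    obtain ⟨g1, g2⟩ := grow K
    have hl := H.nonneg ε
    have hx := H.ds_nonneg x 1
    have hm := mid K
    generalize p K = P at *
    generalize q K = R at *
    generalize hP' : ε⁻¹ * P = P' at *
    generalize hR' : ε⁻¹ * R = R' at *
    have k1 := H.hyp x P R' P'
    have k2 := H.hyp x P' R' P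
    have k3 := H.hyp x R P R'
    have k4 := H.hyp x R' P R
    have t0 := H.ds_comm x 1
    have t1 := H.ds_tri x 1 P
    have t2 := H.ds_tri x 1 R
    have t3 := H.ds_tri 1 x P
    have t4 := H.ds_tri 1 x R
    have t5 := H.ds_tri x P P'
    have t6 := H.ds_tri x P' P
    have t7 := H.ds_tri x R R'
    have t8 := H.ds_tri x R' R
    have t9 := H.ds_tri P R R'
    have t10 := H.ds_tri P R' R
    have s1 := H.ds_comm P P'
    have s2 := H.ds_comm R R'
    have s3 := H.ds_comm R' P'
    have s4 := H.ds_comm R' P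
    have s5 := H.ds_comm R P
    have s6 := H.ds_comm R' R
    have u1 : Near (ds ℓ x P' + ds ℓ P R') (ds ℓ x P + ds ℓ P R) δ := by
      clear k3 k4 e5 e6
      omega
    have u2 : Near (ds ℓ x R' + ds ℓ P R) (ds ℓ x R + ds ℓ P R') δ := by
      clear k1 k2 e5 e6 u1
      omega
    clear k1 k2 k3 k4
    omega
  · intro k
    obtain ⟨K, eK, -, -, e, -⟩ := ex2 (f k) (f k) |k|
    have hK : (K : ℤ) ≤ K * n := le_mul_of_one_le_right (by positivity) hn
    have hk := abs_le.1 (eK.trans hK)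
    have := hc _ _ _ hk.1 hk.2
    rw [fp, fq, H.ds_comm (p K)] at this
    omega
  · intro i j hij
    obtain ⟨K, eK, e1, e2, -⟩ := ex2 (f i) (f j) (|i| + |j|)
    have hK : (K : ℤ) ≤ K * n := le_mul_of_one_le_right (by positivity) hn
    have hi := abs_le.1 (show |i| ≤ (K : ℤ) * n by have := abs_nonneg j; omega)
    have hj := abs_le.1 (show |j| ≤ (K : ℤ) * n by have := abs_nonneg i; omega)
    have c1 := hc _ _ _ hi.1 hij
    have c2 := hc _ _ _ hij hj.2
    rw [fp, H.ds_comm (p K), H.ds_comm (p K)] at c1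
    rw [fq] at c2
    omega

end

section

variable {G : Type*} [Group G] {ℓ : G → ℤ} {δ κ : ℤ} {s : G} {f : ℤ → G} {b h : G → ℤ}

/-- Positions along the net of a line are dense. -/
theorem LineData.dense (D : LineData ℓ δ κ s f b h) {M : ℤ} (hM : ∀ i, ds ℓ (f i) (f (i + 1)) ≤ M)
    (hg : ∀ (i : ℤ) (m : ℕ), (m : ℤ) ≤ ds ℓ (f i) (f (i + m))) (H : HypLen ℓ δ) (f0 : f 0 = 1)
    (t : ℤ) : ∃ k, b (f k) ≤ t ∧ t < b (f k) + 2 * M := by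
  have up : ∀ m : ℕ, 2 * (m : ℤ) - 2 * κ ≤ b (f m) := by
    intro m
    have e1 := D.bf 0 m (by omega)
    have e2 := hg 0 m
    rw [zero_add] at e2
    rw [f0, D.b1] at e1
    rw [f0] at e2
    omega
  have dn : ∀ m : ℕ, b (f (-m)) ≤ 2 * κ - 2 * (m : ℤ) := by
    intro m
    have e1 := D.bf (-m) 0 (by omega)
    have e2 := hg (-m) m
    rw [neg_add_cancel] at e2
    rw [f0, D.b1] at e1
    rw [f0] at e2
    omega
  obtain ⟨k, hk, hk2⟩ := Int.exists_greatest_of_bdd (P := fun k => b (f k) ≤ t)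
    ⟨|t| + |κ|, fun z hz => by
      by_contra hc
      have e := up z.toNat
      have h1 := le_abs_self t
      have h2 := le_abs_self κ
      have h3 := abs_nonneg t
      have h4 := abs_nonneg κ
      rw [Int.toNat_of_nonneg (by omega)] at e
      omega⟩
    ⟨-(|t| + |κ|), by
      have e := dn (|t| + |κ|).toNat
      have h1 := neg_abs_le t
      have h2 := le_abs_self κ
      have h3 := abs_nonneg t
      have h4 := abs_nonneg κ
      rw [Int.toNat_of_nonneg (by omega)] at e
      omega⟩
  refine ⟨k, hk, ?_⟩
  by_contra hc
  have e1 := D.b_lip (f (k + 1)) (f k)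
  have e2 := hM k
  rw [H.ds_comm] at e1
  have := hk2 (k + 1) (by omega)
  omega

/-- A sufficiently loxodromic element. -/
structure Lox (ℓ : G → ℤ) (δ : ℤ) (s : G) : Prop where
  big : 100 * δ ≤ ℓ s
  sq : 2 * ℓ s ≤ ℓ (s ^ 2) + 5 * δ

namespace Lox

theorem step (s : G) (i : ℤ) : ds ℓ (s ^ i) (s ^ (i + 1)) = ℓ s := by
  rw [zpow_chain, zpow_one]

theorem chain_hyp (S : Lox ℓ δ s) (i : ℤ) : ds ℓ (s ^ i) (s ^ (i + 1)) +
    ds ℓ (s ^ (i + 1)) (s ^ (i + 2)) ≤ ds ℓ (s ^ i) (s ^ (i + 2)) + 5 * δ := by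
  have e : ds ℓ (s ^ (i + 1)) (s ^ (i + 2)) = ℓ s := by
    rw [← step (ℓ := ℓ) s (i + 1), add_assoc]; rfl
  rw [step, e, zpow_chain]
  have := S.sq
  norm_cast
  omega

theorem chain (S : Lox ℓ δ s) (H : HypLen ℓ δ) {i j k : ℤ} (hij : i ≤ j) (hjk : j ≤ k) :
    ds ℓ (s ^ i) (s ^ j) + ds ℓ (s ^ j) (s ^ k) ≤ ds ℓ (s ^ i) (s ^ k) + 7 * δ := by
  have hd := H.dpos
  have := S.big
  have := H.chain (f := fun i => s ^ i) (A := ℓ s) (κ := 5 * δ) (by omega) (by omega)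
    (fun i => (step s i).ge) S.chain_hyp hij hjk
  beta_reduce at this
  omega

theorem growth (S : Lox ℓ δ s) (H : HypLen ℓ δ) (i : ℤ) (m : ℕ) :
    (m : ℤ) ≤ ds ℓ (s ^ i) (s ^ (i + m)) := by
  have hd := H.dpos
  have := S.big
  exact H.chain_growth (f := fun i => s ^ i) (A := ℓ s) (κ := 5 * δ) (by omega) (by omega)
    (fun i => (step s i).ge) S.chain_hyp i m

theorem lineData (S : Lox ℓ δ s) (H : HypLen ℓ δ) :
    ∃ b h, LineData ℓ δ (7 * δ) s (fun i => s ^ i) b h :=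
  H.exists_lineData (n := 1) le_rfl (zpow_zero s) (fun i => by rw [add_comm, zpow_one_add])
    (fun _ _ _ h1 h2 => S.chain H h1 h2) (fun i m => S.growth H i m)

theorem dense (S : Lox ℓ δ s) (H : HypLen ℓ δ) (D : LineData ℓ δ (7 * δ) s (fun i => s ^ i) b h)
    (t : ℤ) : ∃ k : ℤ, b (s ^ k) ≤ t ∧ t < b (s ^ k) + 2 * ℓ s :=
  D.dense (M := ℓ s) (fun i => (step s i).le) (fun i m => S.growth H i m) H (zpow_zero s) t

theorem ne_one (S : Lox ℓ δ s) (H : HypLen ℓ δ) : s ≠ 1 := by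
  rintro rfl
  have := S.big
  have := H.dpos
  rw [H.one] at *
  omega

theorem zpow_ne_one (S : Lox ℓ δ s) (H : HypLen ℓ δ) {k : ℤ} (hk : k ≠ 0) : s ^ k ≠ 1 := by
  have key : ∀ n : ℕ, n ≠ 0 → s ^ n ≠ 1 := by
    intro n hn h1
    have := S.growth H 0 n
    rw [zpow_chain, zpow_natCast, h1, H.one] at this
    omega
  rcases Int.natAbs_eq k with e | e <;> rw [e]
  · rw [zpow_natCast]; exact key _ (by omega)
  · rw [zpow_neg, zpow_natCast, ne_eq, inv_eq_one]; exact key _ (by omega)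

theorem bs_aux (S : Lox ℓ δ s) (H : HypLen ℓ δ) {g : G} {a c : ℕ} (hac : a < c)
    (e : ∀ k : ℕ, Near (ℓ (s ^ (a * k))) (ℓ (s ^ (c * k))) (2 * ℓ g)) : False := by
  have hg := H.nonneg g
  have hd := H.dpos
  obtain ⟨k, hk⟩ : ∃ k : ℕ, k = (2 * ℓ g + 7 * δ + 1).toNat := ⟨_, rfl⟩
  have h1 := e k
  obtain ⟨d, rfl⟩ := Nat.exists_eq_add_of_lt hac
  have h2 := S.chain H (i := 0) (j := (a * k : ℕ)) (k := ((a + d + 1) * k : ℕ)) (by omega)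
    (by norm_cast; exact Nat.mul_le_mul_right _ (by omega))
  have h3 := S.growth H ((a * k : ℕ)) ((d + 1) * k)
  have h4 : ((a * k : ℕ) : ℤ) + (((d + 1) * k : ℕ) : ℤ) = (((a + d + 1) * k : ℕ) : ℤ) := by
    push_cast; ring
  rw [h4] at h3
  rw [zpow_zero, ds_one_left, ds_one_left, zpow_natCast, zpow_natCast] at h2
  have h5 : k ≤ (d + 1) * k := Nat.le_mul_of_pos_left _ (by omega)
  rw [zpow_natCast, zpow_natCast] at h3
  have h6 : (k : ℤ) ≤ ((d + 1) * k : ℕ) := by exact_mod_cast h5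
  omega

theorem bs (S : Lox ℓ δ s) (H : HypLen ℓ δ) {g : G} {a c : ℤ} (e : g * s ^ a * g⁻¹ = s ^ c) :
    a.natAbs = c.natAbs := by
  have abs : ∀ (a : ℤ) (k : ℕ), ℓ (s ^ (a.natAbs * k)) = ℓ ((s ^ a) ^ k) := by
    intro a k
    rcases Int.natAbs_eq a with e | e
    · conv_rhs => rw [e, zpow_natCast, ← pow_mul]
    · conv_rhs => rw [e, zpow_neg, zpow_natCast, inv_pow, H.inv, ← pow_mul]
  have key : ∀ k : ℕ, Near (ℓ (s ^ (a.natAbs * k))) (ℓ (s ^ (c.natAbs * k))) (2 * ℓ g) := by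
    intro k
    rw [abs, abs, ← e, conj_pow]
    have h1 := H.mul (g * (s ^ a) ^ k) g⁻¹
    have h2 := H.mul g ((s ^ a) ^ k)
    have h3 := H.mul g⁻¹ (g * (s ^ a) ^ k * g⁻¹ * g)
    have h4 := H.mul (g * (s ^ a) ^ k * g⁻¹) g
    rw [H.inv] at h1 h3
    simp only [inv_mul_cancel_right, inv_mul_cancel_left] at h3 h4
    omega
  rcases lt_trichotomy a.natAbs c.natAbs with h' | h' | h'
  · exact (S.bs_aux H h' key).elim
  · exact h'
  · exact (S.bs_aux H (g := g) h' fun k => by have := key k; omega).elim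

/-- The centraliser of a loxodromic element of a torsion-free group is cyclic. -/
theorem centralizer (S : Lox ℓ δ s) (H : HypLen ℓ δ) (tf : TorFree G) :
    ∃ z, ∀ x, x * s = s * x → x ∈ Subgroup.zpowers z := by
  have hd := H.dpos
  have hS := S.big
  obtain ⟨b, h, D⟩ := S.lineData H
  set Z := Subgroup.centralizer ({s} : Set G) with hZ
  have hsZ : s ∈ Z := by simp [hZ, Subgroup.mem_centralizer_iff]
  have hcom : ∀ x ∈ Z, x * s = s * x := by
    intro x hx
    have := Subgroup.mem_centralizer_iff.1 hx s rfl
    exact this.symm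
  set s' : Z := ⟨s, hsZ⟩ with hs'
  have hcen : Subgroup.zpowers s' ≤ Subgroup.center Z := by
    rw [Subgroup.zpowers_le, Subgroup.mem_center_iff]
    intro x
    exact Subtype.ext (hcom x x.2)
  have hball : Finite {x : Z // ℓ x ≤ 2 * ℓ s} := by
    have := (H.fin (2 * ℓ s)).to_subtype
    exact Finite.of_injective (β := {g : G | ℓ g ≤ 2 * ℓ s}) (fun x => ⟨x.1.1, x.2⟩)
      (fun x y hxy => Subtype.ext (Subtype.ext (by simpa using hxy)))
  have hfin : Finite (Z ⧸ Subgroup.zpowers s') := by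
    refine Finite.of_surjective (fun x : {x : Z // ℓ x ≤ 2 * ℓ s} => (x.1 : Z ⧸ Subgroup.zpowers s'))
      fun y => ?_
    obtain ⟨y, rfl⟩ := QuotientGroup.mk_surjective y
    have hy := hcom y y.2
    obtain ⟨k, k1, k2⟩ := S.dense H D (b y)
    have c1 : (y : G) * s ^ (-k) = s ^ (-k) * y := (Commute.zpow_right hy (-k)).eq
    have e1 := D.shift (s ^ k) (y * s ^ (-k))
      (Commute.zpow_left (Commute.refl s) k).eq
    have e2 : s ^ k * ((y : G) * s ^ (-k)) = y := by rw [c1, ← mul_assoc, ← zpow_add]; simp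
    have e3 := D.hshift (y * s ^ (-k)) 1
      ((show Commute (y : G) s from hy).mul_left (Commute.zpow_left (Commute.refl s) _)).eq
    have e4 := D.hf 0
    have e5 := D.upper (y * s ^ (-k)) 1
    rw [e2] at e1
    rw [mul_one] at e3
    rw [zpow_zero] at e4
    rw [H.ds_comm, ds_one_left] at e5
    have e6 := D.b1
    refine ⟨⟨y * s' ^ (-k), ?_⟩, ?_⟩
    · simp only [hs', Subgroup.coe_mul, Subgroup.coe_zpow]
      omega
    · rw [QuotientGroup.eq]
      exact ⟨k, by simp⟩
  have fi : (Subgroup.zpowers s').FiniteIndex := Subgroup.finiteIndex_of_finite_quotient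
  have fc : (Subgroup.center Z).FiniteIndex := Subgroup.finiteIndex_of_le hcen
  have inj : ∀ x : Z, ∀ m : ℕ, m ≠ 0 → x ^ m = 1 → x = 1 := by
    intro x m hm hx
    exact Subtype.ext (tf x m hm (by simpa using congrArg Subtype.val hx))
  have comm : ∀ x y : Z, x * y = y * x := by
    have i1 : Function.Injective (MonoidHom.transferCenterPow Z) := by
      rw [injective_iff_map_eq_one]
      intro x hx
      refine inj x (Subgroup.center Z).index fc.index_ne_zero ?_
      rw [← MonoidHom.transferCenterPow_apply, hx]; rfl
    intro x y
    apply i1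
    rw [map_mul, map_mul]
    refine Subtype.ext ?_
    exact Subgroup.mem_center_iff.1 (MonoidHom.transferCenterPow Z y).2 _
  let _ : CommGroup Z := { (inferInstance : Group Z) with mul_comm := comm }
  have cyc : IsCyclic Z := by
    refine isCyclic_of_injective (G := Z) (G' := Subgroup.zpowers s')
      ((powMonoidHom (Subgroup.zpowers s').index).codRestrict (Subgroup.zpowers s')
        fun x => Subgroup.pow_index_mem _ x) ?_
    rw [injective_iff_map_eq_one]
    intro x hx
    exact inj x _ fi.index_ne_zero (congrArg Subtype.val hx)
  obtain ⟨z, hz⟩ := cyc.exists_generator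
  refine ⟨z, fun x hx => ?_⟩
  obtain ⟨k, hk⟩ := hz ⟨x, by
    rw [hZ, Subgroup.mem_centralizer_iff]; rintro _ rfl; exact hx.symm⟩
  exact ⟨k, by simpa using congrArg Subtype.val hk⟩

end Lox

theorem Subgroup.eq_zpowers_of_le {K : Subgroup G} {z : G} (h : K ≤ Subgroup.zpowers z) :
    ∃ w, K = Subgroup.zpowers w := by
  have : IsCyclic K := isCyclic_of_injective (Subgroup.inclusion h) (Subgroup.inclusion_injective h)
  obtain ⟨w, hw⟩ := this.exists_generator
  refine ⟨w, le_antisymm (fun x hx => ?_) (by simp)⟩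
  obtain ⟨k, hk⟩ := hw ⟨x, hx⟩
  exact ⟨k, by simpa using congrArg Subtype.val hk⟩

theorem HypLen.exists_lox (H : HypLen ℓ δ) (tf : TorFree G) {g : G} (hg : g ≠ 1) :
    ∃ j : ℕ, j ≠ 0 ∧ ∃ m, Lox ℓ δ (m⁻¹ * g ^ j * m) := by
  obtain ⟨j, hj, m, h1, h2⟩ := H.lox (tf.pow_injective hg) (100 * δ)
  exact ⟨j, hj, m, h1, h2⟩

/-- Centralisers in torsion-free hyperbolic groups are cyclic. -/
theorem HypLen.centralizer (H : HypLen ℓ δ) (tf : TorFree G) {g : G} (hg : g ≠ 1) :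
    ∃ z, ∀ x, x * g = g * x ↔ x ∈ Subgroup.zpowers z := by
  obtain ⟨j, hj, m, S⟩ := H.exists_lox tf hg
  obtain ⟨z, hz⟩ := S.centralizer H tf
  have : Subgroup.centralizer ({g} : Set G) ≤ Subgroup.zpowers (m * z * m⁻¹) := by
    intro x hx
    have hx : Commute x g := (Subgroup.mem_centralizer_iff.1 hx g rfl).symm
    have h1 : (m⁻¹ * x * m) * (m⁻¹ * g ^ j * m) = (m⁻¹ * g ^ j * m) * (m⁻¹ * x * m) := by
      have := (hx.pow_right j).eq
      calc _ = m⁻¹ * (x * g ^ j) * m := by group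
        _ = m⁻¹ * (g ^ j * x) * m := by rw [this]
        _ = _ := by group
    obtain ⟨k, hk⟩ := hz _ h1
    refine ⟨k, ?_⟩
    beta_reduce at hk ⊢
    rw [conj_zpow, hk]; group
  obtain ⟨w, hw⟩ := Subgroup.eq_zpowers_of_le this
  refine ⟨w, fun x => ?_⟩
  rw [← hw, Subgroup.mem_centralizer_iff]
  constructor
  · rintro h _ rfl; exact h.symm
  · intro h; exact (h g rfl).symm

theorem HypLen.commute_trans (H : HypLen ℓ δ) (tf : TorFree G) {g x y : G} (hg : g ≠ 1)
    (hx : x * g = g * x) (hy : y * g = g * y) : x * y = y * x := by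
  obtain ⟨z, hz⟩ := H.centralizer tf hg
  obtain ⟨i, rfl⟩ := (hz x).1 hx
  obtain ⟨j, rfl⟩ := (hz y).1 hy
  exact ((Commute.refl z).zpow_zpow i j).eq

theorem Lox.commute_of_bs (S : Lox ℓ δ s) (H : HypLen ℓ δ) (tf : TorFree G) {g : G} {a c : ℤ}
    (ha : a ≠ 0) (e : g * s ^ a * g⁻¹ = s ^ c) : g * s = s * g := by
  by_cases hg : g = 1
  · simp [hg]
  have h0 := S.bs H e
  have h1 : (g * g) * s ^ a = s ^ a * (g * g) := by
    rcases Int.natAbs_eq_natAbs_iff.1 h0 with rfl | h0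
    · have : g * s ^ a = s ^ a * g := mul_inv_eq_iff_eq_mul.1 e
      exact ((show Commute g (s ^ a) from this).mul_left this).eq
    · have e2 : g * s ^ c * g⁻¹ = s ^ a := by
        have : g * s ^ (-a) * g⁻¹ = s ^ (-c) := by
          rw [zpow_neg, zpow_neg, ← e]; group
        rwa [h0, neg_neg, ← h0] at this
      have : (g * g) * s ^ a * (g * g)⁻¹ = s ^ a := by
        calc _ = g * (g * s ^ a * g⁻¹) * g⁻¹ := by group
          _ = _ := by rw [e, e2]
      exact mul_inv_eq_iff_eq_mul.1 this
  have h2 : (g * g) * s = s * (g * g) :=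
    H.commute_trans tf (S.zpow_ne_one H ha) h1 ((Commute.refl s).zpow_right a).eq
  have h3 : g * g ≠ 1 := fun h => hg (tf g 2 (by omega) (by rw [pow_two, h]))
  exact H.commute_trans tf h3 (by group) h2.symm

/-- Centralisers of loxodromic elements are malnormal. -/
theorem Lox.malnormal (S : Lox ℓ δ s) (H : HypLen ℓ δ) (tf : TorFree G) {γ v : G} (hγ : γ ≠ 1)
    (h1 : γ * s = s * γ) (h2 : (v⁻¹ * γ * v) * s = s * (v⁻¹ * γ * v)) : v * s = s * v := by
  obtain ⟨z, hz⟩ := H.centralizer tf (S.ne_one H)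
  obtain ⟨i, hi⟩ := (hz _).1 h1
  obtain ⟨j, hj⟩ := (hz _).1 h2
  obtain ⟨m, hm⟩ := (hz _).1 rfl
  beta_reduce at hi hj hm
  have hi0 : i ≠ 0 := by rintro rfl; exact hγ (by rw [← hi, zpow_zero])
  have e1 : γ ^ m = s ^ i := by rw [← hi, ← hm, ← zpow_mul, ← zpow_mul, mul_comm]
  have e2 : (v⁻¹ * γ * v) ^ m = s ^ j := by rw [← hj, ← hm, ← zpow_mul, ← zpow_mul, mul_comm]
  have e3 : v⁻¹ * s ^ i * v⁻¹⁻¹ = s ^ j := by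
    rw [← e1, ← e2]
    conv_rhs => rw [show v⁻¹ * γ * v = v⁻¹ * γ * v⁻¹⁻¹ by rw [inv_inv]]
    rw [conj_zpow]
  have := S.commute_of_bs H tf hi0 e3
  have : Commute v⁻¹ s := this
  simpa using (this.inv_left).eq

end

section

variable {G : Type*} [Group G] {ℓ : G → ℤ} {δ κ : ℤ} {s : G} {f : ℤ → G} {b h : G → ℤ}

theorem exists_int_ivt_aux {c : ℤ → ℤ} {M t : ℤ} (hc : ∀ k, c (k + 1) - c k ≤ M) (j : ℤ) (n : ℕ)
    (h1 : c j ≤ t) (h2 : t < c (j + n)) :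
    ∃ k, j ≤ k ∧ k ≤ j + n ∧ t - M < c k ∧ c k ≤ t := by
  induction n with
  | zero => simp at h2; omega
  | succ n ih =>
    by_cases h : t < c (j + n)
    · obtain ⟨k, k1, k2, k3⟩ := ih h
      exact ⟨k, k1, by push_cast; omega, k3⟩
    · refine ⟨j + n, by omega, by push_cast; omega, ?_, by omega⟩
      have := hc (j + n)
      rw [add_assoc] at this
      push_cast at h2
      omega

/-- A discrete intermediate value theorem. -/
theorem exists_int_ivt {c : ℤ → ℤ} {M t : ℤ} (hc : ∀ k, Near (c (k + 1)) (c k) M) (i j : ℤ)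
    (h1 : c j ≤ t) (h2 : t < c i) :
    ∃ k, (j ≤ k ∧ k ≤ i ∨ i ≤ k ∧ k ≤ j) ∧ t - M < c k ∧ c k ≤ t := by
  rcases le_total j i with hij | hij
  · obtain ⟨k, k1, k2, k3⟩ := exists_int_ivt_aux (fun k => (hc k).1) j (i - j).toNat h1
      (by rwa [Int.toNat_of_nonneg (by omega), add_sub_cancel])
    exact ⟨k, Or.inl ⟨k1, by omega⟩, k3⟩
  · obtain ⟨k, k1, k2, k3⟩ := exists_int_ivt_aux (c := fun k => c (-k)) (M := M) (t := t)
      (fun k => by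
        have := (hc (-(k + 1))).2
        rwa [show -(k + 1) + 1 = -k by ring] at this) (-j) (j - i).toNat (by rwa [neg_neg])
      (by rw [Int.toNat_of_nonneg (by omega), show -(-j + (j - i)) = i by ring]; exact h2)
    exact ⟨-k, Or.inr ⟨by omega, by omega⟩, k3⟩

/-- Distinct translates of the axis of a loxodromic element have bounded projection. -/
theorem Lox.overlap (S : Lox ℓ δ s) (H : HypLen ℓ δ) (tf : TorFree G)
    (D : LineData ℓ δ (7 * δ) s (fun i => s ^ i) b h) :
    ∃ K, 0 ≤ K ∧ ∀ g, g * s ≠ s * g → ∀ i j : ℤ, b (g * s ^ i) - b (g * s ^ j) ≤ K := by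
  have hd := H.dpos
  have hS := S.big
  obtain ⟨M, hM⟩ : ∃ M, M = ℓ s := ⟨_, rfl⟩
  have fin := H.fin (19 * δ + 2 * M)
  obtain ⟨N, hN⟩ : ∃ N, N = fin.toFinset.card := ⟨_, rfl⟩
  refine ⟨4 * M * (N + 2) + 10 * δ, by
    have : 0 ≤ M := by omega
    positivity, ?_⟩
  intro g hg i j
  by_contra! hc
  have hstep : ∀ k : ℤ, Near (b (g * s ^ (k + 1))) (b (g * s ^ k)) (2 * M) := by
    intro k
    have e1 := D.b_lip (g * s ^ (k + 1)) (g * s ^ k)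
    have e2 := D.b_lip (g * s ^ k) (g * s ^ (k + 1))
    rw [H.ds_comm, ds_mul_left, Lox.step] at e1
    rw [ds_mul_left, Lox.step] at e2
    omega
  have pt : ∀ t : ℕ, t < N + 1 → ∃ k m : ℤ, (4 * M * (t + 1) + 3 * δ < b (g * s ^ k) - b (g * s ^ j) + 2 * M ∧
      b (g * s ^ k) - b (g * s ^ j) ≤ 4 * M * (t + 1) + 3 * δ) ∧ ℓ ((s ^ m)⁻¹ * (g * s ^ k)) ≤ 19 * δ + 2 * M := by
    intro t ht
    have ht' : 4 * M * ((t : ℤ) + 1) ≤ 4 * M * (N + 2) := by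
      have : ((t : ℤ) + 1) ≤ N + 2 := by omega
      nlinarith
    have ht2 : 4 * M ≤ 4 * M * ((t : ℤ) + 1) := by nlinarith
    obtain ⟨k, kk, k1, k2⟩ := exists_int_ivt (c := fun k => b (g * s ^ k)) hstep (t := b (g * s ^ j) + 4 * M * (t + 1) + 3 * δ) i j
      (by omega) (by omega)
    obtain ⟨m, m1, m2⟩ := S.dense H D (b (g * s ^ k))
    refine ⟨k, m, ⟨by omega, by omega⟩, ?_⟩
    have e1 := D.lower (g * s ^ k) (g * s ^ j) (by omega)
    have e2 := D.lower (g * s ^ i) (g * s ^ k) (by omega)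
    have e3 := D.upper (g * s ^ i) (g * s ^ j)
    have e4 := D.upper (s ^ m) (g * s ^ k)
    have e5 := D.hf m
    beta_reduce at e5
    rw [ds_mul_left] at e1 e2 e3
    have e6 := H.ds_comm (s ^ i) (s ^ j)
    have e7 := H.ds_comm (s ^ i) (s ^ k)
    have e8 := H.ds_comm (s ^ k) (s ^ j)
    have e9 : ds ℓ (s ^ i) (s ^ k) + ds ℓ (s ^ k) (s ^ j) ≤ ds ℓ (s ^ i) (s ^ j) + 7 * δ := by
      rcases kk with ⟨a1, a2⟩ | ⟨a1, a2⟩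
      · have := S.chain H a1 a2
        have s1 := H.ds_comm (s ^ k) (s ^ i)
        omega
      · exact S.chain H a1 a2
    have n1 := D.hnn (g * s ^ i)
    have n2 := D.hnn (g * s ^ j)
    have n3 := D.hnn (g * s ^ k)
    change ds ℓ (s ^ m) (g * s ^ k) ≤ _
    have e11 : h (g * s ^ k) ≤ 10 * δ := by
      clear e4 e5 m1 m2
      omega
    clear e1 e2 e3 e6 e7 e8 e9
    omega
  choose k m hkm hb using pt
  have hcard : fin.toFinset.card < (Finset.univ : Finset (Fin (N + 1))).card := by
    rw [Finset.card_fin]; omega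
  obtain ⟨t, -, t', -, htt, hw⟩ := Finset.exists_ne_map_eq_of_card_lt_of_maps_to hcard
    (f := fun t => (s ^ m t t.2)⁻¹ * (g * s ^ k t t.2)) (fun t _ => by simpa using hb t t.2)
  have hne : k t t.2 - k t' t'.2 ≠ 0 := by
    intro h0
    have e1 := hkm t t.2
    have e2 := hkm t' t'.2
    rw [show k t t.2 = k t' t'.2 by omega] at e1
    have hM0 : 0 < M := by omega
    rcases lt_or_gt_of_ne (fun h => htt (Fin.ext h)) with h1 | h1
    · have : ((t : ℕ) : ℤ) + 1 ≤ t' := by omega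
      nlinarith
    · have : ((t' : ℕ) : ℤ) + 1 ≤ t := by omega
      nlinarith
  refine hg (S.commute_of_bs H tf hne (c := m t t.2 - m t' t'.2) ?_)
  rw [inv_mul_eq_iff_eq_mul] at hw
  calc _ = (g * s ^ k t t.2) * (s ^ k t' t'.2)⁻¹ * g⁻¹ := by rw [zpow_sub]; group
    _ = _ := by rw [hw, zpow_sub]; group

/-- Points of a translate project near its base point. -/
theorem LineData.near (D : LineData ℓ δ κ s f b h) (H : HypLen ℓ δ) {M σ : ℤ} (f0 : f 0 = 1)
    (hM : ∀ t, ∃ k, b (f k) ≤ t ∧ t < b (f k) + 2 * M) {g : G}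
    (ov : ∀ i j, b (g * f i) - b (g * f j) ≤ σ) (p : G) :
    Near (b p) (b g) (h (g⁻¹ * p) + (σ + κ + 2 * M + 2 * δ)) := by
  have hd := H.dpos
  obtain ⟨k, k1, k2⟩ := hM (b (g⁻¹ * p))
  have e1 := ov k 0
  have e2 := ov 0 k
  rw [f0, mul_one] at e1 e2
  have e3 := D.upper (g⁻¹ * p) (f k)
  rw [← ds_mul_left ℓ g, mul_inv_cancel_left] at e3
  have e4 := D.hf k
  have e5 := D.b_lip p (g * f k)
  have e6 := D.b_lip (g * f k) p
  rw [H.ds_comm] at e6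
  omega

/-- A point projects away from the base point on at most one of two lines. -/
theorem LineData.behr (D : LineData ℓ δ κ s f b h) (H : HypLen ℓ δ) {M σ : ℤ} (f0 : f 0 = 1)
    (hM : ∀ t, ∃ k, b (f k) ≤ t ∧ t < b (f k) + 2 * M) {g : G}
    (ov : ∀ i j, b (g * f i) - b (g * f j) ≤ σ)
    (ov' : ∀ i j, b (g⁻¹ * f i) - b (g⁻¹ * f j) ≤ σ) {τ : ℤ}
    (hτ : σ + κ + 2 * M + 4 * δ ≤ τ) (x : G)
    (hx : ¬ Near (b x) (b g) τ) : Near (b (g⁻¹ * x)) (b g⁻¹) τ := by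
  have hd := H.dpos
  by_contra hx'
  obtain ⟨k, k1, k2⟩ := hM (b x)
  obtain ⟨m, m1, m2⟩ := hM (b (g⁻¹ * x))
  have a1 := ov m 0
  have a2 := ov 0 m
  have a3 := ov' k 0
  have a4 := ov' 0 k
  rw [f0, mul_one] at a1 a2 a3 a4
  have e1 := D.lower (g⁻¹ * x) (g⁻¹ * f k)
  have e2 := D.lower (g⁻¹ * f k) (g⁻¹ * x)
  have e3 := D.lower x (g * f m)
  have e4 := D.lower (g * f m) x
  have u1 := D.upper x (f k)
  have u2 := D.upper (g⁻¹ * x) (f m)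
  rw [← ds_mul_left ℓ g, mul_inv_cancel_left] at u2
  rw [ds_mul_left] at e1 e2
  have s1 := H.ds_comm x (f k)
  have s2 := H.ds_comm x (g * f m)
  have n1 := D.hf k
  have n2 := D.hf m
  have n3 := D.hnn (g⁻¹ * f k)
  have n4 := D.hnn (g * f m)
  have n5 : 0 ≤ σ := by have := ov 0 0; omega
  have n6 := D.hnn (f k)
  have c1 : h (g⁻¹ * x) + (τ - σ) < h x + κ + 2 * M + 4 * δ := by
    clear e3 e4 u2 a1 a2
    omega
  have c2 : h x + (τ - σ) < h (g⁻¹ * x) + κ + 2 * M + 4 * δ := by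
    clear e1 e2 u1 a3 a4
    omega
  omega

end

section

variable {G : Type*} [Group G] {ℓ : G → ℤ} {δ σ D : ℤ} {s r : G} {b h : G → ℤ}
  {W V f : ℤ → G}

/-- The geometry of the translates of the axis of `s`. -/
structure UData (ℓ : G → ℤ) (δ : ℤ) (s : G) (b h : G → ℤ) (σ : ℤ) : Prop where
  sig : 100 * δ ≤ σ
  b1 : b 1 = 0
  h1 : h 1 ≤ σ
  b_lip : ∀ x y, b x - b y ≤ 2 * ds ℓ x y
  h_lip : ∀ x y, h x - h y ≤ 2 * ds ℓ x y
  upper : ∀ x y, 2 * ds ℓ x y ≤ h x + h y + (b x - b y) + σ ∨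
    2 * ds ℓ x y ≤ h x + h y + (b y - b x) + σ
  lower : ∀ x y, b x - b y > σ → h x + h y + (b x - b y) ≤ 2 * ds ℓ x y + σ
  shift : ∀ ε x, Commute ε s → Near (b (ε * x)) (b x + b ε) σ
  hshift : ∀ ε x, Commute ε s → Near (h (ε * x)) (h x) σ
  behr : ∀ g x, ¬ Commute g s → ¬ Near (b x) (b g) σ → Near (b (g⁻¹ * x)) (b g⁻¹) σ
  near : ∀ g p, ¬ Commute g s → Near (b p) (b g) (h (g⁻¹ * p) + σ)

/-- A chain of translates of the axis of `s`, invariant under `r`. -/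
structure RelChain (ℓ : G → ℤ) (s : G) (b : G → ℤ) (σ D : ℤ) (r : G) (W V f : ℤ → G) : Prop where
  W_comm : ∀ k, Commute (W k) s
  V_comm : ∀ k, ¬ Commute (V k) s
  V_len : ∀ k, 2 * ℓ (V k) ≤ σ
  f0 : f 0 = 1
  fs : ∀ k, f (k + 1) = f k * (W k * V k)
  lo : ∀ k, 1000 * σ ≤ b (W k)
  hi : ∀ k, b (W k) ≤ D
  D3 : ∀ k, D ≤ 3 * b (W k)
  rig : ∀ m k, Near (b (W m)) (b (W k)) (50 * σ) → W m = W k ∧ V m = V k ∧ ∃ t : ℤ, f k = r ^ t * f m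

namespace RelChain

theorem sig_pos (U : UData ℓ δ s b h σ) (H : HypLen ℓ δ) : 100 ≤ σ := by
  have := U.sig
  have := H.dpos
  omega

theorem b_V (C : RelChain ℓ s b σ D r W V f) (U : UData ℓ δ s b h σ) (H : HypLen ℓ δ) (k : ℤ) :
    Near (b (V k)) 0 σ ∧ Near (b (V k)⁻¹) 0 σ ∧ h (V k) ≤ 2 * σ := by
  have e1 := U.b_lip (V k) 1
  have e2 := U.b_lip 1 (V k)
  have e3 := U.b_lip (V k)⁻¹ 1
  have e4 := U.b_lip 1 (V k)⁻¹
  have e5 := U.h_lip (V k) 1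
  rw [H.ds_comm, ds_one_left] at e1 e3 e5
  rw [ds_one_left] at e2 e4
  rw [H.inv] at e3 e4
  rw [U.b1] at e1 e2 e3 e4
  have := C.V_len k
  have := U.h1
  omega

theorem trans (C : RelChain ℓ s b σ D r W V f) (U : UData ℓ δ s b h σ) (H : HypLen ℓ δ)
    (k : ℤ) (x : G) : Near (b ((f (k + 1))⁻¹ * x)) 0 (2 * σ) ∨
      Near (b ((f k)⁻¹ * x)) (b (W k)) (3 * σ) := by
  obtain ⟨y, hy⟩ : ∃ y, y = (f (k + 1))⁻¹ * x := ⟨_, rfl⟩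
  have hx : (f k)⁻¹ * x = W k * (V k * y) := by rw [hy, C.fs]; group
  rw [hx, ← hy]
  obtain ⟨e1, e2, e3⟩ := C.b_V U H k
  have e4 := U.shift _ (V k * y) (C.W_comm k)
  have e5 := U.behr (V k)⁻¹ y (fun hc => C.V_comm k (by simpa using hc.inv_left))
  rw [inv_inv] at e5
  omega

theorem behind (C : RelChain ℓ s b σ D r W V f) (U : UData ℓ δ s b h σ) (H : HypLen ℓ δ)
    {k : ℤ} {x : G} (hx : 2 * b ((f k)⁻¹ * x) ≤ b (W k)) (n : ℕ) :
    Near (b ((f (k + (n + 1)))⁻¹ * x)) 0 (2 * σ) := by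
  have h0 := sig_pos U H
  induction n with
  | zero =>
    have := C.trans U H k x
    have := C.lo k
    simp only [Nat.cast_zero, zero_add]
    omega
  | succ n ih =>
    have e1 := C.trans U H (k + (n + 1)) x
    have e2 := C.lo (k + (n + 1))
    rw [add_assoc] at e1
    push_cast
    omega

theorem ahead (C : RelChain ℓ s b σ D r W V f) (U : UData ℓ δ s b h σ) (H : HypLen ℓ δ)
    {k : ℤ} {x : G} (hx : 2 * σ < b ((f k)⁻¹ * x)) (n : ℕ) :
    Near (b ((f (k - (n + 1)))⁻¹ * x)) (b (W (k - (n + 1)))) (3 * σ) := by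
  have h0 := sig_pos U H
  induction n with
  | zero =>
    have e1 := C.trans U H (k - 1) x
    rw [sub_add_cancel] at e1
    simp only [Nat.cast_zero, zero_add]
    omega
  | succ n ih =>
    have e1 := C.trans U H (k - (n + 1 + 1)) x
    have e2 := C.lo (k - (n + 1))
    rw [show k - ((n : ℤ) + 1 + 1) + 1 = k - (n + 1) by ring] at e1
    push_cast
    omega

theorem step (C : RelChain ℓ s b σ D r W V f) (U : UData ℓ δ s b h σ) (H : HypLen ℓ δ) (k : ℤ) :
    Near (b ((f k)⁻¹ * f (k + 1))) (b (W k)) (2 * σ) ∧ h ((f k)⁻¹ * f (k + 1)) ≤ 3 * σ := by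
  rw [C.fs, inv_mul_cancel_left]
  obtain ⟨e1, e2, e3⟩ := C.b_V U H k
  have e4 := U.shift _ (V k) (C.W_comm k)
  have e5 := U.hshift _ (V k) (C.W_comm k)
  omega

theorem pos_le (C : RelChain ℓ s b σ D r W V f) (U : UData ℓ δ s b h σ) (H : HypLen ℓ δ)
    {j k : ℤ} (hjk : j ≤ k) : Near (b ((f k)⁻¹ * f j)) 0 (2 * σ) := by
  have h0 := sig_pos U H
  have h1 : b ((f j)⁻¹ * f j) = 0 := by rw [inv_mul_cancel, U.b1]
  rcases hjk.eq_or_lt with rfl | hjk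
  · omega
  · have h2 := C.lo j
    have := C.behind U H (k := j) (x := f j) (by omega) (k - j - 1).toNat
    rwa [Int.toNat_of_nonneg (by omega), show j + (k - j - 1 + 1) = k by ring] at this

theorem pos_lt (C : RelChain ℓ s b σ D r W V f) (U : UData ℓ δ s b h σ) (H : HypLen ℓ δ)
    {j k : ℤ} (hjk : k < j) : Near (b ((f k)⁻¹ * f j)) (b (W k)) (3 * σ) := by
  have h0 := sig_pos U H
  obtain ⟨i, rfl⟩ : ∃ i, j = i + 1 := ⟨j - 1, by ring⟩
  have e1 := (C.step U H i).1
  rcases (show k ≤ i by omega).eq_or_lt with rfl | hk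
  · omega
  · have h2 := C.lo i
    have := C.ahead U H (k := i) (x := f (i + 1)) (by omega) (i - k - 1).toNat
    rwa [Int.toNat_of_nonneg (by omega), show i - (i - k - 1 + 1) = k by ring] at this

/-- The distance between consecutive vertices. -/
theorem step_ds (C : RelChain ℓ s b σ D r W V f) (U : UData ℓ δ s b h σ) (H : HypLen ℓ δ) (k : ℤ) :
    Near (2 * ds ℓ (f k) (f (k + 1))) (b (W k)) (7 * σ) := by
  have h0 := sig_pos U H
  obtain ⟨e1, e2⟩ := C.step U H k
  have e3 := U.upper ((f k)⁻¹ * f k) ((f k)⁻¹ * f (k + 1))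
  have e4 := U.b_lip ((f k)⁻¹ * f (k + 1)) ((f k)⁻¹ * f k)
  rw [ds_mul_left, H.ds_comm] at e4
  rw [ds_mul_left] at e3
  rw [inv_mul_cancel, U.b1] at e3 e4
  have e5 := U.h1
  have e6 := C.lo k
  omega

/-- A point behind line `k` and a point ahead of it are separated by the segment of line `k`. -/
theorem sep (U : UData ℓ δ s b h σ) (H : HypLen ℓ δ) {y X X' Z Z' : G}
    (h1 : Near (b (y⁻¹ * X)) (b (y⁻¹ * Z)) (10 * σ)) (h2 : Near (b (y⁻¹ * X')) (b (y⁻¹ * Z')) (10 * σ))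
    (hZ : h (y⁻¹ * Z) ≤ 3 * σ) (hZ' : h (y⁻¹ * Z') ≤ 3 * σ)
    (hb : b (y⁻¹ * Z) + 100 * σ < b (y⁻¹ * Z')) :
    2 * ds ℓ X Z + 2 * ds ℓ Z Z' + 2 * ds ℓ Z' X' ≤ 2 * ds ℓ X X' + 56 * σ := by
  have h0 := sig_pos U H
  have e1 := U.upper (y⁻¹ * X) (y⁻¹ * Z)
  have e2 := U.upper (y⁻¹ * Z) (y⁻¹ * Z')
  have e3 := U.upper (y⁻¹ * Z') (y⁻¹ * X')
  have e4 := U.lower (y⁻¹ * X') (y⁻¹ * X) (by omega)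
  rw [ds_mul_left] at e1 e2 e3 e4
  rw [H.ds_comm X' X] at e4
  omega

theorem chain_hyp (C : RelChain ℓ s b σ D r W V f) (U : UData ℓ δ s b h σ) (H : HypLen ℓ δ)
    (i : ℤ) : ds ℓ (f i) (f (i + 1)) + ds ℓ (f (i + 1)) (f (i + 2)) ≤
      ds ℓ (f i) (f (i + 2)) + 28 * σ := by
  have h0 := sig_pos U H
  obtain ⟨e1, e2⟩ := C.step U H i
  have e3 := C.pos_lt U H (show i < i + 2 by omega)
  have e4 := C.lo i
  have e5 := U.h1
  have e6 := U.b1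
  have := sep U H (y := f i) (X := f i) (X' := f (i + 2)) (Z := f i) (Z' := f (i + 1))
    (by omega) (by omega) (by rw [inv_mul_cancel]; omega) e2 (by rw [inv_mul_cancel]; omega)
  rw [H.ds_self] at this
  omega

theorem step_lo (C : RelChain ℓ s b σ D r W V f) (U : UData ℓ δ s b h σ) (H : HypLen ℓ δ) (i : ℤ) :
    400 * σ ≤ ds ℓ (f i) (f (i + 1)) := by
  have h0 := sig_pos U H
  have := C.lo i
  have := C.step_ds U H i
  omega

theorem chain (C : RelChain ℓ s b σ D r W V f) (U : UData ℓ δ s b h σ) (H : HypLen ℓ δ)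
    {i j k : ℤ} (hij : i ≤ j) (hjk : j ≤ k) :
    ds ℓ (f i) (f j) + ds ℓ (f j) (f k) ≤ ds ℓ (f i) (f k) + 30 * σ := by
  have h0 := sig_pos U H
  have h1 := U.sig
  have := H.chain (κ := 28 * σ) (by omega) (by omega) (C.step_lo U H) (C.chain_hyp U H) hij hjk
  omega

theorem growth (C : RelChain ℓ s b σ D r W V f) (U : UData ℓ δ s b h σ) (H : HypLen ℓ δ)
    (i : ℤ) (n : ℕ) : (n : ℤ) ≤ ds ℓ (f i) (f (i + n)) := by
  have h0 := sig_pos U H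
  have h1 := U.sig
  exact H.chain_growth (κ := 28 * σ) (by omega) (by omega) (C.step_lo U H) (C.chain_hyp U H) i n

end RelChain

end

section

variable {G : Type*} [Group G] {ℓ : G → ℤ} {δ σ D : ℤ} {s r : G} {b h br hr : G → ℤ}
  {W V f : ℤ → G}

namespace RelChain

/-- A line which is not part of the chain sees a segment of the chain as a bounded set. -/
theorem cross (C : RelChain ℓ s b σ D r W V f) (U : UData ℓ δ s b h σ) (H : HypLen ℓ δ)
    {i j : ℤ} (hij : i ≤ j) {z : G}
    (hz : ∀ m, i ≤ m → m < j → ¬ Commute ((f m)⁻¹ * z) s) :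
    Near (b (z⁻¹ * f i)) (b (z⁻¹ * f j)) (6 * σ) := by
  have h0 := sig_pos U H
  have hb : ∀ m, i ≤ m → m < j → ∀ x, Near (b (z⁻¹ * x)) (b (z⁻¹ * f m)) σ ∨
      Near (b ((f m)⁻¹ * x)) (b ((f m)⁻¹ * z)) σ := by
    intro m h1 h2 x
    by_contra! hc
    have := U.behr (z⁻¹ * f m) (z⁻¹ * x) (fun e => hz m h1 h2 (by simpa using e.inv_left)) hc.1
    rw [show (z⁻¹ * f m)⁻¹ * (z⁻¹ * x) = (f m)⁻¹ * x by group,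
      show (z⁻¹ * f m)⁻¹ = (f m)⁻¹ * z by group] at this
    exact hc.2 this
  have hA : ∀ m, i ≤ m → m < j → b (W m) < 2 * b ((f m)⁻¹ * z) →
      Near (b (z⁻¹ * f i)) (b (z⁻¹ * f m)) σ := by
    intro m h1 h2 h3
    have e1 := hb m h1 h2 (f i)
    have e2 := C.pos_le U H h1
    have e3 := C.lo m
    omega
  have hB : ∀ m, i ≤ m → m < j → 2 * b ((f m)⁻¹ * z) ≤ b (W m) →
      Near (b (z⁻¹ * f j)) (b (z⁻¹ * f m)) σ := by
    intro m h1 h2 h3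
    have e1 := hb m h1 h2 (f j)
    have e2 := C.pos_lt U H h2
    have e3 := C.lo m
    omega
  have hS : ∀ m, i ≤ m → m < j → Near (b (z⁻¹ * f (m + 1))) (b (z⁻¹ * f m)) (4 * σ) := by
    intro m h1 h2
    have := U.near (z⁻¹ * f m) (z⁻¹ * f (m + 1))
      (fun e => hz m h1 h2 (by simpa using e.inv_left))
    rw [show (z⁻¹ * f m)⁻¹ * (z⁻¹ * f (m + 1)) = (f m)⁻¹ * f (m + 1) by group] at this
    have := (C.step U H m).2
    omega
  have key : ∀ n : ℕ, i + n ≤ j → Near (b (z⁻¹ * f i)) (b (z⁻¹ * f (i + n))) (5 * σ) ∨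
      Near (b (z⁻¹ * f i)) (b (z⁻¹ * f j)) (6 * σ) := by
    intro n
    induction n with
    | zero => intro _; left; simp only [Nat.cast_zero, add_zero]; omega
    | succ n ih =>
      intro hn
      push_cast at hn ⊢
      rcases ih (by omega) with e | e
      · have e1 := hA (i + n) (by omega) (by omega)
        have e2 := hB (i + n) (by omega) (by omega)
        have e3 := hS (i + n) (by omega) (by omega)
        rw [add_assoc] at e3
        omega
      · exact Or.inr e
  have := key (j - i).toNat (by omega)
  rw [Int.toNat_of_nonneg (by omega), add_sub_cancel] at this
  omega

theorem D_big (C : RelChain ℓ s b σ D r W V f) : 1000 * σ ≤ D := (C.lo 0).trans (C.hi 0)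

theorem dense (C : RelChain ℓ s b σ D r W V f) (U : UData ℓ δ s b h σ) (H : HypLen ℓ δ)
    (R : LineData ℓ δ (30 * σ) r f br hr) (t : ℤ) :
    ∃ k, br (f k) ≤ t ∧ t < br (f k) + (D + 7 * σ) := by
  obtain ⟨k, h1, h2⟩ := R.dense (M := (D + 7 * σ) / 2) (fun i => by
    have := C.step_ds U H i
    have := C.hi i
    omega) (C.growth U H) H C.f0 t
  exact ⟨k, h1, by omega⟩

theorem below (C : RelChain ℓ s b σ D r W V f) (U : UData ℓ δ s b h σ) (H : HypLen ℓ δ)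
    (R : LineData ℓ δ (30 * σ) r f br hr) {k : ℤ} {X : G} (hX : br X + 2 * D < br (f k)) :
    2 * b ((f k)⁻¹ * X) ≤ b (W k) := by
  by_contra! hc
  have h0 := sig_pos U H
  have h1 := C.D_big
  have h2 := C.lo k
  have h3 := C.lo (k - 1)
  have hs := U.sig
  have hd := H.dpos
  have e1 := C.ahead U H (k := k) (x := X) (by omega) 0
  simp only [Nat.cast_zero, zero_add] at e1
  obtain ⟨p, p1, p2⟩ := C.dense U H R (br X)
  have hp : p ≤ k - 1 := by
    by_contra hp
    have := R.bf k p (by omega)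
    have := H.ds_nonneg (f k) (f p)
    omega
  have e2 := C.pos_le U H hp
  obtain ⟨e3, e4⟩ := C.step U H (k - 1)
  rw [sub_add_cancel] at e3 e4
  have e5 := U.h1
  have e6 := U.b1
  have e7 := sep U H (y := f (k - 1)) (X := f p) (X' := X) (Z := f (k - 1)) (Z' := f k)
    (by rw [inv_mul_cancel]; omega) (by omega) (by rw [inv_mul_cancel]; omega) e4
    (by rw [inv_mul_cancel]; omega)
  have e8 := R.upper (f p) X
  have e9 := R.lower (f k) X (by omega)
  have e10 := R.hf p
  have e11 := R.hnn (f k)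
  have e12 := H.ds_nonneg (f p) (f (k - 1))
  have e13 := H.ds_nonneg (f (k - 1)) (f k)
  omega

theorem above (C : RelChain ℓ s b σ D r W V f) (U : UData ℓ δ s b h σ) (H : HypLen ℓ δ)
    (R : LineData ℓ δ (30 * σ) r f br hr) {k : ℤ} {X : G} (hX : br (f (k + 1)) + 2 * D < br X) :
    Near (b ((f k)⁻¹ * X)) (b (W k)) (3 * σ) := by
  by_contra! hc
  have h0 := sig_pos U H
  have h1 := C.D_big
  have h3 := C.lo (k + 1)
  have hs := U.sig
  have hd := H.dpos
  have e1 := (C.trans U H k X).resolve_right hc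
  obtain ⟨p, p1, p2⟩ := C.dense U H R (br X)
  have hp : k + 1 < p := by
    by_contra hp
    have := R.bf p (k + 1) (by omega)
    have := H.ds_nonneg (f p) (f (k + 1))
    omega
  have e2 := C.pos_lt U H hp
  obtain ⟨e3, e4⟩ := C.step U H (k + 1)
  have e5 := U.h1
  have e6 := U.b1
  have e7 := sep U H (y := f (k + 1)) (X := X) (X' := f p) (Z := f (k + 1)) (Z' := f (k + 1 + 1))
    (by rw [inv_mul_cancel]; omega) (by omega) (by rw [inv_mul_cancel]; omega) e4
    (by rw [inv_mul_cancel]; omega)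
  have e8 := R.upper X (f p)
  have e9 := R.lower X (f (k + 1)) (by omega)
  have e10 := R.hf p
  have e11 := R.hnn (f (k + 1))
  have e12 := H.ds_nonneg (f (k + 1 + 1)) (f p)
  have e13 := H.ds_nonneg (f (k + 1)) (f (k + 1 + 1))
  omega

/-- If a translate of the chain crosses line `k`, then line `k` is one of its own lines. -/
theorem common (C : RelChain ℓ s b σ D r W V f) (U : UData ℓ δ s b h σ) (H : HypLen ℓ δ)
    {k i j : ℤ} {g : G} (h1 : Near (b ((f k)⁻¹ * (g * f j))) 0 (2 * σ))
    (h2 : Near (b ((f k)⁻¹ * (g * f i))) (b (W k)) (3 * σ)) :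
    ∃ m, Commute ((f m)⁻¹ * (g⁻¹ * f k)) s ∧ Near (b ((f m)⁻¹ * (g⁻¹ * f k))) 0 (6 * σ) ∧
      2 * ℓ ((f m)⁻¹ * (g⁻¹ * f k)) ≤ 10 * σ ∧ Near (b (W m)) (b (W k)) (12 * σ) := by
  have h0 := sig_pos U H
  have hk := C.lo k
  have ez : ∀ j, (g⁻¹ * f k)⁻¹ * f j = (f k)⁻¹ * (g * f j) := fun j => by group
  obtain ⟨m, hm, hc⟩ : ∃ m, (j ≤ m ∧ m < i ∨ i ≤ m ∧ m < j) ∧ Commute ((f m)⁻¹ * (g⁻¹ * f k)) s := by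
    by_contra! hc
    rcases le_total i j with hij | hij
    · have := C.cross U H hij (z := g⁻¹ * f k) (fun m m1 m2 => hc m (Or.inr ⟨m1, m2⟩))
      rw [ez, ez] at this
      omega
    · have := C.cross U H hij (z := g⁻¹ * f k) (fun m m1 m2 => hc m (Or.inl ⟨m1, m2⟩))
      rw [ez, ez] at this
      omega
  obtain ⟨ε, hε⟩ : ∃ ε, ε = (f m)⁻¹ * (g⁻¹ * f k) := ⟨_, rfl⟩
  rw [← hε] at hc
  have ex : ∀ j, (f k)⁻¹ * (g * f j) = ε⁻¹ * ((f m)⁻¹ * f j) := fun j => by rw [hε]; group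
  rw [ex] at h1 h2
  have e1 := U.shift ε⁻¹ ((f m)⁻¹ * f j) hc.inv_left
  have e2 := U.shift ε⁻¹ ((f m)⁻¹ * f i) hc.inv_left
  have e3 := U.shift ε ε⁻¹ hc
  have e4 := U.hshift ε 1 hc
  have e5 := U.upper 1 ε
  have e6 := U.h1
  have e7 := C.lo m
  rw [mul_inv_cancel, U.b1] at e3
  rw [mul_one] at e4
  rw [ds_one_left, U.b1] at e5
  rcases hm with ⟨m1, m2⟩ | ⟨m1, m2⟩
  · have p1 := C.pos_le U H m1
    have p2 := C.pos_lt U H m2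
    refine ⟨m, ?_⟩
    rw [← hε]
    refine ⟨hc, by omega, by omega, by omega⟩
  · have p1 := C.pos_le U H m1
    have p2 := C.pos_lt U H m2
    omega

theorem overlap (C : RelChain ℓ s b σ D r W V f) (U : UData ℓ δ s b h σ) (H : HypLen ℓ δ)
    (R : LineData ℓ δ (30 * σ) r f br hr)
    (hab : ∀ x y, Commute x s → Commute y s → Commute x y)
    (hmal : ∀ γ v, γ ≠ 1 → Commute γ s → Commute (v⁻¹ * γ * v) s → Commute v s)
    {g : G} (hg : g ∉ Subgroup.zpowers r) (i j : ℤ) : br (g * f i) - br (g * f j) ≤ 12 * D := by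
  by_contra! hc
  have h0 := sig_pos U H
  have hD := C.D_big
  have hs := U.sig
  have hd := H.dpos
  obtain ⟨p, p1, p2⟩ := C.dense U H R (br (g * f j) + 2 * D)
  have stp : ∀ q, D - 240 * σ ≤ 3 * (br (f (q + 1)) - br (f q)) ∧
      br (f (q + 1)) - br (f q) ≤ D + 7 * σ := by
    intro q
    have e1 := R.bf q (q + 1) (by omega)
    have e2 := R.b_lip (f (q + 1)) (f q)
    have e3 := C.step_ds U H q
    have e4 := C.D3 q
    have e5 := C.hi q
    rw [H.ds_comm] at e2
    omega
  have s0 := stp p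
  have s1 := stp (p + 1)
  have s2 := stp (p + 1 + 1)
  have s3 := stp (p + 1 + 1 + 1)
  have s4 := stp (p + 1 + 1 + 1 + 1)
  have s5 := stp (p + 1 + 1 + 1 + 1 + 1)
  have s6 := stp (p + 1 + 1 + 1 + 1 + 1 + 1)
  obtain ⟨q, hq⟩ : ∃ q, q = p + 1 + 1 + 1 + 1 := ⟨_, rfl⟩
  rw [← hq] at s3 s4 s5 s6
  have b1 := C.behind U H (C.below U H R (k := q) (X := g * f j) (by omega)) 0
  have b2 := C.behind U H (C.below U H R (k := q + 1) (X := g * f j) (by omega)) 0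
  have a1 := C.above U H R (k := q + 1) (X := g * f i) (by omega)
  have a2 := C.above U H R (k := q + 1 + 1) (X := g * f i) (by omega)
  simp only [Nat.cast_zero, zero_add] at b1 b2
  generalize q + 1 = k at *
  clear s0 s1 s2 s3 s4 s5 s6
  obtain ⟨m, c1, c2, c3, c4⟩ := C.common U H b1 a1
  obtain ⟨m', c1', c2', c3', c4'⟩ := C.common U H b2 a2
  obtain ⟨ε, hε⟩ : ∃ ε, ε = (f m)⁻¹ * (g⁻¹ * f k) := ⟨_, rfl⟩
  obtain ⟨ε', hε'⟩ : ∃ ε', ε' = (f m')⁻¹ * (g⁻¹ * f (k + 1)) := ⟨_, rfl⟩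
  rw [← hε] at c1 c2 c3
  rw [← hε'] at c1' c2' c3'
  obtain ⟨rW, rV, t, rt⟩ := C.rig m k (by omega)
  have hfm : (f m)⁻¹ * f m' = ε * W k * (V k * ε'⁻¹) := by
    rw [hε, hε', C.fs]; group
  have lk := C.lo k
  have x1 := U.shift ε (W k) c1
  have x2 := U.b_lip (ε * W k) (ε * W k * (V k * ε'⁻¹))
  have x3 : ds ℓ (ε * W k) (ε * W k * (V k * ε'⁻¹)) = ℓ (V k * ε'⁻¹) := by simp [ds, mul_assoc]
  have x4 := H.mul (V k) ε'⁻¹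
  have x5 := C.V_len k
  rw [H.inv] at x4
  rw [x3, ← hfm] at x2
  have hmm : m < m' := by
    by_contra hmm
    have := C.pos_le U H (show m' ≤ m by omega)
    omega
  have hm' : m' = m + 1 := by
    by_contra hne
    have y1 := C.chain U H (show m ≤ m + 1 by omega) (show m + 1 ≤ m' by omega)
    have y2 := C.chain U H (show m + 1 ≤ m + 1 + 1 by omega) (show m + 1 + 1 ≤ m' by omega)
    have y3 := C.step_lo U H (m + 1)
    have y4 := H.ds_nonneg (f (m + 1 + 1)) (f m')
    have y5 := C.step_ds U H m
    have y6 : ds ℓ (f m) (f m') = ℓ (ε * W k * (V k * ε'⁻¹)) := by rw [← hfm]; rfl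
    have y7 := H.mul (ε * W k) (V k * ε'⁻¹)
    have y8 := H.mul ε (W k)
    have y9 := U.upper 1 (W k)
    have y10 := U.hshift (W k) 1 (C.W_comm k)
    have y11 := U.h1
    rw [mul_one] at y10
    rw [ds_one_left, U.b1] at y9
    rw [rW] at y5
    omega
  rw [hm', C.fs, inv_mul_cancel_left, rW, rV] at hfm
  have hab1 : ε * W k = W k * ε := (hab _ _ c1 (C.W_comm k)).eq
  have hconj : (V k)⁻¹ * ε * V k = ε' := by
    rw [hab1] at hfm
    have : V k = ε * (V k * ε'⁻¹) := by
      apply mul_left_cancel (a := W k)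
      rw [← mul_assoc]; exact hfm
    calc (V k)⁻¹ * ε * V k = (V k)⁻¹ * (ε * (V k * ε'⁻¹)) * ε' := by group
      _ = ε' := by rw [← this]; group
  have hε1 : ε = 1 := by
    by_contra hne
    exact C.V_comm k (hmal ε (V k) hne c1 (by rw [hconj]; exact c1'))
  refine hg ⟨t, ?_⟩
  beta_reduce
  rw [rt] at hε
  rw [hε1] at hε
  have : f m = g⁻¹ * (r ^ t * f m) := by rw [eq_comm, inv_mul_eq_one] at hε; exact hε
  rw [← mul_assoc, eq_comm, mul_eq_right, inv_mul_eq_one] at this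
  exact this.symm

end RelChain

end

section

variable {G : Type*} [Group G] {ℓ : G → ℤ} {δ σ D : ℤ} {s r : G} {b h br hr : G → ℤ}
  {W V f : ℤ → G}

namespace RelChain

theorem growth_mul (C : RelChain ℓ s b σ D r W V f) (U : UData ℓ δ s b h σ) (H : HypLen ℓ δ) (n : ℕ) :
    n * (D - 201 * σ) ≤ 6 * ds ℓ (f 0) (f n) := by
  induction n with
  | zero => have := H.ds_nonneg (f 0) (f 0); simpa using this
  | succ n ih =>
    have e1 := C.chain U H (show (0 : ℤ) ≤ n by omega) (show (n : ℤ) ≤ n + 1 by omega)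
    have e2 := C.step_ds U H n
    have e3 := C.D3 n
    push_cast
    rw [add_mul, one_mul]
    omega

/-- A periodic chain makes its translation an axis satisfying small cancellation. -/
theorem axisData (C : RelChain ℓ s b σ D r W V f) (U : UData ℓ δ s b h σ) (H : HypLen ℓ δ)
    {n : ℕ} (hn : 1000000000 ≤ n) (hs : ∀ i, f (i + n) = r * f i)
    (hab : ∀ x y, Commute x s → Commute y s → Commute x y)
    (hmal : ∀ γ v, γ ≠ 1 → Commute γ s → Commute (v⁻¹ * γ * v) s → Commute v s) :
    1000 * σ ≤ D ∧ ∃ b' h' L, AxisData ℓ δ r (100 * D) L b' h' := by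
  have h0 := sig_pos U H
  have h1 := U.sig
  have hd := H.dpos
  have hD : 1000 * σ ≤ D := (C.lo 0).trans (C.hi 0)
  obtain ⟨br, hr, R⟩ := H.exists_lineData (n := n) (by omega) C.f0 hs
    (fun i j k => C.chain U H) (C.growth U H)
  have hM : ∀ t, ∃ k, br (f k) ≤ t ∧ t < br (f k) + 2 * ((D + 7 * σ) / 2 + 1) := by
    intro t
    obtain ⟨k, h1, h2⟩ := C.dense U H R t
    exact ⟨k, h1, by omega⟩
  have hov : ∀ g, g ∉ Subgroup.zpowers r → ∀ i j, br (g * f i) - br (g * f j) ≤ 12 * D :=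
    fun g hg i j => C.overlap U H R hab hmal hg i j
  have hcom : ∀ k : ℤ, r ^ k * r = r * r ^ k := fun k => (Commute.refl r).zpow_left k
  refine ⟨hD, br, hr, br r, ?_⟩
  constructor
  · omega
  · have e1 := C.growth_mul U H n
    have e2 := R.bf 0 n (by omega)
    have e3 := hs 0
    rw [zero_add, C.f0, mul_one] at e3
    rw [e3, C.f0, R.b1] at e2
    rw [e3, C.f0] at e1
    have : 1000000000 * (D - 201 * σ) ≤ n * (D - 201 * σ) :=
      mul_le_mul_of_nonneg_right (by exact_mod_cast hn) (by omega)
    omega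
  · exact R.hnn
  · exact R.b_lip
  · exact R.h_lip
  · intro x y
    have := R.upper x y
    omega
  · intro x y hxy
    have := R.lower x y (by omega)
    omega
  · rfl
  · intro k x
    have := R.shift _ x (hcom k)
    omega
  · intro k x
    have := R.hshift _ x (hcom k)
    omega
  · intro g x hg hx
    exact R.behr H C.f0 hM (hov g hg) (hov g⁻¹ (by simpa using hg)) (by omega) x hx
  · intro g p hg
    have := R.near H C.f0 hM (hov g hg) p
    omega
  · have := R.hf 0
    rw [C.f0] at this
    omega
  · exact R.b1

end RelChain

/-- The axis data attached to a loxodromic element. -/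
theorem Lox.uData (S : Lox ℓ δ s) (H : HypLen ℓ δ) (tf : TorFree G) :
    ∃ b h, LineData ℓ δ (7 * δ) s (fun i => s ^ i) b h ∧
      ∃ σ₀, ∀ σ, σ₀ ≤ σ → UData ℓ δ s b h σ := by
  obtain ⟨b, h, D⟩ := S.lineData H
  obtain ⟨K, K0, hK⟩ := S.overlap H tf D
  have hd := H.dpos
  have hb := S.big
  refine ⟨b, h, D, K + 2 * ℓ s + 100 * δ, fun σ hσ => ?_⟩
  have f0 : (fun i : ℤ => s ^ i) 0 = 1 := zpow_zero s
  constructor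
  · omega
  · exact D.b1
  · have := D.hf 0
    beta_reduce at this; rw [zpow_zero] at this
    omega
  · exact D.b_lip
  · exact D.h_lip
  · intro x y
    have := D.upper x y
    omega
  · intro x y hxy
    have := D.lower x y (by omega)
    omega
  · intro ε x hε
    have := D.shift ε x hε
    omega
  · intro ε x hε
    have := D.hshift ε x hε
    omega
  · intro g x hg hx
    exact D.behr H f0 (S.dense H D) (hK g hg) (hK g⁻¹ fun e => hg
      (by have := Commute.inv_left (show Commute g⁻¹ s from e); simpa using this)) (by omega) x hx
  · intro g p hg
    have := D.near H f0 (S.dense H D) (hK g hg) p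
    omega

/-- Prefix products of a bi-infinite sequence. -/
theorem exists_prefix_products (x : ℤ → G) : ∃ f : ℤ → G, f 0 = 1 ∧ ∀ k, f (k + 1) = f k * x k := by
  let p : ℕ → G := fun n => Nat.rec 1 (fun k y => y * x k) n
  let q : ℕ → G := fun n => Nat.rec 1 (fun k y => y * (x (-(k + 1)))⁻¹) n
  have hp : ∀ n, p (n + 1) = p n * x n := fun _ => rfl
  have hq : ∀ n : ℕ, q (n + 1) = q n * (x (-(n + 1)))⁻¹ := fun _ => rfl
  have p0 : p 0 = 1 := rfl
  have q0 : q 0 = 1 := rfl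
  clear_value p q
  refine ⟨fun k => if 0 ≤ k then p k.toNat else q (-k).toNat, by simp [p0], fun k => ?_⟩
  beta_reduce
  rcases lt_trichotomy k (-1) with hk | hk | hk
  · rw [if_neg (by omega), if_neg (by omega)]
    obtain ⟨m, rfl⟩ : ∃ m : ℕ, k = -(m + 1) := ⟨(-k - 1).toNat, by omega⟩
    rw [show (-(-(m + 1) + 1 : ℤ)).toNat = m by omega, show (-(-(m + 1)) : ℤ).toNat = m + 1 by omega,
      hq, inv_mul_cancel_right]
  · subst hk
    have := hq 0
    simp [p0, q0] at this ⊢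
    simp [this]
  · rw [if_pos (by omega), if_pos (by omega)]
    obtain ⟨m, rfl⟩ : ∃ m : ℕ, k = m := ⟨k.toNat, by omega⟩
    rw [show ((m : ℤ) + 1).toNat = m + 1 by omega, hp]
    simp

theorem prefix_products_periodic {x f : ℤ → G} {n : ℤ} (f0 : f 0 = 1)
    (fs : ∀ k, f (k + 1) = f k * x k) (hx : ∀ k, x (k + n) = x k) (k : ℤ) :
    f (k + n) = f n * f k := by
  induction k using Int.induction_on with
  | zero => simp [f0]
  | succ i ih =>
    rw [show (i : ℤ) + 1 + n = i + n + 1 by ring, fs, ih, fs, hx, mul_assoc]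
  | pred i ih =>
    have e1 := fs (-i - 1 + n)
    have e2 := fs (-i - 1)
    rw [show (-i - 1 + n + 1 : ℤ) = -i + n by ring, ih, hx] at e1
    rw [sub_add_cancel] at e2
    rw [e2, ← mul_assoc] at e1
    exact (mul_right_cancel e1).symm

theorem zpow_translate {f : ℤ → G} {n : ℤ} (h : ∀ k, f (k + n) = r * f k) (t k : ℤ) :
    f (k + n * t) = r ^ t * f k := by
  induction t using Int.induction_on with
  | zero => simp
  | succ i ih =>
    rw [show k + n * (i + 1 : ℤ) = k + n * i + n by ring, h, ih, zpow_add, zpow_one, ← mul_assoc,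
      (Commute.refl r).zpow_right]
  | pred i ih =>
    have := h (k + n * (-i - 1))
    rw [show k + n * (-i - 1 : ℤ) + n = k + n * -i by ring, ih] at this
    rw [zpow_sub, zpow_one, (Commute.refl r).zpow_left _ |>.inv_right.eq, mul_assoc, this,
      inv_mul_cancel_left]
end

section

variable {G : Type*} [Group G] {ℓ : G → ℤ} {δ : ℤ} {s : G} {b h : G → ℤ}

theorem UData.zpow_bounds {σ : ℤ} (U : UData ℓ δ s b h σ) {w : G} (hw : Commute w s) (e : ℕ) :
    e * (b w - σ) ≤ b (w ^ e) ∧ b (w ^ e) ≤ e * (b w + σ) := by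
  induction e with
  | zero => simp [U.b1]
  | succ e ih =>
    have := U.shift w (w ^ e) hw
    rw [← pow_succ'] at this
    push_cast
    rw [add_mul, one_mul, add_mul, one_mul]
    omega

open Subgroup in
/-- A relator satisfying small cancellation which forces `a` into the subgroup generated by
`s` and `v`. -/
theorem Lox.exists_relator (S : Lox ℓ δ s) (H : HypLen ℓ δ) (tf : TorFree G) {v : G}
    (hv : ¬ Commute v s) (a : G) (T : ℤ) :
    ∃ r σ L b h, AxisData ℓ δ r σ L b h ∧ T ≤ σ ∧ a ∈ closure {s, v} ⊔ normalClosure {r} := by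
  obtain ⟨b, h, D, σ₀, hU⟩ := S.uData H tf
  obtain ⟨w0, hw0, hvs⟩ : ∃ w0, w0 ∈ closure {s, v} ∧ ¬ Commute (v * a * w0) s := by
    by_cases hc : Commute (v * a) s
    · refine ⟨v, subset_closure (by simp), fun hc' => hv ?_⟩
      have := hc.inv_left.mul_left hc'
      rwa [inv_mul_cancel_left] at this
    · exact ⟨1, one_mem _, by rwa [mul_one]⟩
  obtain ⟨vs, evs⟩ : ∃ vs, vs = v * a * w0 := ⟨_, rfl⟩
  rw [← evs] at hvs
  have hd := H.dpos
  obtain ⟨σ, s0, s1, s2, s3, s4⟩ :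
      ∃ σ, σ₀ ≤ σ ∧ T ≤ σ ∧ 2 * ℓ v ≤ σ ∧ 2 * ℓ vs ≤ σ ∧ 100 * δ ≤ σ :=
    ⟨max σ₀ (max T (max (2 * ℓ v) (max (2 * ℓ vs) (100 * δ)))), by omega, by omega, by omega,
      by omega, by omega⟩
  have U := hU σ s0
  have hσ : 100 ≤ σ := by omega
  obtain ⟨w, hw, hws, hτ⟩ : ∃ w, Commute w s ∧ w ∈ closure {s, v} ∧ 2000 * σ ≤ b w := by
    refine ⟨s ^ ((2000 * σ).toNat), (Commute.refl s).pow_left _,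
      pow_mem (subset_closure (by simp)) _, ?_⟩
    have e1 := D.bf 0 ((2000 * σ).toNat) (by omega)
    have e2 := S.growth H 0 ((2000 * σ).toNat)
    rw [zero_add] at e2
    beta_reduce at e1
    rw [zpow_zero, U.b1, zpow_natCast] at e1
    rw [zpow_zero, zpow_natCast] at e2
    omega
  obtain ⟨τ, eτ⟩ : ∃ τ, τ = b w := ⟨_, rfl⟩
  obtain ⟨Q, hQ⟩ : ∃ Q : ℕ, 1000000000 ≤ Q := ⟨_, le_rfl⟩
  obtain ⟨e, he⟩ : ∃ e : ℤ → ℕ, ∀ k, e k = Q + (k % Q).toNat := ⟨_, fun _ => rfl⟩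
  have hmod : ∀ k : ℤ, 0 ≤ k % Q ∧ k % Q < Q := fun k =>
    ⟨Int.emod_nonneg _ (by omega), Int.emod_lt_of_pos _ (by omega)⟩
  obtain ⟨V, hV⟩ : ∃ V : ℤ → G, ∀ k, V k = if k % Q = Q - 1 then vs else v := ⟨_, fun _ => rfl⟩
  obtain ⟨f, f0, fs⟩ := exists_prefix_products fun k => w ^ e k * V k
  have hper : ∀ k : ℤ, (k + Q) % Q = k % Q := fun k => by simp
  have hs : ∀ k, f (k + Q) = f Q * f k :=
    prefix_products_periodic f0 fs fun k => by simp only [he, hV, hper]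
  have hbd := U.zpow_bounds hw
  rw [← eτ] at hbd hτ
  have C : RelChain ℓ s b σ (2 * Q * (τ + σ)) (f Q) (fun k => w ^ e k) V f := by
    constructor
    · exact fun k => hw.pow_left _
    · intro k
      rw [hV]
      split_ifs <;> assumption
    · intro k
      rw [hV]
      split_ifs <;> assumption
    · exact f0
    · exact fs
    · intro k
      have h1 : (1 : ℤ) * (τ - σ) ≤ e k * (τ - σ) :=
        mul_le_mul_of_nonneg_right (by rw [he]; push_cast; omega) (by omega)
      have := (hbd (e k)).1
      omega
    · intro k
      have h1 : (e k : ℤ) * (τ + σ) ≤ (2 * Q) * (τ + σ) :=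
        mul_le_mul_of_nonneg_right (by rw [he]; have := hmod k; push_cast; omega) (by omega)
      exact (hbd (e k)).2.trans h1
    · intro k
      have h1 : (Q : ℤ) * (τ - σ) ≤ e k * (τ - σ) :=
        mul_le_mul_of_nonneg_right (by rw [he]; push_cast; omega) (by omega)
      have h2 : 0 ≤ (Q : ℤ) * (τ - 5 * σ) := mul_nonneg (by omega) (by omega)
      have := (hbd (e k)).1
      nlinarith
    · have key : ∀ x d : ℕ, d ≠ 0 → ¬ Near (b (w ^ (x + d))) (b (w ^ x)) (50 * σ) := by
        intro x d hd0 hN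
        have h1 := U.shift (w ^ d) (w ^ x) (hw.pow_left _)
        rw [← pow_add, add_comm d x] at h1
        have h2 : (1 : ℤ) * (τ - σ) ≤ d * (τ - σ) :=
          mul_le_mul_of_nonneg_right (by omega) (by omega)
        have := (hbd d).1
        omega
      intro m k hN
      have hek : e m = e k := by
        rcases lt_trichotomy (e m) (e k) with hlt | heq | hlt
        · exfalso
          obtain ⟨d, hd'⟩ := Nat.exists_eq_add_of_lt hlt
          rw [hd', add_assoc] at hN
          exact key _ _ (Nat.succ_ne_zero d) ⟨hN.2, hN.1⟩
        · exact heq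
        · exfalso
          obtain ⟨d, hd'⟩ := Nat.exists_eq_add_of_lt hlt
          rw [hd', add_assoc] at hN
          exact key _ _ (Nat.succ_ne_zero d) hN
      have hmk : m % Q = k % Q := by
        have := hmod m
        have := hmod k
        rw [he, he] at hek
        omega
      refine ⟨by rw [hek], by rw [hV, hV, hmk], k / Q - m / Q, ?_⟩
      rw [← zpow_translate hs]
      congr 1
      have h1 := Int.mul_ediv_add_emod k Q
      have h2 := Int.mul_ediv_add_emod m Q
      rw [mul_sub]
      omega
  obtain ⟨hD, b', h', L, A⟩ := C.axisData U H hQ hs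
    (fun x y hx hy => H.commute_trans tf (S.ne_one H) hx hy)
    (fun γ v h1 h2 h3 => S.malnormal H tf h1 h2 h3)
  refine ⟨_, _, L, b', h', A, by omega, ?_⟩
  have hsub : ∀ k : ℕ, k < Q → f k ∈ closure {s, v} := by
    intro k hk
    induction k with
    | zero => rw [Nat.cast_zero, f0]; exact one_mem _
    | succ k ih =>
      rw [Nat.cast_succ, fs]
      refine mul_mem (ih (by omega)) (mul_mem (pow_mem hws _) ?_)
      rw [hV, Int.emod_eq_of_lt (by omega) (by omega), if_neg (by omega)]
      exact subset_closure (by simp)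
  have hr := fs (Q - 1)
  beta_reduce at hr
  rw [sub_add_cancel, hV, Int.emod_eq_of_lt (by omega) (by omega), if_pos rfl, evs] at hr
  have h1 := hsub (Q - 1) (by omega)
  rw [show (((Q - 1 : ℕ) : ℤ)) = Q - 1 by omega] at h1
  have hle : closure {s, v} ≤ closure {s, v} ⊔ normalClosure {f Q} := le_sup_left
  have h2 : f Q ∈ closure {s, v} ⊔ normalClosure {f Q} :=
    le_sup_right (a := closure {s, v}) (subset_normalClosure rfl)
  have h3 : a = v⁻¹ * ((w ^ e (Q - 1))⁻¹ * ((f (Q - 1))⁻¹ * f Q)) * w0⁻¹ := by rw [hr]; group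
  rw [h3]
  refine mul_mem (mul_mem (inv_mem (hle (subset_closure (by simp)))) (mul_mem
    (inv_mem (hle (pow_mem hws _))) (mul_mem (inv_mem (hle h1)) h2))) (inv_mem (hle hw0))
end

section

open Subgroup
open scoped commutatorElement

variable {G : Type*} [Group G] {ℓ : G → ℤ} {δ : ℤ}

theorem HypLen.exists_relator (H : HypLen ℓ δ) (tf : TorFree G) {u v : G}
    (huv : ¬ Commute v u) (a : G) (T : ℤ) :
    ∃ r σ L b h, AxisData ℓ δ r σ L b h ∧ T ≤ σ ∧ a ∈ closure {u, v} ⊔ normalClosure {r} := by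
  have hu : u ≠ 1 := by
    rintro rfl
    exact huv (Commute.one_right v)
  obtain ⟨j, hj, m, S⟩ := H.exists_lox tf hu
  have hv : ¬ Commute (m⁻¹ * v * m) (m⁻¹ * u ^ j * m) := by
    intro hc
    have h1 : v * u ^ j = u ^ j * v := by
      calc v * u ^ j = m * ((m⁻¹ * v * m) * (m⁻¹ * u ^ j * m)) * m⁻¹ := by group
        _ = m * ((m⁻¹ * u ^ j * m) * (m⁻¹ * v * m)) * m⁻¹ := by rw [hc.eq]
        _ = u ^ j * v := by group
    exact huv (H.commute_trans tf (fun e => hu (tf u j hj e)) h1 ((Commute.refl u).pow_right j).eq)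
  obtain ⟨r, σ, L, b, h, A, hT, ha⟩ := S.exists_relator H tf hv (m⁻¹ * a * m) T
  refine ⟨r, σ, L, b, h, A, hT, ?_⟩
  have h1 := mem_map_of_mem (MulAut.conj m).toMonoidHom ha
  rw [Subgroup.map_sup] at h1
  have h2 : (MulAut.conj m).toMonoidHom (m⁻¹ * a * m) = a := by simp [mul_assoc]
  rw [h2] at h1
  refine SetLike.le_def.1 (sup_le_sup ?_ ?_) h1
  · rw [MonoidHom.map_closure, closure_le]
    rintro _ ⟨x, hx | hx, rfl⟩
    · subst hx
      have : (MulAut.conj m).toMonoidHom (m⁻¹ * u ^ j * m) = u ^ j := by simp [mul_assoc]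
      rw [this]
      exact pow_mem (subset_closure (by simp)) _
    · rw [Set.mem_singleton_iff] at hx
      subst hx
      have : (MulAut.conj m).toMonoidHom (m⁻¹ * v * m) = v := by simp [mul_assoc]
      rw [this]
      exact subset_closure (by simp)
  · rw [map_le_iff_le_comap]
    exact fun x hx => normalClosure_normal.conj_mem x hx m

/-- The quotient by `N` is a torsion-free hyperbolic group. -/
def GoodKer {F : Type} [Group F] (N : Subgroup F) : Prop :=
  ∃ (Q : Type) (_ : Group Q) (π : F →* Q), Function.Surjective π ∧ π.ker = N ∧ TorFree Q ∧
    ∃ ℓ δ, HypLen (G := Q) ℓ δ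

/-- One step of the construction. -/
structure Extends {F : Type} [Group F] (N N' : Subgroup F) (r : F) (S : Set F) : Prop where
  eq : N' = N ⊔ normalClosure {r}
  rel : r ∉ N
  inj : ∀ s ∈ S, s ∈ N' → s ∈ N
  cent : ∀ g ∈ S, g ∉ N → ∀ x, x * g * x⁻¹ * g⁻¹ ∈ N' →
    ∃ y, y * g * y⁻¹ * g⁻¹ ∈ N ∧ x * y⁻¹ ∈ N'
  comm : N ⊓ (⁅(⊤ : Subgroup F), N⁆ ⊔ normalClosure {r}) ≤ ⁅(⊤ : Subgroup F), N⁆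
  free : r ∉ N ⊔ ⁅(⊤ : Subgroup F), N'⁆

theorem AxisData.not_mem_commutator {r : G} {σ L : ℤ} {b h : G → ℤ}
    (D : AxisData ℓ δ r σ L b h) (H : HypLen ℓ δ) :
    r ∉ ⁅(⊤ : Subgroup G), normalClosure {r}⁆ := by
  intro hr
  let rh : G × Multiplicative ℤ := (r, Multiplicative.ofAdd 1)
  let p : G × Multiplicative ℤ →* G := MonoidHom.fst _ _
  have hp : Function.Surjective p := fun x => ⟨(x, 1), rfl⟩
  have h1 : map p ⁅(⊤ : Subgroup (G × Multiplicative ℤ)), normalClosure {rh}⁆ =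
      ⁅(⊤ : Subgroup G), normalClosure {r}⁆ := by
    rw [map_commutator, map_top_of_surjective p hp, map_normalClosure _ _ hp, Set.image_singleton]
    rfl
  rw [← h1] at hr
  obtain ⟨x, hx, hxr⟩ := hr
  have h2 : x.2 = 1 := by
    have h3 : ⁅(⊤ : Subgroup (G × Multiplicative ℤ)), normalClosure {rh}⁆ ≤
        (MonoidHom.snd G (Multiplicative ℤ)).ker := by
      rw [commutator_le]
      intro g _ g' _
      rw [MonoidHom.mem_ker, map_commutatorElement, commutatorElement_eq_one_iff_mul_comm, mul_comm]
    exact h3 hx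
  have h3 : x⁻¹ * rh ∈ normalClosure {rh} :=
    mul_mem (inv_mem (commutator_le_right _ _ hx)) (subset_normalClosure rfl)
  have D' : AxisData ℓ δ (p rh) σ L b h := D
  have h4 := D'.central H (by
    rintro ⟨z1, z2⟩ hz ⟨e1, e2⟩
    have : z1 = 1 := hz
    subst this
    simp [mul_comm]) h3 (by rw [map_mul, map_inv, hxr]; exact inv_mul_cancel r)
  have h5 := congrArg Prod.snd h4
  simp [h2, rh] at h5

theorem GoodKer.exists_extends {F : Type} [Group F] {N : Subgroup F} (hN : GoodKer N) {u v : F}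
    (huv : v * u * v⁻¹ * u⁻¹ ∉ N) (a : F) {S : Set F} (hS : S.Finite) :
    ∃ N' r, GoodKer N' ∧ Extends N N' r S ∧ a ∈ closure {u, v} ⊔ N' := by
  obtain ⟨Q, _, π, hπ, rfl, tf, ℓ, δ, H⟩ := hN
  obtain ⟨T, hT⟩ : ∃ T, ∀ s ∈ S, ℓ (π s) ≤ T := by
    obtain ⟨T, hT⟩ := (hS.image fun s => ℓ (π s)).bddAbove
    exact ⟨T, fun s hs => hT ⟨s, hs, rfl⟩⟩
  have huv' : ¬ Commute (π v) (π u) := by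
    intro hc
    apply huv
    rw [MonoidHom.mem_ker, map_mul, map_mul, map_mul, hc.eq]
    simp
  obtain ⟨r', σ, L, b, h, A, hTσ, ha⟩ := H.exists_relator tf huv' (π a) T
  obtain ⟨r, rfl⟩ := hπ r'
  have h0 := A.sig_pos H
  have hbig := A.big
  obtain ⟨M, hM⟩ : ∃ M, M = normalClosure {π r} := ⟨_, rfl⟩
  have hMn : M.Normal := hM ▸ normalClosure_normal
  have hmap : map π (normalClosure {r}) = M := by
    rw [map_normalClosure _ _ hπ, Set.image_singleton, hM]
  have hcom : comap π M = π.ker ⊔ normalClosure {r} := by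
    rw [← hmap, comap_map_eq, sup_comm]
  have hinj : ∀ s ∈ S, π s ∈ M → π s = 1 := by
    intro s hs hsM
    by_contra hne
    have := A.long H (hM ▸ hsM) hne
    have := hT s hs
    omega
  refine ⟨comap π M, r, ?_, ?_, ?_⟩
  · refine ⟨Q ⧸ M, inferInstance, (QuotientGroup.mk' M).comp π,
      (QuotientGroup.mk'_surjective M).comp hπ, ?_, ?_⟩
    · rw [← MonoidHom.comap_ker, QuotientGroup.ker_mk']
    · have h1 : (QuotientGroup.mk' M).ker = normalClosure {π r} := by
        rw [QuotientGroup.ker_mk', hM]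
      exact ⟨A.torFree H tf (QuotientGroup.mk'_surjective M) h1, _, _,
        A.hypLen_qlen H (QuotientGroup.mk'_surjective M) h1⟩
  · constructor
    · exact hcom
    · intro hr
      have := A.br
      rw [MonoidHom.mem_ker] at hr
      rw [hr, A.b1] at this
      omega
    · intro s hs hsM
      exact hinj s hs hsM
    · intro g hg hgN x hx
      have h1 : π g ∉ normalClosure {π r} := fun hc => hgN (hinj g hg (hM ▸ hc))
      rw [mem_comap, map_mul, map_mul, map_mul, map_inv, map_inv, hM] at hx
      have h2 := hT g hg
      obtain ⟨y', hy1, hy2⟩ := A.commute_lift H (by omega) h1 (π x) hx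
      obtain ⟨y, rfl⟩ := hπ y'
      refine ⟨y, ?_, ?_⟩
      · rw [MonoidHom.mem_ker, map_mul, map_mul, map_mul, hy1]
        simp
      · rw [mem_comap, map_mul, map_inv, hM]
        exact hy2
    · rintro x ⟨hx1, hx2⟩
      obtain ⟨C, hC⟩ : ∃ C, C = ⁅(⊤ : Subgroup F), π.ker⁆ := ⟨_, rfl⟩
      rw [← hC] at hx2 ⊢
      have hCn : C.Normal := hC ▸ inferInstance
      have hle : C ≤ π.ker := hC ▸ commutator_le_right _ _
      let p : F ⧸ C →* Q := QuotientGroup.lift C π hle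
      have A' : AxisData ℓ δ (p (QuotientGroup.mk' C r)) σ L b h := A
      have hs := QuotientGroup.mk'_surjective C
      have h1 := A'.central H (y := QuotientGroup.mk' C x) (by
        intro z hz e
        obtain ⟨z, rfl⟩ := hs z
        obtain ⟨e, rfl⟩ := hs e
        have hz : z ∈ π.ker := hz
        have h3 : ⁅e, z⁆ ∈ C := by rw [hC]; exact commutator_mem_commutator (mem_top e) hz
        rw [← QuotientGroup.ker_mk' C, MonoidHom.mem_ker, map_commutatorElement,
          commutatorElement_eq_one_iff_mul_comm] at h3
        exact h3.symm) (by
        have := mem_map_of_mem (QuotientGroup.mk' C) hx2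
        rw [Subgroup.map_sup, QuotientGroup.map_mk'_self, bot_sup_eq, map_normalClosure _ _ hs,
          Set.image_singleton] at this
        exact this) hx1
      rw [← MonoidHom.mem_ker, QuotientGroup.ker_mk'] at h1
      exact h1
    · intro hr
      have h1 := mem_map_of_mem π hr
      rw [Subgroup.map_sup, (Subgroup.map_eq_bot_iff _).2 le_rfl, bot_sup_eq, map_commutator,
        map_top_of_surjective π hπ, map_comap_eq_self_of_surjective hπ, hM] at h1
      exact A.not_mem_commutator H h1
  · have h1 : map π (closure {u, v}) = closure {π u, π v} := by
      rw [MonoidHom.map_closure, Set.image_pair]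
    rw [← h1, ← hM, ← hmap, ← Subgroup.map_sup] at ha
    have h2 : a ∈ comap π (map π (closure {u, v} ⊔ normalClosure {r})) := ha
    rw [comap_map_eq, sup_assoc, sup_comm (normalClosure {r}), ← hcom] at h2
    exact h2
end

section

open FreeGroup

variable {α : Type}

theorem freeGroup_torFree : TorFree (FreeGroup α) := by
  intro g m hm hg
  exact (pow_eq_one_iff_left hm).1 hg

variable [DecidableEq α]

/-- The length of the longest common initial segment. -/
def commonPrefix : List (α × Bool) → List (α × Bool) → ℕ
  | a :: L, b :: M => if a = b then commonPrefix L M + 1 else 0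
  | _, _ => 0

theorem commonPrefix_ultra (L M K : List (α × Bool)) :
    commonPrefix L M ≤ commonPrefix M K ∨ commonPrefix L K ≤ commonPrefix M K := by
  induction L generalizing M K with
  | nil => left; simp [commonPrefix]
  | cons a L ih =>
    cases M with
    | nil => left; simp [commonPrefix]
    | cons b M =>
      cases K with
      | nil => right; simp [commonPrefix]
      | cons c K =>
        have := ih M K
        simp only [commonPrefix]
        split_ifs <;> first | omega | (subst_vars; contradiction)

theorem norm_inv_mul_mk {L M : List (α × Bool)} (hL : IsReduced L) (hM : IsReduced M) :
    norm ((mk L)⁻¹ * mk M) + 2 * commonPrefix L M = L.length + M.length := by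
  induction L generalizing M with
  | nil =>
    rw [← one_eq_mk, inv_one, one_mul, FreeGroup.norm, toWord_mk, hM.reduce_eq]
    simp [commonPrefix]
  | cons a L ih =>
    cases M with
    | nil =>
      rw [← one_eq_mk, mul_one, norm_inv_eq, FreeGroup.norm, toWord_mk, hL.reduce_eq]
      simp [commonPrefix]
    | cons b M =>
      by_cases hab : a = b
      · subst hab
        have h0 : IsReduced L := List.IsChain.tail hL
        have h3 : IsReduced M := List.IsChain.tail hM
        have h1 := ih h0 h3
        have h2 : ∀ K : List (α × Bool), mk (a :: K) = mk [a] * mk K := fun K => by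
          rw [mul_mk]; rfl
        rw [h2 L, h2 M, mul_inv_rev, mul_assoc, inv_mul_cancel_left]
        simp only [commonPrefix, if_true, List.length_cons]
        omega
      · have h0 : invRev (a :: L) = invRev L ++ [(a.1, !a.2)] := by simp [invRev]
        have h1 : IsReduced (invRev L ++ [(a.1, !a.2)] ++ b :: M) := by
          apply IsReduced.append_overlap
          · rw [← h0]
            apply IsReduced.of_reduce_eq
            rw [reduce_invRev, hL.reduce_eq]
          · rw [List.singleton_append, isReduced_cons_cons]
            refine ⟨fun h => ?_, hM⟩
            by_contra hne
            exact hab (Prod.ext h (by simpa using hne))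
          · simp
        rw [inv_mk, mul_mk, FreeGroup.norm, toWord_mk, h0, h1.reduce_eq]
        simp only [commonPrefix, if_neg hab, List.length_append, List.length_cons, invRev_length,
          List.length_nil]
        omega

theorem freeGroup_norm_inv_mul (x y : FreeGroup α) :
    norm (x⁻¹ * y) + 2 * commonPrefix x.toWord y.toWord = norm x + norm y := by
  have := norm_inv_mul_mk (isReduced_toWord (x := x)) (isReduced_toWord (x := y))
  rwa [mk_toWord, mk_toWord] at this

theorem freeGroup_hypLen [Finite α] : HypLen (fun g : FreeGroup α => (norm g : ℤ)) 1 := by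
  constructor
  · intro g; positivity
  · simp
  · intro g hg
    exact norm_eq_zero.1 (by omega)
  · intro g
    rw [norm_inv_eq]
  · intro g h
    exact_mod_cast norm_mul_le g h
  · intro g k h0 hk
    have h1 : g.toWord = g.toWord.take k.toNat ++ g.toWord.drop k.toNat :=
      (List.take_append_drop _ _).symm
    have hl : (g.toWord.length : ℤ) = norm g := rfl
    have h2 : g = mk (g.toWord.take k.toNat) * mk (g.toWord.drop k.toNat) := by
      rw [mul_mk, ← h1, mk_toWord]
    have hr := isReduced_toWord (x := g)
    refine ⟨mk (g.toWord.take k.toNat), ?_, ?_⟩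
    · rw [FreeGroup.norm, toWord_mk, IsReduced.reduce_eq (List.IsChain.take hr _), List.length_take]
      omega
    · nth_rewrite 2 [h2]
      rw [inv_mul_cancel_left, FreeGroup.norm, toWord_mk, IsReduced.reduce_eq (List.IsChain.drop hr _),
        List.length_drop]
      omega
  · intro n
    refine Set.Finite.of_finite_image (f := toWord) ?_ toWord_injective.injOn
    refine (List.finite_length_le (α × Bool) n.toNat).subset ?_
    rintro _ ⟨g, hg, rfl⟩
    have hg : (norm g : ℤ) ≤ n := hg
    have hl : g.toWord.length = norm g := rfl
    change g.toWord.length ≤ n.toNat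
    omega
  · rfl
  · intro x y z w
    have e : ∀ p q, ds (fun g : FreeGroup α => (norm g : ℤ)) p q =
        norm (x⁻¹ * p) + norm (x⁻¹ * q) -
          2 * commonPrefix (x⁻¹ * p).toWord (x⁻¹ * q).toWord := by
      intro p q
      have := freeGroup_norm_inv_mul (x⁻¹ * p) (x⁻¹ * q)
      rw [← ds_mul_left _ x⁻¹ p q]
      simp only [ds]
      omega
    have e0 : ∀ q, ds (fun g : FreeGroup α => (norm g : ℤ)) x q = norm (x⁻¹ * q) := fun q => rfl
    rw [e0, e0, e0, e z w, e y w, e y z]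
    have := commonPrefix_ultra (x⁻¹ * w).toWord (x⁻¹ * y).toWord (x⁻¹ * z).toWord
    have := commonPrefix_ultra (x⁻¹ * y).toWord (x⁻¹ * z).toWord (x⁻¹ * w).toWord
    have := commonPrefix_ultra (x⁻¹ * z).toWord (x⁻¹ * y).toWord (x⁻¹ * w).toWord
    have c : ∀ L M : List (α × Bool), commonPrefix L M = commonPrefix M L := by
      intro L
      induction L with
      | nil => intro M; cases M <;> simp [commonPrefix]
      | cons a L ih =>
        intro M
        cases M with
        | nil => simp [commonPrefix]
        | cons b M => simp only [commonPrefix, ih M, eq_comm]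
    rw [c (x⁻¹ * w).toWord] at *
    rw [c (x⁻¹ * z).toWord (x⁻¹ * y).toWord] at *
    omega

theorem goodKer_bot : GoodKer (⊥ : Subgroup (FreeGroup (Fin 2))) :=
  ⟨FreeGroup (Fin 2), inferInstance, MonoidHom.id _, Function.surjective_id, rfl,
    freeGroup_torFree, _, _, freeGroup_hypLen⟩
end

section

open Subgroup
open scoped commutatorElement

variable {F : Type} [Group F]

/-- The sequence of relators defining the group. -/
structure RelSeq (N : ℕ → Subgroup F) (r g : ℕ → F) : Prop where
  good : ∀ i, GoodKer (N i)
  step : ∀ i, Extends (N i) (N (i + 1)) (r i) {x | ∃ j < i, g j = x}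
  top : ∀ u v a, (∀ i, v * u * v⁻¹ * u⁻¹ ∉ N i) → ∃ i, a ∈ Subgroup.closure {u, v} ⊔ N i

theorem exists_relSeq [Countable F] (hF : GoodKer (⊥ : Subgroup F)) {x y : F}
    (hxy : y * x * y⁻¹ * x⁻¹ ≠ 1) :
    ∃ N r g, RelSeq (F := F) N r g ∧ Function.Surjective g := by
  obtain ⟨g, hg⟩ := exists_surjective_nat F
  obtain ⟨t, ht⟩ := exists_surjective_nat (F × F × F)
  let State := {N : Subgroup F // GoodKer N ∧ y * x * y⁻¹ * x⁻¹ ∉ N}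
  have main : ∀ (i : ℕ) (N : State), ∃ (N' : State) (r : F),
      Extends N.1 N'.1 r {x | ∃ j < i, g j = x} ∧
      ((t i).2.1 * (t i).1 * (t i).2.1⁻¹ * (t i).1⁻¹ ∉ N.1 →
        (t i).2.2 ∈ closure {(t i).1, (t i).2.1} ⊔ N'.1) := by
    rintro i ⟨N, hN, hc⟩
    have hfin : (insert (y * x * y⁻¹ * x⁻¹) {x | ∃ j < i, g j = x}).Finite :=
      ((Set.finite_Iio i).image g).insert _
    have mono : ∀ {N' r}, Extends N N' r (insert (y * x * y⁻¹ * x⁻¹) {x | ∃ j < i, g j = x}) →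
        y * x * y⁻¹ * x⁻¹ ∉ N' ∧ Extends N N' r {x | ∃ j < i, g j = x} := fun E =>
      ⟨fun h => hc (E.inj _ (Set.mem_insert _ _) h), E.eq, E.rel,
        fun s hs => E.inj s (Set.mem_insert_of_mem _ hs),
        fun s hs => E.cent s (Set.mem_insert_of_mem _ hs), E.comm, E.free⟩
    by_cases h : (t i).2.1 * (t i).1 * (t i).2.1⁻¹ * (t i).1⁻¹ ∈ N
    · obtain ⟨N', r, h1, h2, -⟩ := hN.exists_extends hc 1 hfin
      exact ⟨⟨N', h1, (mono h2).1⟩, r, (mono h2).2, fun h' => absurd h h'⟩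
    · obtain ⟨N', r, h1, h2, h3⟩ := hN.exists_extends h (t i).2.2 hfin
      exact ⟨⟨N', h1, (mono h2).1⟩, r, (mono h2).2, fun _ => h3⟩
  choose next rel h1 h2 using main
  let N : ℕ → State := fun n => Nat.rec ⟨⊥, hF, by rwa [mem_bot]⟩ next n
  have hN : ∀ i, N (i + 1) = next i (N i) := fun _ => rfl
  refine ⟨fun i => (N i).1, fun i => rel i (N i), g, ⟨fun i => (N i).2.1, fun i => ?_, ?_⟩, hg⟩
  · rw [hN]
    exact h1 i (N i)
  · intro u v a huv
    obtain ⟨i, hi⟩ := ht (u, v, a)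
    refine ⟨i + 1, ?_⟩
    have := h2 i (N i)
    rw [hi] at this
    rw [hN]
    exact this (huv i)

namespace RelSeq

variable {N : ℕ → Subgroup F} {r g : ℕ → F}

theorem normal (A : RelSeq N r g) (i : ℕ) : (N i).Normal := by
  obtain ⟨Q, _, π, -, h, -⟩ := A.good i
  rw [← h]
  infer_instance

theorem mono (A : RelSeq N r g) : Monotone N :=
  monotone_nat_of_le_succ fun i => (A.step i).eq ▸ le_sup_left

theorem mem_iSup (A : RelSeq N r g) {x : F} : x ∈ ⨆ i, N i ↔ ∃ i, x ∈ N i :=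
  mem_iSup_of_directed A.mono.directed_le

theorem normal_iSup (A : RelSeq N r g) : (⨆ i, N i).Normal := by
  constructor
  intro n hn x
  obtain ⟨i, hi⟩ := A.mem_iSup.1 hn
  exact A.mem_iSup.2 ⟨i, (A.normal i).conj_mem n hi x⟩

theorem centralizer_lift (A : RelSeq N r g) {j : ℕ} (hj : ∀ i, g j ∉ N i) {k : ℕ}
    (hk : j + 1 ≤ k) (x : F) (hx : x * g j * x⁻¹ * (g j)⁻¹ ∈ N k) :
    ∃ y, y * g j * y⁻¹ * (g j)⁻¹ ∈ N (j + 1) ∧ x * y⁻¹ ∈ N k := by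
  induction k, hk using Nat.le_induction generalizing x with
  | base => exact ⟨x, hx, by simp⟩
  | succ k hk ih =>
    obtain ⟨y, h1, h2⟩ := (A.step k).cent (g j) ⟨j, by omega, rfl⟩ (hj k) x hx
    obtain ⟨z, h3, h4⟩ := ih y h1
    refine ⟨z, h3, ?_⟩
    have := mul_mem h2 (A.mono (Nat.le_succ k) h4)
    rwa [mul_assoc, inv_mul_cancel_left] at this

theorem centralizer_cyclic (A : RelSeq N r g) {j : ℕ} (hj : ∀ i, g j ∉ N i) :
    ∃ z, ∀ x, x * g j * x⁻¹ * (g j)⁻¹ ∈ ⨆ i, N i → ∃ t : ℤ, x * (z ^ t)⁻¹ ∈ ⨆ i, N i := by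
  obtain ⟨Q, _, π, hπ, hker, tf, ℓ, δ, H⟩ := A.good (j + 1)
  have hg : π (g j) ≠ 1 := fun h => hj (j + 1) (hker ▸ h)
  obtain ⟨z', hz⟩ := H.centralizer tf hg
  obtain ⟨z, rfl⟩ := hπ z'
  refine ⟨z, fun x hx => ?_⟩
  obtain ⟨k, hk⟩ := A.mem_iSup.1 hx
  obtain ⟨y, h1, h2⟩ := A.centralizer_lift hj (le_max_left (j + 1) k) x
    (A.mono (le_max_right (j + 1) k) hk)
  rw [← hker, MonoidHom.mem_ker, map_mul, map_mul, map_mul, map_inv, map_inv, mul_inv_eq_one,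
    mul_inv_eq_iff_eq_mul] at h1
  obtain ⟨t, ht⟩ := (hz _).1 h1
  refine ⟨t, ?_⟩
  have h3 : y * (z ^ t)⁻¹ ∈ N (j + 1) := by
    rw [← hker, MonoidHom.mem_ker, map_mul, map_inv, map_zpow, ← ht]
    exact mul_inv_cancel _
  have := mul_mem h2 (A.mono (le_max_left (j + 1) k) h3)
  rw [mul_assoc, inv_mul_cancel_left] at this
  exact A.mem_iSup.2 ⟨_, this⟩

/-- Every subgroup of the limit group is finitely generated. -/
theorem fg_subgroup (A : RelSeq N r g) (hg : Function.Surjective g) {R : Subgroup F} [R.Normal]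
    (hR : R = ⨆ i, N i) (K : Subgroup (F ⧸ R)) : K.FG := by
  have hmem : ∀ {x : F}, x ∈ R ↔ ∃ i, x ∈ N i := by rw [hR]; exact A.mem_iSup
  have hle : ∀ i, N i ≤ R := fun i => hR ▸ le_iSup N i
  have hs := QuotientGroup.mk'_surjective R
  have hpk := QuotientGroup.ker_mk' R
  obtain ⟨p, hp⟩ : ∃ p, p = QuotientGroup.mk' R := ⟨_, rfl⟩
  rw [← hp] at hs hpk
  by_cases hc : ∃ u v, p u ∈ K ∧ p v ∈ K ∧ v * u * v⁻¹ * u⁻¹ ∉ R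
  · obtain ⟨u, v, hu, hv, huv⟩ := hc
    have : K = closure {p u, p v} := by
      refine le_antisymm (fun q _ => ?_) ?_
      · obtain ⟨a, rfl⟩ := hs q
        obtain ⟨i, hi⟩ := A.top u v a fun i hi => huv (hmem.2 ⟨i, hi⟩)
        have h1 := mem_map_of_mem p (SetLike.le_def.1 (sup_le_sup_left (hle i) _) hi)
        rwa [Subgroup.map_sup, (Subgroup.map_eq_bot_iff _).2 hpk.ge, sup_bot_eq,
          MonoidHom.map_closure, Set.image_pair] at h1
      · rw [closure_le]
        rintro _ (rfl | rfl) <;> assumption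
    rw [this]
    exact (Subgroup.fg_iff _).2 ⟨_, rfl, by simp⟩
  · push Not at hc
    by_cases hb : K = ⊥
    · rw [hb]
      exact Subgroup.FG.bot
    · obtain ⟨q, hq, hq1⟩ := K.bot_or_exists_ne_one.resolve_left hb
      obtain ⟨x, rfl⟩ := hs q
      obtain ⟨j, rfl⟩ := hg x
      have hj : g j ∉ R := fun h => hq1 (by rwa [← MonoidHom.mem_ker, hpk])
      obtain ⟨z, hz⟩ := A.centralizer_cyclic (j := j) fun i hi => hj (hmem.2 ⟨i, hi⟩)
      have hK : K ≤ zpowers (p z) := by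
        intro q' hq'
        obtain ⟨x, rfl⟩ := hs q'
        obtain ⟨t, ht⟩ := hz x (hR ▸ hc _ _ hq hq')
        rw [← hR, ← hpk, MonoidHom.mem_ker, map_mul, map_inv, map_zpow, mul_inv_eq_one] at ht
        exact ⟨t, ht.symm⟩
      obtain ⟨w, rfl⟩ := Subgroup.eq_zpowers_of_le hK
      rw [zpowers_eq_closure]
      exact (Subgroup.fg_iff _).2 ⟨_, rfl, by simp⟩

theorem commutator_succ_le (A : RelSeq N r g) (i : ℕ) :
    N i ⊓ ⁅(⊤ : Subgroup F), N (i + 1)⁆ ≤ ⁅(⊤ : Subgroup F), N i⁆ := by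
  have := A.normal i
  refine le_trans (inf_le_inf_left _ ?_) (A.step i).comm
  rw [commutator_le]
  intro x _ y hy
  rw [(A.step i).eq, mem_sup_of_normal_left] at hy
  obtain ⟨n, hn, m, hm, rfl⟩ := hy
  have h1 : ⁅x, n * m⁆ = ⁅x, n⁆ * (n * ⁅x, m⁆ * n⁻¹) := by
    simp only [commutatorElement_def]
    group
  rw [h1]
  refine mul_mem (le_sup_left (a := ⁅(⊤ : Subgroup F), N i⁆)
    (commutator_mem_commutator (mem_top x) hn)) (le_sup_right (a := ⁅(⊤ : Subgroup F), N i⁆) ?_)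
  refine normalClosure_normal.conj_mem _ ?_ n
  exact commutator_le_right ⊤ _ (commutator_mem_commutator (mem_top x) hm)

theorem commutator_add_le (A : RelSeq N r g) (i k : ℕ) :
    N i ⊓ ⁅(⊤ : Subgroup F), N (i + k)⁆ ≤ ⁅(⊤ : Subgroup F), N i⁆ := by
  induction k with
  | zero => exact inf_le_right
  | succ k ih =>
    refine le_trans (le_inf inf_le_left ?_) ih
    exact le_trans (inf_le_inf_right _ (A.mono (Nat.le_add_right i k)))
      (A.commutator_succ_le (i + k))

/-- The relation module of the limit group modulo the action is not finitely generated. -/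
theorem not_fg (A : RelSeq N r g) {R : Subgroup F} (hR : R = ⨆ i, N i)
    [⁅(⊤ : Subgroup F), R⁆.Normal] :
    ¬ (R.map (QuotientGroup.mk' ⁅(⊤ : Subgroup F), R⁆)).FG := by
  have hmem : ∀ {x : F}, x ∈ R ↔ ∃ i, x ∈ N i := by rw [hR]; exact A.mem_iSup
  have hle : ∀ i, N i ≤ R := fun i => hR ▸ le_iSup N i
  have hRn : R.Normal := hR ▸ A.normal_iSup
  have hcom : ∀ {x : F}, x ∈ ⁅(⊤ : Subgroup F), R⁆ → ∃ i, x ∈ ⁅(⊤ : Subgroup F), N i⁆ := by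
    have hd : Monotone fun i => ⁅(⊤ : Subgroup F), N i⁆ :=
      fun i j hij => commutator_mono le_rfl (A.mono hij)
    have : ⁅(⊤ : Subgroup F), R⁆ ≤ ⨆ i, ⁅(⊤ : Subgroup F), N i⁆ := by
      rw [commutator_le]
      intro x _ y hy
      obtain ⟨i, hi⟩ := hmem.1 hy
      exact (mem_iSup_of_directed hd.directed_le).2
        ⟨i, commutator_mem_commutator (mem_top x) hi⟩
    exact fun {x} hx => (mem_iSup_of_directed hd.directed_le).1 (this hx)
  intro hfg
  obtain ⟨p, hp⟩ : ∃ p, p = QuotientGroup.mk' ⁅(⊤ : Subgroup F), R⁆ := ⟨_, rfl⟩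
  have hpk : p.ker = ⁅(⊤ : Subgroup F), R⁆ := by rw [hp, QuotientGroup.ker_mk']
  rw [← hp] at hfg
  obtain ⟨S, hS⟩ := hfg
  have h1 : ∃ i, R.map p ≤ (N i).map p := by
    have h2 : ∀ s, ∃ i, s ∈ S → s ∈ (N i).map p := by
      intro s
      by_cases hs : s ∈ S
      · have h3 : s ∈ R.map p := hS ▸ subset_closure hs
        obtain ⟨x, hx, rfl⟩ := h3
        obtain ⟨i, hi⟩ := hmem.1 hx
        exact ⟨i, fun _ => mem_map_of_mem p hi⟩
      · exact ⟨0, fun h => absurd h hs⟩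
    choose k hk using h2
    refine ⟨S.sup k, ?_⟩
    rw [← hS, closure_le]
    exact fun s hs => Subgroup.map_mono (A.mono (Finset.le_sup hs)) (hk s hs)
  obtain ⟨i, hi⟩ := h1
  have hri : r i ∈ N (i + 1) := by
    rw [(A.step i).eq]
    exact le_sup_right (a := N i) (subset_normalClosure rfl)
  obtain ⟨n, hn, hnr⟩ := hi (mem_map_of_mem p (hle _ hri))
  have h2 : n⁻¹ * r i ∈ ⁅(⊤ : Subgroup F), R⁆ := by
    rw [← hpk, MonoidHom.mem_ker, map_mul, map_inv, hnr, inv_mul_cancel]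
  obtain ⟨j, hj⟩ := hcom h2
  have hn' : n⁻¹ * r i ∈ N (i + 1) :=
    (N (i + 1)).mul_mem ((N (i + 1)).inv_mem (A.mono (Nat.le_succ i) hn)) hri
  have h3 : n⁻¹ * r i ∈ ⁅(⊤ : Subgroup F), N (i + 1)⁆ :=
    A.commutator_add_le (i + 1) j ⟨hn',
      commutator_mono le_rfl (A.mono (Nat.le_add_left j (i + 1))) hj⟩
  apply (A.step i).free
  have h4 : r i = n * (n⁻¹ * r i) := by group
  rw [h4]
  exact mul_mem (le_sup_left (b := ⁅(⊤ : Subgroup F), N (i + 1)⁆) hn)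
    (le_sup_right (a := N i) h3)

end RelSeq
end

section

open Subgroup
open scoped commutatorElement

theorem commGroup_subgroup_fg {A : Type*} [CommGroup A] [Group.FG A] (B : Subgroup A) : B.FG := by
  have : Module.Finite ℤ (Additive A) := Module.Finite.iff_addGroup_fg.2 inferInstance
  rw [Subgroup.fg_iff_add_fg]
  have := IsNoetherian.noetherian (AddSubgroup.toIntSubmodule B.toAddSubgroup)
  rw [Submodule.fg_iff_addSubgroup_fg] at this
  exact this

/-- A subgroup of a finitely generated group is finitely generated if its intersection with the
commutator subgroup is. -/
theorem fg_of_fg_inf_commutator {E : Type*} [Group E] [Group.FG E] {A : Subgroup E}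
    (h : (A ⊓ commutator E).FG) : A.FG := by
  have : Group.FG (Abelianization E) :=
    Group.fg_of_surjective (f := Abelianization.of) (QuotientGroup.mk'_surjective _)
  obtain ⟨S, hS⟩ := commGroup_subgroup_fg (A.map Abelianization.of)
  have h1 : ∀ s, ∃ x, s ∈ S → x ∈ A ∧ Abelianization.of x = s := by
    intro s
    by_cases hs : s ∈ S
    · have h3 : s ∈ A.map Abelianization.of := hS ▸ subset_closure hs
      obtain ⟨x, hx, hxs⟩ := h3
      exact ⟨x, fun _ => ⟨hx, hxs⟩⟩
    · exact ⟨1, fun h => absurd h hs⟩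
  choose k hk using h1
  have hle : Subgroup.closure (k '' S) ≤ A := by
    rw [closure_le]
    rintro _ ⟨s, hs, rfl⟩
    exact (hk s hs).1
  have : A = Subgroup.closure (k '' S) ⊔ (A ⊓ commutator E) := by
    refine le_antisymm (fun a ha => ?_) (sup_le hle inf_le_left)
    have h2 : A.map Abelianization.of ≤ (Subgroup.closure (k '' S)).map Abelianization.of := by
      rw [← hS, closure_le]
      intro s hs
      exact ⟨k s, subset_closure ⟨s, hs, rfl⟩, (hk s hs).2⟩
    obtain ⟨c, hc, hca⟩ := h2 (mem_map_of_mem _ ha)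
    have h3 : a = c * (c⁻¹ * a) := by group
    have h4 : c⁻¹ * a ∈ commutator E := by
      rw [← Abelianization.ker_of, MonoidHom.mem_ker, map_mul, map_inv, hca, inv_mul_cancel]
    rw [h3]
    exact mul_mem (le_sup_left (b := A ⊓ commutator E) hc)
      (le_sup_right (a := Subgroup.closure (k '' S)) ⟨A.mul_mem (A.inv_mem (hle hc)) ha, h4⟩)
  rw [this]
  exact Subgroup.FG.sup ((Subgroup.fg_iff _).2 ⟨_, rfl, S.finite_toSet.image k⟩) h

/-- The Schur multiplier of a group maps onto the kernel of a central extension intersected with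
the commutator subgroup. -/
theorem fg_inf_commutator_of_schurMultiplier {E H : Type} [Group E] [Group H] {p : E →* H}
    (hp : Function.Surjective p) (hc : ∀ a ∈ p.ker, ∀ e, a * e = e * a)
    (h : Group.FG ↥(SchurMultiplier H)) : (p.ker ⊓ commutator E).FG := by
  rw [Group.fg_iff_subgroup_fg] at h
  choose q hq using hp
  obtain ⟨φ, hφ⟩ : ∃ φ : FreeGroup H →* E, φ = FreeGroup.lift q := ⟨_, rfl⟩
  have hcomp : p.comp φ = FreeGroup.lift id := by
    ext x
    simp [hφ, hq]
  obtain ⟨π, hπ⟩ : ∃ π, π = FreeGroup.lift (id : H → H) := ⟨_, rfl⟩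
  rw [← hπ] at hcomp
  have hpφ : ∀ x, p (φ x) = π x := fun x => by rw [← hcomp]; rfl
  unfold SchurMultiplier at h
  rw! [← hπ] at h
  have hkill : ⁅(⊤ : Subgroup (FreeGroup H)), π.ker⁆ ≤ φ.ker := by
    rw [commutator_le]
    intro x _ y hy
    rw [MonoidHom.mem_ker, map_commutatorElement, commutatorElement_eq_one_iff_mul_comm]
    exact (hc _ (by rwa [MonoidHom.mem_ker, hpφ]) _).symm
  have h1 : (Subgroup.map (QuotientGroup.lift _ φ hkill) _).FG :=
    (Subgroup.fg_iff_submonoid_fg _).2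
      (((Subgroup.fg_iff_submonoid_fg _).1 h).map (QuotientGroup.lift _ φ hkill))
  rw [Subgroup.map_map] at h1
  have h2 : (QuotientGroup.lift _ φ hkill).comp (QuotientGroup.mk' _) = φ := by ext; rfl
  rw [h2] at h1
  have hcm : commutator E ≤ (commutator (FreeGroup H)).map φ := by
    have hdec : ∀ e, ∃ a ∈ p.ker, ∃ w, e = a * φ w := by
      intro e
      refine ⟨e * (φ (FreeGroup.of (p e)))⁻¹, ?_, FreeGroup.of (p e), by group⟩
      rw [MonoidHom.mem_ker, map_mul, map_inv, hpφ, hπ]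
      simp
    rw [commutator_def, commutator_le]
    intro x _ y _
    obtain ⟨a, ha, w, rfl⟩ := hdec x
    obtain ⟨a', ha', w', rfl⟩ := hdec y
    refine ⟨⁅w, w'⁆, commutator_mem_commutator (mem_top _) (mem_top _), ?_⟩
    rw [map_commutatorElement]
    have e2 : ∀ x, Commute a' x := hc a' ha'
    have e3 : ∀ x, Commute a x := hc a ha
    have e4 : ⁅a * φ w, a' * φ w'⁆ = ⁅φ w, φ w'⁆ := by
      have e5 : a * φ w * (a' * φ w') = a * a' * (φ w * φ w') := by
        rw [mul_assoc, mul_assoc, ← mul_assoc (φ w) a', ← (e2 (φ w)).eq, mul_assoc]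
      have e6 : a' * φ w' * (a * φ w) = a * a' * (φ w' * φ w) := by
        rw [mul_assoc, ← mul_assoc (φ w') a, ← (e3 (φ w')).eq, mul_assoc a, ← mul_assoc a',
          (e2 a).eq]
      have e7 : ∀ s t : E, ⁅s, t⁆ = s * t * (t * s)⁻¹ := fun s t => by
        rw [commutatorElement_def]; group
      rw [e7, e7, e5, e6, mul_inv_rev (a * a'), ← mul_assoc,
        mul_assoc (a * a'), ((e3 _).mul_left (e2 _)).eq]
      group
    exact e4.symm
  have h3 : p.ker ⊓ commutator E = (π.ker ⊓ commutator (FreeGroup H)).map φ := by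
    apply le_antisymm
    · rintro b ⟨hb1, hb2⟩
      obtain ⟨w, hw, rfl⟩ := hcm hb2
      exact ⟨w, ⟨(hpφ w).symm.trans hb1, hw⟩, rfl⟩
    · rintro _ ⟨w, ⟨hw1, hw2⟩, rfl⟩
      refine ⟨(hpφ w).trans hw1, ?_⟩
      have : (commutator (FreeGroup H)).map φ ≤ commutator E := by
        rw [_root_.commutator_def, _root_.commutator_def, map_commutator]
        exact commutator_mono le_top le_top
      exact this ⟨w, hw2, rfl⟩
  rw [h3]
  exact h1

/-- If `R / [F, R]` is not finitely generated, then neither is the Schur multiplier of `F / R`. -/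
theorem not_fg_schurMultiplier_quotient {F : Type} [Group F] [Group.FG F] {R : Subgroup F}
    [R.Normal] (hR : ¬ (R.map (QuotientGroup.mk' ⁅(⊤ : Subgroup F), R⁆)).FG) :
    ¬ Group.FG ↥(SchurMultiplier (F ⧸ R)) := by
  intro hS
  have hle : ⁅(⊤ : Subgroup F), R⁆ ≤ R := Subgroup.commutator_le_right _ _
  have hker : (QuotientGroup.lift _ (QuotientGroup.mk' R)
      (hle.trans (QuotientGroup.ker_mk' R).ge)).ker =
      R.map (QuotientGroup.mk' ⁅(⊤ : Subgroup F), R⁆) := by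
    rw [QuotientGroup.ker_lift, QuotientGroup.ker_mk']
  have h1 := fg_inf_commutator_of_schurMultiplier
    (p := QuotientGroup.lift _ (QuotientGroup.mk' R) (hle.trans (QuotientGroup.ker_mk' R).ge))
    (QuotientGroup.lift_surjective_of_surjective _ _ (QuotientGroup.mk'_surjective R) _) (by
      rw [hker]
      rintro _ ⟨x, hx, rfl⟩ e
      obtain ⟨e, rfl⟩ := QuotientGroup.mk'_surjective _ e
      have h3 : ⁅e, x⁆ ∈ ⁅(⊤ : Subgroup F), R⁆ :=
        Subgroup.commutator_mem_commutator (Subgroup.mem_top e) hx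
      rw [← QuotientGroup.ker_mk' ⁅(⊤ : Subgroup F), R⁆, MonoidHom.mem_ker,
        map_commutatorElement, commutatorElement_eq_one_iff_mul_comm] at h3
      exact h3.symm) hS
  rw [hker] at h1
  exact hR (fg_of_fg_inf_commutator h1)

end

/-- There exists a Noetherian group whose Schur multiplier is not finitely generated. -/
theorem exists_noetherian_group_with_non_fg_schurMultiplier :
    ∃ (H : Type) (_ : Group H), IsNoetherianGroup H ∧ ¬ Group.FG ↥(SchurMultiplier H) := by
  obtain ⟨N, r, g, A, hg⟩ := exists_relSeq goodKer_bot (x := FreeGroup.of 0) (y := FreeGroup.of 1)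
    (by decide)
  obtain ⟨R, hR⟩ : ∃ R, R = ⨆ i, N i := ⟨_, rfl⟩
  have hRn : R.Normal := hR ▸ A.normal_iSup
  refine ⟨FreeGroup (Fin 2) ⧸ R, inferInstance, A.fg_subgroup hg hR,
    not_fg_schurMultiplier_quotient (A.not_fg hR)⟩
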